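/- (Posterior concentration under hierarchical composition structure.) Assume the nonparametric Gaussian regression model: (X_i, Y_i) i.i.d. with X ∼ P_X on X ⊆ [−a,a]^d and Y | X ∼ N(f_0(X), σ_0²), where f_0 follows the hierarchical composition structure H(N, P) (and ‖f_0‖∞ ≤ F). For ν ∈ [0,1), consider the Bayesian model Y_i ∼ N(T_F ∘ f_{θ,ρν}(X_i), σ²) with DNN architecture (L_n, (d, r_n, …, r_n, 1)), where L_n = ⌈C̃_L log₂ n⌉ and r_n = ⌈C̃_r · max_{(β',d') ∈ P} n^{d'/(2(2β'+d'))}⌉ for the constants C̃_L, C̃_r of the hierarchical approximation lemma, and priors Π_θ satisfying Assumption 1 and Π_{σ²} satisfying Assumption 2. Then, for ε_n = max_{(β',d') ∈ P} n^{−β'/(2β'+d')} (log n)^γ with γ > 2 and any M_n → ∞, the posterior mass Π_n( (θ, σ²) : ‖T_F ∘ f_{θ,ρν} − f_0‖_{2,P_X} + |σ² − σ_0²| > M_n ε_n | D^{(n)} ) → 0 in P_0^n-probability; and in the nonparametric logistic regression model Y | X ∼ Bernoulli(φ(f_0(X))) with model Y_i ∼ Bernoulli(φ(T_F ∘ f_{θ,ρν}(X_i)))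 and Π_θ satisfying Assumption 1, Π_n( θ : ‖φ ∘ T_F ∘ f_{θ,ρν} − φ ∘ f_0‖_{2,P_X} > M_n ε_n | D^{(n)} ) → 0 in P_0^n-probability. -/

import Mathlib

open MeasureTheory ProbabilityTheory Filter
open scoped ENNReal NNReal

noncomputable section

/-- Leaky-ReLU activation. -/
def lrelu (ν x : ℝ) : ℝ := max x (ν * x)

/-- A fully connected Leaky-ReLU network with input dimension `d` and hidden width `r`:
a first affine layer `ℝ^d → ℝ^r`, a list of inner affine layers `ℝ^r → ℝ^r`, and an
output affine layer `ℝ^r → ℝ`.  Each affine layer except the last is followed by the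
componentwise Leaky-ReLU activation.  The number of hidden layers (the depth) is
`hid.length + 1`. -/
structure LNet (d r : ℕ) where
  W0 : Fin r → Fin d → ℝ
  b0 : Fin r → ℝ
  hid : List ((Fin r → Fin r → ℝ) × (Fin r → ℝ))
  Wout : Fin r → ℝ
  bout : ℝ

/-- Evaluation of a Leaky-ReLU network. -/
def LNet.eval (ν : ℝ) {d r : ℕ} (net : LNet d r) (x : Fin d → ℝ) : ℝ :=
  let h := net.hid.foldl
    (fun (h : Fin r → ℝ) p => fun i => lrelu ν ((∑ j, p.1 i j * h j) + p.2 i))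
    (fun i => lrelu ν ((∑ j, net.W0 i j * x j) + net.b0 i))
  (∑ i, net.Wout i * h i) + net.bout

/-- All weights and biases of the network are bounded by `B` in absolute value. -/
def LNet.bounded {d r : ℕ} (net : LNet d r) (B : ℝ) : Prop :=
  (∀ i j, |net.W0 i j| ≤ B) ∧ (∀ i, |net.b0 i| ≤ B) ∧
  (∀ p ∈ net.hid, (∀ i j, |p.1 i j| ≤ B) ∧ (∀ i, |p.2 i| ≤ B)) ∧
  (∀ i, |net.Wout i| ≤ B) ∧ |net.bout| ≤ B

/-- Membership in the class `F_{ρν}^{DNN}(L, r, B)` of Leaky-ReLU networks with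
architecture `(L, (d, r, …, r, 1))` and all parameters bounded by `B`. -/
def memDNN (ν : ℝ) (d L r : ℕ) (B : ℝ) (f : (Fin d → ℝ) → ℝ) : Prop :=
  ∃ net : LNet d r, net.hid.length + 1 = L ∧ net.bounded B ∧ ∀ x, f x = net.eval ν x

/-- The cube `[−a,a]^d`. -/
def cube (a : ℝ) (d : ℕ) : Set (Fin d → ℝ) := {x | ∀ i, x i ∈ Set.Icc (-a) a}

/-- Partial derivative of `f : ℝ^d → ℝ` in coordinate `i`. -/
def pder {d : ℕ} (i : Fin d) (f : (Fin d → ℝ) → ℝ) : (Fin d → ℝ) → ℝ :=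
  fun x => fderiv ℝ f x (Pi.single i 1)

/-- Multi-index partial derivative `∂^α f = ∂_1^{α 1} ⋯ ∂_d^{α d} f`. -/
def pderm {d : ℕ} (α : Fin d → ℕ) (f : (Fin d → ℝ) → ℝ) : (Fin d → ℝ) → ℝ :=
  (List.finRange d).foldr (fun i g => (pder i)^[α i] g) f

/-- Membership in the Hölder ball `H_d^β(K)` on `[−a,a]^d`: `f` is `⌊β⌋`-times
continuously differentiable and there are bounds `S α` on `|∂^α f|` over the cube for all
multi-indices with `|α|₁ < β`, and Hölder constants `H α` for `∂^α f` (with exponent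
`β − ⌊β⌋`, with respect to the sup-norm) for all multi-indices with `|α|₁ = ⌊β⌋`, whose
total sum is at most `K`. -/
def memHolder (a : ℝ) (d : ℕ) (β K : ℝ) (f : (Fin d → ℝ) → ℝ) : Prop :=
  ContDiff ℝ (⌊β⌋₊ : ℕ∞) f ∧
  ∃ S H : (Fin d → Fin (⌊β⌋₊ + 1)) → ℝ,
    (∀ α : Fin d → Fin (⌊β⌋₊ + 1), ((∑ i, (α i : ℕ) : ℕ) : ℝ) < β →
      ∀ x ∈ cube a d, |pderm (fun i => (α i : ℕ)) f x| ≤ S α) ∧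
    (∀ α : Fin d → Fin (⌊β⌋₊ + 1), (∑ i, (α i : ℕ)) = ⌊β⌋₊ →
      ∀ x₁ ∈ cube a d, ∀ x₂ ∈ cube a d, x₁ ≠ x₂ →
        |pderm (fun i => (α i : ℕ)) f x₁ - pderm (fun i => (α i : ℕ)) f x₂| ≤
          H α * ‖x₁ - x₂‖ ^ (β - (⌊β⌋₊ : ℝ))) ∧
    (∑ α ∈ Finset.univ.filter
        (fun α : Fin d → Fin (⌊β⌋₊ + 1) => ((∑ i, (α i : ℕ) : ℕ) : ℝ) < β), S α) +
      (∑ α ∈ Finset.univ.filter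
        (fun α : Fin d → Fin (⌊β⌋₊ + 1) => (∑ i, (α i : ℕ)) = ⌊β⌋₊), H α) ≤ K

/-- `f : ℝ^d → ℝ` follows the hierarchical composition structure `H(N, P)` (with constants
`K, F, C_Lip` and `N_q := 1`): there are functions `f_{l,i}` (`0 ≤ l ≤ q`, `0 ≤ i < N_l`)
such that each `f_{0,i}` is a coordinate projection, each `f_{l,i}` (`1 ≤ l ≤ q`) is
obtained by applying a `C_Lip`-Lipschitz function `g_{l,i} ∈ H_{d_{l,i}}^{β_{l,i}}(K)` with
`(β_{l,i}, d_{l,i}) ∈ P`, `Σᵢ d_{l,i} = N_{l−1}` and `‖g_{l,i}‖_∞ ≤ F` to consecutive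
blocks of the previous level, and `f = f_{q,1}`. -/
def followsHCS (a : ℝ) (d q : ℕ) (N : ℕ → ℕ) (P : Finset (ℝ × ℕ)) (K F CLip : ℝ)
    (f : (Fin d → ℝ) → ℝ) : Prop :=
  0 < q ∧ N q = 1 ∧
  ∃ (fl : ℕ → ℕ → (Fin d → ℝ) → ℝ)
    (βh : ℕ → ℕ → ℝ) (dh : ℕ → ℕ → ℕ)
    (g : (l : ℕ) → (i : ℕ) → (Fin (dh l i) → ℝ) → ℝ),
    (∀ i < N 0, ∃ j : Fin d, ∀ x, fl 0 i x = x j) ∧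
    (∀ l, 1 ≤ l → l ≤ q → ∀ i < N l,
      (βh l i, dh l i) ∈ P ∧
      (∀ y z : Fin (dh l i) → ℝ,
        |g l i y - g l i z| ≤ CLip * Real.sqrt (∑ j, (y j - z j) ^ 2)) ∧
      memHolder (max a (2 * F)) (dh l i) (βh l i) K (g l i) ∧
      (∀ y, |g l i y| ≤ F) ∧
      (∀ x, fl l i x =
        g l i (fun j => fl (l - 1) ((∑ i' ∈ Finset.range i, dh l i') + j) x))) ∧
    (∀ l, 1 ≤ l → l ≤ q → (∑ i ∈ Finset.range (N l), dh l i) = N (l - 1)) ∧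
    (∀ x, f x = fl q 0 x)

/-- `max_{(β',d') ∈ P} n^{−β'/(2β'+d')}`, the hierarchical-composition approximation rate. -/
def maxRate (P : Finset (ℝ × ℕ)) (hP : P.Nonempty) (n : ℕ) : ℝ :=
  P.sup' hP fun p => (n : ℝ) ^ (-(p.1 / (2 * p.1 + p.2)))

/-- `max_{(β',d') ∈ P} n^{d'/(2(2β'+d'))}`, which governs the network width. -/
def maxWidthExp (P : Finset (ℝ × ℕ)) (hP : P.Nonempty) (n : ℕ) : ℝ :=
  P.sup' hP fun p => (n : ℝ) ^ ((p.2 : ℝ) / (2 * (2 * p.1 + p.2)))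

/-- Index type for the parameters `θ` of a DNN with architecture `(L, (d, r, …, r, 1))`:
first-layer weights and biases, the `L−1` inner-layer weight matrices and bias vectors,
and the output-layer weights and bias.  Its cardinality is
`T = (d+1)r + (L−1)(r+1)r + (r+1)`. -/
abbrev ParamIdx (d r L : ℕ) : Type :=
  (Fin r × Fin d) ⊕ Fin r ⊕ (Fin (L - 1) × Fin r × Fin r) ⊕ (Fin (L - 1) × Fin r) ⊕
    Fin r ⊕ Unit

/-- The Leaky-ReLU network with architecture `(L, (d, r, …, r, 1))` determined by the
parameter vector `θ`. -/
def netOfParams (ν : ℝ) (d r L : ℕ) (θ : ParamIdx d r L → ℝ) (x : Fin d → ℝ) : ℝ :=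
  let h0 : Fin r → ℝ := fun i =>
    lrelu ν ((∑ j, θ (Sum.inl (i, j)) * x j) + θ (Sum.inr (Sum.inl i)))
  let h : Fin r → ℝ := (List.finRange (L - 1)).foldl
    (fun h l => fun i =>
      lrelu ν ((∑ j, θ (Sum.inr (Sum.inr (Sum.inl (l, i, j)))) * h j) +
        θ (Sum.inr (Sum.inr (Sum.inr (Sum.inl (l, i))))))) h0
  (∑ i, θ (Sum.inr (Sum.inr (Sum.inr (Sum.inr (Sum.inl i))))) * h i) +
    θ (Sum.inr (Sum.inr (Sum.inr (Sum.inr (Sum.inr ())))))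

/-- Truncation operator `T_F(x) = min(max(x, −F), F)`. -/
def trunc (F x : ℝ) : ℝ := min (max x (-F)) F

/-- The Gaussian density with mean `m` and variance `s`, evaluated at `y`. -/
def gpdf (m s y : ℝ) : ℝ :=
  (Real.sqrt (2 * Real.pi * s))⁻¹ * Real.exp (-((y - m) ^ 2) / (2 * s))

/-- The joint law of `(X, Y)` where `X ∼ P_X` and `Y | X ∼ N(f₀(X), v)`. -/
def gaussRegLaw (d : ℕ) (PX : Measure (Fin d → ℝ)) (f₀ : (Fin d → ℝ) → ℝ) (v : ℝ≥0) :
    Measure ((Fin d → ℝ) × ℝ) :=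
  PX.bind fun x => (gaussianReal (f₀ x) v).map fun y => (x, y)

/-- Posterior mass of the set `A` under prior `prior` and likelihood `lik`. -/
def postMass {α : Type*} [MeasurableSpace α] (prior : Measure α) (lik : α → ℝ)
    (A : Set α) : ℝ≥0∞ :=
  (∫⁻ p in A, ENNReal.ofReal (lik p) ∂prior) / ∫⁻ p, ENNReal.ofReal (lik p) ∂prior

/-- The `L²(P_X)` distance `‖g − h‖_{2,P_X}`. -/
def l2dist (d : ℕ) (PX : Measure (Fin d → ℝ)) (g h : (Fin d → ℝ) → ℝ) : ℝ :=
  Real.sqrt (∫ x, (g x - h x) ^ 2 ∂PX)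

/-- The Gaussian regression likelihood of `(θ, σ²)` given the data `D`. -/
def gaussLik (ν F : ℝ) (d r L : ℕ) {n : ℕ} (D : Fin n → (Fin d → ℝ) × ℝ)
    (p : (ParamIdx d r L → ℝ) × ℝ) : ℝ :=
  ∏ i, gpdf (trunc F (netOfParams ν d r L p.1 (D i).1)) p.2 (D i).2

/-- The sigmoid function `φ(z) = (1 + e^{−z})⁻¹`. -/
def sigmoid (z : ℝ) : ℝ := (1 + Real.exp (-z))⁻¹

/-- The Bernoulli distribution on `ℝ` with success probability `p` (mass `p` at `1` and
`1 − p` at `0`). -/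
def bern (p : ℝ) : Measure ℝ :=
  ENNReal.ofReal p • Measure.dirac 1 + ENNReal.ofReal (1 - p) • Measure.dirac 0

/-- The joint law of `(X, Y)` where `X ∼ P_X` and `Y | X ∼ Bernoulli(φ(f₀(X)))`. -/
def logisticLaw (d : ℕ) (PX : Measure (Fin d → ℝ)) (f₀ : (Fin d → ℝ) → ℝ) :
    Measure ((Fin d → ℝ) × ℝ) :=
  PX.bind fun x => (bern (sigmoid (f₀ x))).map fun y => (x, y)

/-- The logistic-regression (Bernoulli) likelihood of `θ` given the data `D`. -/
def bernLik (ν F : ℝ) (d r L : ℕ) {n : ℕ} (D : Fin n → (Fin d → ℝ) × ℝ)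
    (θ : ParamIdx d r L → ℝ) : ℝ :=
  ∏ i, sigmoid (trunc F (netOfParams ν d r L θ (D i).1)) ^ (D i).2 *
    (1 - sigmoid (trunc F (netOfParams ν d r L θ (D i).1))) ^ (1 - (D i).2)

/-- The depth `L_n = ⌈C̃_L log₂ n⌉` of the Bayesian model. -/
def LdepthH (CL : ℝ) (n : ℕ) : ℕ := ⌈CL * Real.logb 2 n⌉₊

/-- The width `r_n = ⌈C̃_r · max_{(β',d') ∈ P} n^{d'/(2(2β'+d'))}⌉` of the Bayesian model. -/
def rwidthH (Cr : ℝ) (P : Finset (ℝ × ℕ)) (hP : P.Nonempty) (n : ℕ) : ℕ :=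
  ⌈Cr * maxWidthExp P hP n⌉₊


section Warren

open MvPolynomial

variable {ι : Type*} [Fintype ι]

lemma wr_totalDegree_pderiv_le (i : ι) (p : MvPolynomial ι ℝ) :
    (pderiv i p).totalDegree ≤ p.totalDegree := by
  classical
  conv_lhs => rw [p.as_sum]
  rw [map_sum]
  apply totalDegree_finsetSum_le
  intro s hs
  rw [pderiv_monomial]
  refine (totalDegree_monomial_le _ _).trans ?_
  refine le_trans ?_ (le_totalDegree hs)
  change Finsupp.sum _ (fun _ e => e) ≤ Finsupp.sum _ (fun _ e => e)
  rw [Finsupp.sum_fintype _ _ (by simp), Finsupp.sum_fintype _ _ (by simp)]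
  apply Finset.sum_le_sum
  intro j _
  simp

lemma wr_hasDerivAt_eval [DecidableEq ι] (p : MvPolynomial ι ℝ) (θ : ι → ℝ) (j : ι) :
    HasDerivAt (fun t : ℝ => eval (Function.update θ j t) p) (eval θ (pderiv j p)) (θ j) := by
  induction p using MvPolynomial.induction_on with
  | C a => simpa using hasDerivAt_const (θ j) a
  | add p q hp hq => simpa using hp.fun_add hq
  | mul_X p i hp =>
    have h1 : HasDerivAt (fun t : ℝ => Function.update θ j t i)
        (eval θ (pderiv j (X i : MvPolynomial ι ℝ))) (θ j) := by
      by_cases h : i = j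
      · subst h
        simpa using hasDerivAt_id' (θ i)
      · simp [h, pderiv_X_of_ne h]
        exact hasDerivAt_const _ _
    have h2 := hp.mul h1
    simp only [map_mul, eval_X, pderiv_mul, map_add, Function.update_eq_self] at h2 ⊢
    exact h2

lemma wr_growth (p : MvPolynomial ι ℝ) :
    ∃ C : ℝ, ∃ k : ℕ, 0 ≤ C ∧ ∀ θ : ι → ℝ, |eval θ p| ≤ C * (1 + ‖θ‖) ^ k := by
  induction p using MvPolynomial.induction_on with
  | C a => exact ⟨|a|, 0, abs_nonneg _, fun θ => by simp⟩
  | add p q hp hq =>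
    obtain ⟨C, k, hC, h⟩ := hp
    obtain ⟨C', k', hC', h'⟩ := hq
    refine ⟨C + C', k + k', by positivity, fun θ => ?_⟩
    have h1 : (1 : ℝ) ≤ 1 + ‖θ‖ := by linarith [norm_nonneg θ]
    have e1 : (1 + ‖θ‖) ^ k ≤ (1 + ‖θ‖) ^ (k + k') := pow_le_pow_right₀ h1 (by omega)
    have e2 : (1 + ‖θ‖) ^ k' ≤ (1 + ‖θ‖) ^ (k + k') := pow_le_pow_right₀ h1 (by omega)
    rw [map_add]
    calc |eval θ p + eval θ q| ≤ |eval θ p| + |eval θ q| := abs_add_le _ _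
      _ ≤ C * (1 + ‖θ‖) ^ k + C' * (1 + ‖θ‖) ^ k' := add_le_add (h θ) (h' θ)
      _ ≤ C * (1 + ‖θ‖) ^ (k + k') + C' * (1 + ‖θ‖) ^ (k + k') := by gcongr
      _ = _ := by ring
  | mul_X p i hp =>
    obtain ⟨C, k, hC, h⟩ := hp
    refine ⟨C, k + 1, hC, fun θ => ?_⟩
    rw [map_mul, eval_X, abs_mul, pow_succ, ← mul_assoc]
    have h2 : |θ i| ≤ 1 + ‖θ‖ := by
      have := norm_le_pi_norm θ i
      rw [Real.norm_eq_abs] at this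
      linarith
    exact mul_le_mul (h θ) h2 (abs_nonneg _) (by positivity)

lemma wr_tendsto_one (C c : ℝ) (k : ℕ) :
    Tendsto (fun t : ℝ => C * (1 + t) ^ k * Real.exp (-(t - c) ^ 2)) atTop (nhds 0) := by
  have h1 : Tendsto (fun t : ℝ => (1 + t) ^ k * Real.exp (-(1 + t))) atTop (nhds 0) :=
    (Real.tendsto_pow_mul_exp_neg_atTop_nhds_zero k).comp
      (tendsto_atTop_add_const_left atTop 1 tendsto_id)
  have h2 := h1.const_mul |C|
  rw [mul_zero] at h2
  refine squeeze_zero_norm' ?_ h2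
  filter_upwards [eventually_ge_atTop (2 * |c| + 4), eventually_ge_atTop 0] with t ht ht0
  rw [Real.norm_eq_abs, abs_mul, abs_mul, Real.abs_exp, abs_of_nonneg (by positivity : 0 ≤ (1 + t) ^ k),
    mul_assoc]
  gcongr
  have := abs_nonneg c
  have h3 : t / 2 + 2 ≤ t - c := by linarith [le_abs_self c]
  nlinarith

lemma wr_crit (Q : MvPolynomial ι ℝ) (K : Set (ι → ℝ)) (hK : IsClosed K)
    (hop : IsOpen (K ∩ {θ | eval θ Q ≠ 0})) (θ₀ : ι → ℝ) (hθ₀ : θ₀ ∈ K) (hQ : eval θ₀ Q ≠ 0)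
    (c : ι → ℝ) :
    ∃ θ ∈ K, eval θ Q ≠ 0 ∧ ∀ j, eval θ Q * θ j - eval θ (pderiv j Q) = eval θ Q * c j := by
  classical
  set h : (ι → ℝ) → ℝ := fun θ => (eval θ Q) ^ 2 * Real.exp (-∑ j, (θ j - c j) ^ 2) with hh
  have hcQ : Continuous fun θ : ι → ℝ => eval θ Q := MvPolynomial.continuous_eval Q
  have hc : Continuous h := by
    simp only [hh]
    fun_prop
  have hpos : 0 < h θ₀ := by simp only [hh]; positivity
  have htend : Tendsto h (cocompact (ι → ℝ)) (nhds 0) := by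
    obtain ⟨C, k, hC, hg⟩ := wr_growth (Q * Q)
    have := (wr_tendsto_one C ‖c‖ k).comp (tendsto_norm_cocompact_atTop (E := ι → ℝ))
    refine squeeze_zero' (Eventually.of_forall fun θ => by simp only [hh]; positivity) ?_ this
    have hev : ∀ᶠ θ : ι → ℝ in cocompact (ι → ℝ), ‖c‖ ≤ ‖θ‖ :=
      (tendsto_norm_cocompact_atTop (E := ι → ℝ)).eventually_ge_atTop _
    filter_upwards [hev] with θ hθ
    simp only [hh, Function.comp]
    have e1 : (eval θ Q) ^ 2 ≤ C * (1 + ‖θ‖) ^ k := by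
      have := hg θ
      rw [map_mul, ← pow_two] at this
      exact (le_abs_self _).trans this
    have e2 : (‖θ‖ - ‖c‖) ^ 2 ≤ ∑ j, (θ j - c j) ^ 2 := by
      have hs : 0 ≤ ∑ j, (θ j - c j) ^ 2 := Finset.sum_nonneg fun j _ => sq_nonneg _
      have e3 : ‖θ - c‖ ≤ Real.sqrt (∑ j, (θ j - c j) ^ 2) := by
        rw [pi_norm_le_iff_of_nonneg (Real.sqrt_nonneg _)]
        intro i
        rw [Real.norm_eq_abs]
        apply Real.abs_le_sqrt
        exact Finset.single_le_sum (f := fun j => (θ j - c j) ^ 2)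
          (fun j _ => sq_nonneg _) (Finset.mem_univ i)
      have e4 : ‖θ‖ - ‖c‖ ≤ Real.sqrt (∑ j, (θ j - c j) ^ 2) :=
        (norm_sub_norm_le θ c).trans e3
      calc (‖θ‖ - ‖c‖) ^ 2 ≤ (Real.sqrt (∑ j, (θ j - c j) ^ 2)) ^ 2 :=
            pow_le_pow_left₀ (by linarith) e4 2
        _ = _ := Real.sq_sqrt hs
    exact mul_le_mul e1 (Real.exp_le_exp.2 (neg_le_neg e2)) (Real.exp_pos _).le (by positivity)
  obtain ⟨θ, hθK, hmax⟩ := hc.continuousOn.exists_isMaxOn' (s := K) hK hθ₀ (by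
    apply Filter.Eventually.filter_mono inf_le_left
    filter_upwards [htend.eventually (gt_mem_nhds hpos)] with θ hθ using hθ.le)
  have hθQ : eval θ Q ≠ 0 := by
    intro h0
    have := hmax hθ₀
    simp only [Set.mem_ofPred_eq] at this
    have h1 : h θ = 0 := by simp [hh, h0]
    linarith
  refine ⟨θ, hθK, hθQ, fun j => ?_⟩
  have hloc : IsLocalMax (fun t : ℝ => h (Function.update θ j t)) (θ j) := by
    have hcu : Continuous fun t : ℝ => Function.update θ j t := by fun_prop
    have hmem : (K ∩ {θ | eval θ Q ≠ 0}) ∈ nhds (Function.update θ j (θ j)) := by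
      rw [Function.update_eq_self]
      exact hop.mem_nhds ⟨hθK, hθQ⟩
    have := hcu.continuousAt.preimage_mem_nhds hmem
    filter_upwards [this] with t ht
    rw [Function.update_eq_self]
    exact hmax ht.1
  have hd1 := wr_hasDerivAt_eval Q θ j
  have hd2 : HasDerivAt (fun t : ℝ => ∑ i, (Function.update θ j t i - c i) ^ 2)
      (2 * (θ j - c j)) (θ j) := by
    have : ∀ i ∈ (Finset.univ : Finset ι), HasDerivAt
        (fun t : ℝ => (Function.update θ j t i - c i) ^ 2)
        (if i = j then 2 * (θ j - c j) else 0) (θ j) := by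
      intro i _
      by_cases hij : i = j
      · subst hij
        simp only [Function.update_self, if_true]
        simpa using ((hasDerivAt_id' (θ i)).sub_const (c i)).fun_pow 2
      · simp only [hij, if_false, ne_eq, not_false_eq_true, Function.update_of_ne]
        exact hasDerivAt_const _ _
    have := HasDerivAt.fun_sum this
    simpa using this
  have hd3 := (hd1.pow 2).mul hd2.neg.exp
  have hz := hloc.hasDerivAt_eq_zero hd3
  simp only [Function.update_eq_self] at hz
  have hexp := Real.exp_pos (-∑ j, (θ j - c j) ^ 2)
  have hz2 : Real.exp (-∑ j, (θ j - c j) ^ 2) *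
      (2 * eval θ Q * (eval θ (pderiv j Q) - eval θ Q * (θ j - c j))) = 0 := by
    rw [← hz]
    simp
    ring
  have h3 := (mul_eq_zero.1 hz2).resolve_left hexp.ne'
  have h4 := (mul_eq_zero.1 h3).resolve_left (mul_ne_zero two_ne_zero hθQ)
  linarith

end Warren

section Warren2

open MvPolynomial

variable {ι : Type*} [Fintype ι]

lemma wr_kernel {σ : Type*} [Fintype σ] (q : σ → MvPolynomial ι ℝ) (D : ℕ)
    (hq : ∀ i, (q i).totalDegree < D) (hcard : D ^ Fintype.card ι < Fintype.card σ) :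
    ∃ c : σ → ℝ, c ≠ 0 ∧ ∑ i, c i • q i = 0 := by
  classical
  let Λ : (σ → ℝ) →ₗ[ℝ] ((ι → Fin D) → ℝ) :=
    { toFun := fun c s => coeff (Finsupp.equivFunOnFinite.symm fun k => (s k : ℕ)) (∑ i, c i • q i)
      map_add' := by
        intro c c'
        funext s
        simp [add_smul, Finset.sum_add_distrib, coeff_sum]
      map_smul' := by
        intro a c
        funext s
        simp [coeff_sum, Finset.mul_sum, mul_assoc] }
  have hker : LinearMap.ker Λ ≠ ⊥ := by
    apply LinearMap.ker_ne_bot_of_finrank_lt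
    simpa using hcard
  obtain ⟨c, hc, hc0⟩ := (Submodule.ne_bot_iff _).1 hker
  refine ⟨c, hc0, ?_⟩
  ext m
  rw [coeff_zero]
  by_cases hm : ∀ k, m k < D
  · have h1 := congrFun (LinearMap.mem_ker.1 hc) (fun k => (⟨m k, hm k⟩ : Fin D))
    simp only [Λ, LinearMap.coe_mk, AddHom.coe_mk, Pi.zero_apply] at h1
    rw [← h1]
    congr 1
    ext k
    simp
  · push Not at hm
    obtain ⟨k, hk⟩ := hm
    rw [coeff_sum]
    apply Finset.sum_eq_zero
    intro i _
    rw [coeff_smul, coeff_eq_zero_of_totalDegree_lt, smul_zero]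
    refine (hq i).trans_le (hk.trans ?_)
    by_cases hk0 : m k = 0
    · simp [hk0]
    · exact Finset.single_le_sum (f := fun j => m j) (fun j _ => Nat.zero_le _)
        (Finsupp.mem_support_iff.2 hk0)

/-- Linear form with coefficients powers of `t`. -/
def wrLin (ι : Type*) [Fintype ι] (t : ℝ) : MvPolynomial ι ℝ :=
  ∑ k, C (t ^ ((Fintype.equivFin ι k : ℕ))) * X k

lemma wrLin_eval (t : ℝ) (θ : ι → ℝ) :
    eval θ (wrLin ι t) = ∑ k, t ^ ((Fintype.equivFin ι k : ℕ)) * θ k := by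
  simp [wrLin]

lemma wrLin_deg (t : ℝ) : (wrLin ι t).totalDegree ≤ 1 := by
  apply totalDegree_finsetSum_le
  intro k _
  refine (totalDegree_mul _ _).trans ?_
  rw [totalDegree_C, totalDegree_X]

lemma wr_separate {N : ℕ} (θ : Fin N → ι → ℝ) (hθ : Function.Injective θ) :
    ∃ t ∈ Finset.range (N * N * Fintype.card ι + 1),
      Function.Injective fun i => eval (θ i) (wrLin ι (t : ℝ)) := by
  classical
  let R : Fin N × Fin N → Polynomial ℝ := fun p =>
    if p.1 = p.2 then 1 else
      ∑ k, Polynomial.C (θ p.1 k - θ p.2 k) * Polynomial.X ^ ((Fintype.equivFin ι k : ℕ))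
  have hcoef : ∀ p : Fin N × Fin N, p.1 ≠ p.2 → ∀ k, (R p).coeff (Fintype.equivFin ι k : ℕ)
      = θ p.1 k - θ p.2 k := by
    intro p hp k
    simp only [R, hp, if_false, Polynomial.finsetSum_coeff, Polynomial.coeff_C_mul,
      Polynomial.coeff_X_pow]
    rw [Finset.sum_eq_single k]
    · simp
    · intro b _ hb
      have : ¬ ((Fintype.equivFin ι k : ℕ) = (Fintype.equivFin ι b : ℕ)) := by
        intro h
        exact hb ((Fintype.equivFin ι).injective (Fin.ext h)).symm
      simp [this]
    · simp
  have hR0 : ∀ p, R p ≠ 0 := by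
    intro p
    by_cases hp : p.1 = p.2
    · simp [R, hp]
    · intro h0
      apply hp
      apply hθ
      funext k
      have := hcoef p hp k
      rw [h0, Polynomial.coeff_zero] at this
      linarith
  have hRdeg : ∀ p, (R p).natDegree ≤ Fintype.card ι := by
    intro p
    by_cases hp : p.1 = p.2
    · simp [R, hp]
    · simp only [R, hp, if_false]
      apply Polynomial.natDegree_sum_le_of_forall_le
      intro k _
      refine (Polynomial.natDegree_C_mul_X_pow_le _ _).trans ?_
      exact (Fintype.equivFin ι k).2.le
  have hprod : ∏ p, R p ≠ 0 := Finset.prod_ne_zero_iff.2 fun p _ => hR0 p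
  have hdeg : (∏ p, R p).natDegree ≤ N * N * Fintype.card ι := by
    refine (Polynomial.natDegree_prod_le _ _).trans ?_
    refine (Finset.sum_le_card_nsmul _ _ _ fun p _ => hRdeg p).trans ?_
    simp
  have hex : ∃ t ∈ Finset.range (N * N * Fintype.card ι + 1), (∏ p, R p).eval (t : ℝ) ≠ 0 := by
    by_contra hcon
    push Not at hcon
    apply hprod
    refine Polynomial.eq_zero_of_natDegree_lt_card_of_eval_eq_zero' _
      ((Finset.range (N * N * Fintype.card ι + 1)).image fun t : ℕ => (t : ℝ)) ?_ ?_
    · intro x hx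
      obtain ⟨t, ht, rfl⟩ := Finset.mem_image.1 hx
      exact hcon t ht
    · rw [Finset.card_image_of_injective _ Nat.cast_injective, Finset.card_range]
      omega
  obtain ⟨t, ht, hne⟩ := hex
  refine ⟨t, ht, fun i i' hii => ?_⟩
  by_contra hne'
  rw [Polynomial.eval_prod, Finset.prod_ne_zero_iff] at hne
  apply hne (i, i') (Finset.mem_univ _)
  simp only [wrLin_eval] at hii
  simp only [R, hne', if_false, Polynomial.eval_finsetSum, Polynomial.eval_mul,
    Polynomial.eval_C, Polynomial.eval_pow, Polynomial.eval_X, sub_mul, Finset.sum_sub_distrib]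
  rw [sub_eq_zero]
  simpa [mul_comm] using hii

lemma wr_count (Q : MvPolynomial ι ℝ) (N : ℕ) (U : Fin N → Set (ι → ℝ))
    (hdisj : ∀ i j, i ≠ j → Disjoint (U i) (U j))
    (hU : ∀ i, ∀ c : ι → ℝ, ∃ θ ∈ U i, eval θ Q ≠ 0 ∧
      ∀ j, eval θ Q * θ j - eval θ (pderiv j Q) = eval θ Q * c j) :
    N ≤ (1 + Fintype.card ι * (Q.totalDegree + 1)) ^ Fintype.card ι := by
  classical
  by_contra hlt
  push Not at hlt
  have hN : 0 < N := by omega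
  set T := Fintype.card ι with hT
  set E := Q.totalDegree with hE
  let G : ι → MvPolynomial ι ℝ := fun k => Q * X k - pderiv k Q
  have hG : ∀ k, (G k).totalDegree ≤ E + 1 := by
    intro k
    refine (totalDegree_sub _ _).trans (max_le ?_ ?_)
    · refine (totalDegree_mul _ _).trans ?_
      simp [hE]
    · exact (wr_totalDegree_pderiv_le k Q).trans (by omega)
  let q : ℕ → Fin N × (ι → Fin N) → MvPolynomial ι ℝ := fun t p =>
    (wrLin ι (t : ℝ)) ^ (p.1 : ℕ) * ∏ k, (G k ^ (p.2 k : ℕ) * Q ^ (N - 1 - (p.2 k : ℕ)))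
  have hqdeg : ∀ t p, (q t p).totalDegree < N * (1 + T * (E + 1)) := by
    intro t p
    have h1 : ((wrLin ι (t : ℝ)) ^ (p.1 : ℕ)).totalDegree ≤ N - 1 := by
      refine (totalDegree_pow _ _).trans ?_
      have := wrLin_deg (ι := ι) (t : ℝ)
      have h2 := p.1.2
      calc (p.1 : ℕ) * (wrLin ι (t : ℝ)).totalDegree ≤ (p.1 : ℕ) * 1 := by gcongr
        _ ≤ N - 1 := by omega
    have h2 : (∏ k, (G k ^ (p.2 k : ℕ) * Q ^ (N - 1 - (p.2 k : ℕ)))).totalDegree ≤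
        T * ((N - 1) * (E + 1)) := by
      refine (totalDegree_finsetProd _ _).trans ?_
      refine (Finset.sum_le_card_nsmul _ _ ((N - 1) * (E + 1)) fun k _ => ?_).trans ?_
      · refine (totalDegree_mul _ _).trans ?_
        have e1 := (totalDegree_pow (G k) (p.2 k : ℕ)).trans
          (Nat.mul_le_mul_left _ (hG k))
        have e2 := totalDegree_pow Q (N - 1 - (p.2 k : ℕ))
        have e3 : (p.2 k : ℕ) ≤ N - 1 := by have := (p.2 k).2; omega
        obtain ⟨z, hz⟩ := Nat.exists_eq_add_of_le e3
        rw [hz] at e2 ⊢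
        have e4 : (p.2 k : ℕ) + z - (p.2 k : ℕ) = z := by omega
        rw [e4] at e2 ⊢
        have e5 : z * Q.totalDegree ≤ z * (E + 1) := Nat.mul_le_mul_left _ (by omega)
        calc _ ≤ (p.2 k : ℕ) * (E + 1) + z * (E + 1) := by omega
          _ = _ := by ring
      · simp [hT]
    refine ((totalDegree_mul _ _).trans (add_le_add h1 h2)).trans_lt ?_
    have h3 : T * ((N - 1) * (E + 1)) ≤ T * (N * (E + 1)) := by gcongr; omega
    have h4 : N * (1 + T * (E + 1)) = N + T * (N * (E + 1)) := by ring
    omega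
  have hker : ∀ t : ℕ, ∃ c : Fin N × (ι → Fin N) → ℝ, c ≠ 0 ∧ ∑ p, c p • q t p = 0 := by
    intro t
    apply wr_kernel (q t) _ (hqdeg t)
    simp only [Fintype.card_prod, Fintype.card_fin, Fintype.card_fun]
    rw [mul_pow, mul_comm]
    exact Nat.mul_lt_mul_of_pos_right hlt (by positivity)
  choose c hc0 hc using hker
  let A : ℕ → Fin N → MvPolynomial ι ℝ := fun t j =>
    ∑ α : ι → Fin N, monomial (Finsupp.equivFunOnFinite.symm fun k => (α k : ℕ)) (c t (j, α))
  have hA : ∀ t, ∃ j, A t j ≠ 0 := by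
    intro t
    obtain ⟨⟨j, α⟩, hjα⟩ := Function.ne_iff.1 (hc0 t)
    refine ⟨j, fun h0 => hjα ?_⟩
    have h1 : coeff (Finsupp.equivFunOnFinite.symm fun k => (α k : ℕ)) (A t j) = c t (j, α) := by
      simp only [A, coeff_sum, coeff_monomial]
      rw [Finset.sum_eq_single α]
      · simp
      · intro α' _ hne
        rw [if_neg]
        intro h
        apply hne
        funext k
        have := DFunLike.congr_fun h k
        simp at this
        exact Fin.ext this
      · simp
    rw [h0, coeff_zero] at h1
    simpa using h1.symm
  choose j hj using hA
  have hprod : (∏ t ∈ Finset.range (N * N * T + 1), A t (j t)) ≠ 0 :=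
    Finset.prod_ne_zero_iff.2 fun t _ => hj t
  have hv : ∃ v : ι → ℝ, eval v (∏ t ∈ Finset.range (N * N * T + 1), A t (j t)) ≠ 0 := by
    by_contra hcon
    push Not at hcon
    apply hprod
    apply MvPolynomial.funext
    intro v
    rw [hcon v, map_zero]
  obtain ⟨v, hv⟩ := hv
  rw [map_prod, Finset.prod_ne_zero_iff] at hv
  choose θ hθU hθQ hθ using fun i => hU i v
  have hinj : Function.Injective θ := by
    intro i i' h
    by_contra hne
    exact Set.disjoint_left.1 (hdisj i i' hne) (hθU i) (h ▸ hθU i')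
  obtain ⟨t, ht, hsep⟩ := wr_separate θ hinj
  apply hv t ht
  let f : Polynomial ℝ := ∑ j : Fin N, Polynomial.C (eval v (A t j)) * Polynomial.X ^ (j : ℕ)
  have hfdeg : f.natDegree < N := by
    have : f.natDegree ≤ N - 1 := by
      apply Polynomial.natDegree_sum_le_of_forall_le
      intro k _
      refine (Polynomial.natDegree_C_mul_X_pow_le _ _).trans ?_
      have := k.2
      omega
    omega
  have hf0 : f = 0 := by
    refine Polynomial.eq_zero_of_natDegree_lt_card_of_eval_eq_zero f hsep ?_ (by simpa using hfdeg)
    intro i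
    have h1 := congrArg (eval (θ i)) (hc t)
    rw [map_sum, map_zero, Fintype.sum_prod_type] at h1
    have hGe : ∀ k, eval (θ i) (G k) = eval (θ i) Q * v k := by
      intro k
      simp only [G, map_sub, map_mul, eval_X]
      exact hθ i k
    have h2 : ∀ (j : Fin N) (α : ι → Fin N), eval (θ i) (c t (j, α) • q t (j, α)) =
        (eval (θ i) Q) ^ ((N - 1) * T) * (eval v
          (monomial (Finsupp.equivFunOnFinite.symm fun k => (α k : ℕ)) (c t (j, α))) *
          (eval (θ i) (wrLin ι (t : ℝ))) ^ (j : ℕ)) := by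
      intro j α
      rw [smul_eval]
      simp only [q, map_mul, map_pow, map_prod, hGe, eval_monomial]
      have h3 : ∀ k, (eval (θ i) Q * v k) ^ (α k : ℕ) * eval (θ i) Q ^ (N - 1 - (α k : ℕ)) =
          eval (θ i) Q ^ (N - 1) * v k ^ (α k : ℕ) := by
        intro k
        have e3 : (α k : ℕ) ≤ N - 1 := by have := (α k).2; omega
        rw [mul_pow, mul_right_comm, ← pow_add, Nat.add_sub_cancel' e3]
      simp only [h3, Finset.prod_mul_distrib, Finset.prod_const, Finset.card_univ]
      rw [Finsupp.prod_fintype _ _ (by simp), ← pow_mul]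
      simp [hT]
      ring
    simp only [h2, ← Finset.mul_sum, ← Finset.sum_mul] at h1
    have h4 := (mul_eq_zero.1 h1).resolve_left (pow_ne_zero _ (hθQ i))
    simp only [f, Polynomial.eval_finsetSum, Polynomial.eval_mul, Polynomial.eval_C,
      Polynomial.eval_pow, Polynomial.eval_X]
    simp only [A, map_sum]
    exact h4
  have h5 : f.coeff (j t : ℕ) = eval v (A t (j t)) := by
    simp only [f, Polynomial.finsetSum_coeff, Polynomial.coeff_C_mul, Polynomial.coeff_X_pow]
    rw [Finset.sum_eq_single (j t)]
    · simp
    · intro b _ hb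
      have : ¬ ((j t : ℕ) = (b : ℕ)) := fun h => hb (Fin.ext h).symm
      simp [this]
    · simp
  rw [← h5, hf0, Polynomial.coeff_zero]

/-- Warren-type bound on the number of sign patterns. -/
lemma wr_patterns {κ : Type*} [Fintype κ] (p : κ → MvPolynomial ι ℝ) (D : ℕ)
    (hp : ∀ k, (p k).totalDegree ≤ D) (S : Finset (ι → ℝ))
    (hS : ∀ θ ∈ S, ∀ θ' ∈ S, (∀ k, 0 ≤ eval θ (p k) ↔ 0 ≤ eval θ' (p k)) → θ = θ') :
    S.card ≤ (1 + Fintype.card ι * (Fintype.card κ * D + 1)) ^ Fintype.card ι := by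
  classical
  have hη : ∃ η : ℝ, 0 < η ∧ ∀ θ ∈ S, ∀ k, eval θ (p k) < 0 → eval θ (p k) + η < 0 := by
    have h1 : ∀ᶠ η : ℝ in nhdsWithin 0 (Set.Ioi 0),
        ∀ θ ∈ S, ∀ k ∈ (Finset.univ : Finset κ), eval θ (p k) < 0 → eval θ (p k) + η < 0 := by
      rw [Filter.eventually_all_finset]
      intro θ _
      rw [Filter.eventually_all_finset]
      intro k _
      by_cases h : eval θ (p k) < 0
      · have : Set.Ioo 0 (-eval θ (p k)) ∈ nhdsWithin (0 : ℝ) (Set.Ioi 0) :=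
          Ioo_mem_nhdsGT (by linarith)
        filter_upwards [this] with η hη _
        linarith [hη.2]
      · exact Eventually.of_forall fun η h' => absurd h' h
    obtain ⟨η, h2, h3⟩ := (h1.and self_mem_nhdsWithin).exists
    exact ⟨η, h3, fun θ hθ k => h2 θ hθ k (Finset.mem_univ k)⟩
  obtain ⟨η, hη0, hη⟩ := hη
  let p' : κ → MvPolynomial ι ℝ := fun k => p k + C η
  have hp'e : ∀ θ k, eval θ (p' k) = eval θ (p k) + η := fun θ k => by simp [p']
  let Q := ∏ k, p' k
  have hQe : ∀ θ, eval θ Q = ∏ k, eval θ (p' k) := fun θ => by simp [Q, map_prod]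
  have hQ : Q.totalDegree ≤ Fintype.card κ * D := by
    refine (totalDegree_finsetProd _ _).trans ?_
    refine (Finset.sum_le_card_nsmul _ _ D fun k _ => ?_).trans (by simp)
    refine (totalDegree_add _ _).trans (max_le (hp k) ?_)
    simp
  let e := S.equivFin.symm
  let sg : (ι → ℝ) → κ → ℝ := fun θ k => if 0 ≤ eval θ (p k) then 1 else -1
  have hsg : ∀ θ k, sg θ k = 1 ∨ sg θ k = -1 := by
    intro θ k
    simp only [sg]
    split_ifs <;> simp
  have hsgS : ∀ θ ∈ S, ∀ k, 0 < sg θ k * eval θ (p' k) := by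
    intro θ hθ k
    simp only [sg, hp'e]
    split_ifs with h
    · linarith
    · have := hη θ hθ k (not_le.1 h)
      linarith
  let U : Fin S.card → Set (ι → ℝ) := fun i => {θ | ∀ k, 0 < sg (e i) k * eval θ (p' k)}
  have hdisj : ∀ i j, i ≠ j → Disjoint (U i) (U j) := by
    intro i j hij
    rw [Set.disjoint_left]
    intro θ hi hj
    apply hij
    apply e.injective
    apply Subtype.ext
    apply hS _ (e i).2 _ (e j).2
    intro k
    have h1 := hi k
    have h2 := hj k
    simp only [sg] at h1 h2
    constructor
    · intro h
      by_contra h'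
      rw [if_pos h] at h1
      rw [if_neg h'] at h2
      linarith
    · intro h
      by_contra h'
      rw [if_pos h] at h2
      rw [if_neg h'] at h1
      linarith
  have hce : ∀ k, Continuous fun θ : ι → ℝ => eval θ (p' k) :=
    fun k => MvPolynomial.continuous_eval (p' k)
  have := wr_count Q S.card U hdisj ?_
  · refine this.trans ?_
    gcongr
  · intro i c
    let K : Set (ι → ℝ) := {θ | ∀ k, 0 ≤ sg (e i) k * eval θ (p' k)}
    have hKU : K ∩ {θ | eval θ Q ≠ 0} = U i := by
      ext θ
      constructor
      · rintro ⟨h1, h2⟩ k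
        refine lt_of_le_of_ne (h1 k) (Ne.symm ?_)
        have h3 : eval θ Q ≠ 0 := h2
        rw [hQe, Finset.prod_ne_zero_iff] at h3
        apply mul_ne_zero _ (h3 k (Finset.mem_univ k))
        rcases hsg (e i) k with h | h <;> rw [h] <;> norm_num
      · intro h
        refine ⟨fun k => (h k).le, ?_⟩
        change eval θ Q ≠ 0
        rw [hQe, Finset.prod_ne_zero_iff]
        intro k _ h0
        have := h k
        rw [h0, mul_zero] at this
        exact lt_irrefl _ this
    have hKc : IsClosed K := by
      have : K = ⋂ k, {θ | 0 ≤ sg (e i) k * eval θ (p' k)} := by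
        ext θ; simp [K]
      rw [this]
      exact isClosed_iInter fun k => isClosed_le continuous_const (continuous_const.mul (hce k))
    have hUo : IsOpen (U i) := by
      have : U i = ⋂ k, {θ | 0 < sg (e i) k * eval θ (p' k)} := by
        ext θ; simp [U]
      rw [this]
      exact isOpen_iInter_of_finite fun k =>
        isOpen_lt continuous_const (continuous_const.mul (hce k))
    have hmem : ((e i : S) : ι → ℝ) ∈ U i := fun k => hsgS _ (e i).2 k
    rw [← hKU] at hmem hUo
    obtain ⟨θ, h1, h2, h3⟩ := wr_crit Q K hKc hUo _ hmem.1 hmem.2 c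
    exact ⟨θ, hKU ▸ ⟨h1, h2⟩, h2, h3⟩

end Warren2

section NetCount

open MvPolynomial

variable {ι : Type*} [Fintype ι]

/-- The counting bound for sign patterns of `m` polynomials of degree `D` in `T` variables. -/
def wrB (T m D : ℕ) : ℕ := (1 + T * (m * D + 1)) ^ T

lemma wrB_mono {T m m' D D' : ℕ} (hm : m ≤ m') (hD : D ≤ D') : wrB T m D ≤ wrB T m' D' := by
  unfold wrB
  gcongr

lemma wrB_pos (T m D : ℕ) : 0 < wrB T m D := by
  unfold wrB
  positivity

lemma wr_pat_map {κ : Type*} [Fintype κ] (p : κ → MvPolynomial ι ℝ) (D : ℕ)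
    (hp : ∀ k, (p k).totalDegree ≤ D) :
    ∃ τ : (ι → ℝ) → Fin (wrB (Fintype.card ι) (Fintype.card κ) D), ∀ θ θ', τ θ = τ θ' →
      ∀ k, (0 ≤ eval θ (p k) ↔ 0 ≤ eval θ' (p k)) := by
  classical
  let b : (ι → ℝ) → κ → Bool := fun θ k => decide (0 ≤ eval θ (p k))
  let R : Finset (κ → Bool) := Finset.univ.filter fun s => s ∈ Set.range b
  have hR : ∀ s : R, ∃ θ, b θ = s := fun s => (Finset.mem_filter.1 s.2).2
  choose g hg using hR
  have hginj : Function.Injective g := by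
    intro s s' h
    apply Subtype.ext
    rw [← hg s, ← hg s', h]
  have hcard : R.card ≤ wrB (Fintype.card ι) (Fintype.card κ) D := by
    have := wr_patterns p D hp (Finset.univ.image g) (by
      intro θ hθ θ' hθ' h
      obtain ⟨s, _, rfl⟩ := Finset.mem_image.1 hθ
      obtain ⟨s', _, rfl⟩ := Finset.mem_image.1 hθ'
      congr 1
      apply Subtype.ext
      rw [← hg s, ← hg s']
      funext k
      simp only [b, h k])
    rw [Finset.card_image_of_injective _ hginj, Finset.card_univ, Fintype.card_coe] at this
    exact this
  have hbR : ∀ θ, b θ ∈ R := fun θ => Finset.mem_filter.2 ⟨Finset.mem_univ _, ⟨θ, rfl⟩⟩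
  refine ⟨fun θ => Fin.castLE hcard (R.equivFin ⟨b θ, hbR θ⟩), fun θ θ' h k => ?_⟩
  have h1 := R.equivFin.injective (Fin.castLE_injective hcard h)
  have h2 := congrFun (congrArg Subtype.val h1) k
  simpa [b] using h2

/-- A family of functions that is polynomial of degree at most `D` on each of `C` cells. -/
def PPoly {κ : Type*} (u : κ → (ι → ℝ) → ℝ) (C D : ℕ) : Prop :=
  ∃ S : (ι → ℝ) → Fin C, ∀ s, ∃ P : κ → MvPolynomial ι ℝ,
    (∀ k, (P k).totalDegree ≤ D) ∧ ∀ θ, S θ = s → ∀ k, u k θ = eval θ (P k)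

lemma PPoly.mono {κ : Type*} {u : κ → (ι → ℝ) → ℝ} {C C' D D' : ℕ} (h : PPoly u C D)
    (hC : C ≤ C') (hD : D ≤ D') : PPoly u C' D' := by
  obtain ⟨S, hS⟩ := h
  refine ⟨fun θ => Fin.castLE hC (S θ), fun s => ?_⟩
  by_cases hs : ∃ θ, Fin.castLE hC (S θ) = s
  · obtain ⟨θ, hθ⟩ := hs
    obtain ⟨P, h1, h2⟩ := hS (S θ)
    refine ⟨P, fun k => (h1 k).trans hD, fun θ' h' k => h2 θ' ?_ k⟩
    rw [← hθ] at h'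
    exact Fin.castLE_injective hC h'
  · exact ⟨fun _ => 0, fun k => by simp, fun θ h => absurd ⟨θ, h⟩ hs⟩

lemma PPoly.refine {κ : Type*} [Fintype κ] {u : κ → (ι → ℝ) → ℝ} {C D : ℕ} (h : PPoly u C D) :
    ∃ S : (ι → ℝ) → Fin (C * wrB (Fintype.card ι) (Fintype.card κ) D),
      (∀ s, ∃ P : κ → MvPolynomial ι ℝ,
        (∀ k, (P k).totalDegree ≤ D) ∧ ∀ θ, S θ = s → ∀ k, u k θ = eval θ (P k)) ∧
      ∀ θ θ', S θ = S θ' → ∀ k, (0 ≤ u k θ ↔ 0 ≤ u k θ') := by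
  obtain ⟨S, hS⟩ := h
  choose P hP1 hP2 using hS
  choose τ hτ using fun s => wr_pat_map (P s) D (hP1 s)
  refine ⟨fun θ => finProdFinEquiv (S θ, τ (S θ) θ), fun s => ?_, fun θ θ' h k => ?_⟩
  · refine ⟨P (finProdFinEquiv.symm s).1, hP1 _, fun θ hθ k => hP2 _ θ ?_ k⟩
    rw [← hθ]
    simp
  · have h1 := finProdFinEquiv.injective h
    have h2 : S θ = S θ' := congrArg Prod.fst h1
    have h3 : τ (S θ) θ = τ (S θ') θ' := congrArg Prod.snd h1
    rw [hP2 (S θ) θ rfl k, hP2 (S θ) θ' h2.symm k]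
    apply hτ
    rw [h3, h2]

lemma PPoly.count {κ : Type*} [Fintype κ] {u : κ → (ι → ℝ) → ℝ} {C D : ℕ} (h : PPoly u C D)
    (F : Finset (ι → ℝ))
    (hF : ∀ θ ∈ F, ∀ θ' ∈ F, (∀ k, 0 ≤ u k θ ↔ 0 ≤ u k θ') → θ = θ') :
    F.card ≤ C * wrB (Fintype.card ι) (Fintype.card κ) D := by
  obtain ⟨S, _, hS⟩ := h.refine
  have := Finset.card_le_card_of_injOn (s := F) (t := Finset.univ) S (by simp)
    (fun θ hθ θ' hθ' h => hF θ hθ θ' hθ' (hS θ θ' h))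
  simpa using this

lemma lrelu_of_nonneg {ν x : ℝ} (h1 : ν < 1) (hx : 0 ≤ x) : lrelu ν x = x := by
  unfold lrelu
  apply max_eq_left
  nlinarith

lemma lrelu_of_neg {ν x : ℝ} (h1 : ν < 1) (hx : x < 0) : lrelu ν x = ν * x := by
  unfold lrelu
  apply max_eq_right
  nlinarith

lemma PPoly.act {κ : Type*} [Fintype κ] {u : κ → (ι → ℝ) → ℝ} {C D : ℕ} (h : PPoly u C D)
    {ν : ℝ} (hν : ν < 1) :
    PPoly (fun k θ => lrelu ν (u k θ)) (C * wrB (Fintype.card ι) (Fintype.card κ) D) D := by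
  classical
  obtain ⟨S, hS1, hS2⟩ := h.refine
  refine ⟨S, fun s => ?_⟩
  by_cases hs : ∃ θ, S θ = s
  · obtain ⟨θ₀, hθ₀⟩ := hs
    obtain ⟨P, h1, h2⟩ := hS1 s
    refine ⟨fun k => if 0 ≤ u k θ₀ then P k else MvPolynomial.C ν * P k, fun k => ?_,
      fun θ hθ k => ?_⟩
    · dsimp only
      split_ifs
      · exact h1 k
      · refine (totalDegree_mul _ _).trans ?_
        simpa using h1 k
    · have h3 := hS2 θ θ₀ (hθ.trans hθ₀.symm) k
      dsimp only
      split_ifs with h4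
      · rw [lrelu_of_nonneg hν (h3.2 h4), h2 θ hθ k]
      · rw [lrelu_of_neg hν (not_le.1 fun h => h4 (h3.1 h)), h2 θ hθ k]
        simp
  · exact ⟨fun _ => 0, fun k => by simp, fun θ h => absurd ⟨θ, h⟩ hs⟩

lemma PPoly.affine {κ ρ ρ' : Type*} [Fintype ρ] {h : κ × ρ → (ι → ℝ) → ℝ} {C D : ℕ}
    (hh : PPoly h C D) (w : ρ' → ρ → ι) (b : ρ' → ι) :
    PPoly (fun (k : κ × ρ') θ => (∑ j, θ (w k.2 j) * h (k.1, j) θ) + θ (b k.2)) C (D + 1) := by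
  obtain ⟨S, hS⟩ := hh
  refine ⟨S, fun s => ?_⟩
  obtain ⟨P, h1, h2⟩ := hS s
  refine ⟨fun k => (∑ j, X (w k.2 j) * P (k.1, j)) + X (b k.2), fun k => ?_, fun θ hθ k => ?_⟩
  · refine (totalDegree_add _ _).trans (max_le ?_ ?_)
    · apply totalDegree_finsetSum_le
      intro j _
      refine (totalDegree_mul _ _).trans ?_
      have := h1 (k.1, j)
      rw [totalDegree_X]
      omega
    · rw [totalDegree_X]
      omega
  · simp [h2 θ hθ]

lemma PPoly.const {κ : Type*} (x : κ → ℝ) : PPoly (fun k (_ : ι → ℝ) => x k) 1 0 :=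
  ⟨fun _ => 0, fun s => ⟨fun k => MvPolynomial.C (x k), fun k => by simp, fun θ _ k => by simp⟩⟩

lemma PPoly.foldl {m r Λ : ℕ} {ν : ℝ} (hν : ν < 1) (w : Fin Λ → Fin r → Fin r → ι)
    (b : Fin Λ → Fin r → ι) (Dm : ℕ) (ls : List (Fin Λ)) :
    ∀ (h : Fin m → (ι → ℝ) → Fin r → ℝ) (C D : ℕ), D + ls.length ≤ Dm →
      PPoly (fun (k : Fin m × Fin r) θ => h k.1 θ k.2) C D →
      PPoly (fun (k : Fin m × Fin r) θ => (ls.foldl (fun (v : Fin r → ℝ) l => fun i =>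
        lrelu ν ((∑ j, θ (w l i j) * v j) + θ (b l i))) (h k.1 θ)) k.2)
        (C * (wrB (Fintype.card ι) (m * r) Dm) ^ ls.length) (D + ls.length) := by
  induction ls with
  | nil => intro h C D _ hh; simpa using hh
  | cons l ls ih =>
    intro h C D hD hh
    simp only [List.length_cons] at hD
    have h1 := (hh.affine (w l) (b l)).act hν
    have h2 := h1.mono (C' := C * wrB (Fintype.card ι) (m * r) Dm) (D' := D + 1) (by
      gcongr
      apply wrB_mono
      · simp
      · omega) le_rfl
    have h3 := ih (fun k θ i => lrelu ν ((∑ j, θ (w l i j) * h k θ j) + θ (b l i))) _ _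
      (by omega) h2
    have e1 : C * wrB (Fintype.card ι) (m * r) Dm * wrB (Fintype.card ι) (m * r) Dm ^ ls.length =
        C * (wrB (Fintype.card ι) (m * r) Dm) ^ (l :: ls).length := by
      rw [List.length_cons, pow_succ]; ring
    have e2 : D + 1 + ls.length = D + (l :: ls).length := by
      rw [List.length_cons]; omega
    rw [e1, e2] at h3
    exact h3

lemma ppoly_net {d r L m : ℕ} (hL : 1 ≤ L) {ν : ℝ} (hν : ν < 1) (x : Fin m → Fin d → ℝ) :
    PPoly (fun (k : Fin m) (θ : ParamIdx d r L → ℝ) => netOfParams ν d r L θ (x k))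
      ((wrB (Fintype.card (ParamIdx d r L)) (m * r) (L + 1)) ^ L) (L + 1) := by
  have h0 : PPoly (fun (k : Fin m × Fin d) (_ : ParamIdx d r L → ℝ) => x k.1 k.2) 1 0 :=
    PPoly.const _
  have h1 := (h0.affine (fun (i : Fin r) j => (Sum.inl (i, j) : ParamIdx d r L))
    (fun i => Sum.inr (Sum.inl i))).act hν
  have h2 := h1.mono (C' := wrB (Fintype.card (ParamIdx d r L)) (m * r) (L + 1)) (D' := 1) (by
      rw [one_mul]
      apply wrB_mono
      · simp
      · omega) le_rfl
  have h3 := PPoly.foldl hν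
    (fun l i j => (Sum.inr (Sum.inr (Sum.inl (l, i, j))) : ParamIdx d r L))
    (fun l i => Sum.inr (Sum.inr (Sum.inr (Sum.inl (l, i))))) (L + 1) (List.finRange (L - 1))
    (fun k θ i => lrelu ν ((∑ j, θ (Sum.inl (i, j)) * x k j) + θ (Sum.inr (Sum.inl i)))) _ 1
    (by simp; omega) h2
  have h4 := h3.affine (ρ' := Unit)
    (fun _ i => (Sum.inr (Sum.inr (Sum.inr (Sum.inr (Sum.inl i)))) : ParamIdx d r L))
    (fun _ => Sum.inr (Sum.inr (Sum.inr (Sum.inr (Sum.inr ())))))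
  have e1 : wrB (Fintype.card (ParamIdx d r L)) (m * r) (L + 1) *
      wrB (Fintype.card (ParamIdx d r L)) (m * r) (L + 1) ^ (List.finRange (L - 1)).length =
      wrB (Fintype.card (ParamIdx d r L)) (m * r) (L + 1) ^ L := by
    rw [List.length_finRange, ← pow_succ']
    congr 1
    omega
  have e2 : 1 + (List.finRange (L - 1)).length + 1 = L + 1 := by
    rw [List.length_finRange]; omega
  rw [e1, e2] at h4
  obtain ⟨S, hS⟩ := h4
  refine ⟨S, fun s => ?_⟩
  obtain ⟨P, hP1, hP2⟩ := hS s
  exact ⟨fun k => P (k, ()), fun k => hP1 _, fun θ hθ k => hP2 θ hθ (k, ())⟩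

lemma PPoly.thresh {κ ρ : Type*} {u : κ → (ι → ℝ) → ℝ} {C D : ℕ} (h : PPoly u C D)
    (τ : ρ → ℝ) : PPoly (fun (k : κ × ρ) θ => u k.1 θ - τ k.2) C D := by
  obtain ⟨S, hS⟩ := h
  refine ⟨S, fun s => ?_⟩
  obtain ⟨P, h1, h2⟩ := hS s
  refine ⟨fun k => P k.1 - MvPolynomial.C (τ k.2), fun k => ?_, fun θ hθ k => ?_⟩
  · refine (totalDegree_sub _ _).trans (max_le (h1 _) (by simp))
  · simp [h2 θ hθ]

lemma trunc_le {F x : ℝ} : trunc F x ≤ F := min_le_right _ _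

lemma neg_le_trunc {F x : ℝ} (hF : 0 ≤ F) : -F ≤ trunc F x :=
  le_min (le_max_right _ _) (by linarith)

lemma trunc_abs_le {F x : ℝ} (hF : 0 ≤ F) : |trunc F x| ≤ F :=
  abs_le.2 ⟨neg_le_trunc hF, trunc_le⟩

lemma le_trunc_iff {F x τ : ℝ} (h1 : -F < τ) (h2 : τ ≤ F) : τ ≤ trunc F x ↔ τ ≤ x := by
  unfold trunc
  rw [le_min_iff, le_max_iff]
  constructor
  · rintro ⟨h | h, _⟩
    · exact h
    · linarith
  · intro h
    exact ⟨Or.inl h, h2⟩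

lemma net_sep_count {d r L m : ℕ} (hL : 1 ≤ L) {ν : ℝ} (hν : ν < 1) {F η : ℝ}
    (hη : 0 < η) (J : ℕ) (hJ : 2 * F / η ≤ J)
    (x : Fin m → Fin d → ℝ) (A : Finset (ParamIdx d r L → ℝ))
    (hA : ∀ θ ∈ A, ∀ θ' ∈ A, θ ≠ θ' → ∃ k, η <
      |trunc F (netOfParams ν d r L θ (x k)) - trunc F (netOfParams ν d r L θ' (x k))|) :
    A.card ≤ (wrB (Fintype.card (ParamIdx d r L)) (m * (r + (J + 1))) (L + 1)) ^ (L + 1) := by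
  classical
  by_cases hF : 0 ≤ F
  swap
  · have h0 : A.card ≤ 1 := by
      rw [Finset.card_le_one]
      intro θ hθ θ' hθ'
      by_contra hne
      obtain ⟨k, hk⟩ := hA θ hθ θ' hθ' hne
      have : ∀ y, trunc F y = F := fun y => by
        unfold trunc
        apply min_eq_right
        refine le_trans ?_ (le_max_right _ _)
        linarith
      rw [this, this] at hk
      simp at hk
      linarith
    exact h0.trans (Nat.one_le_pow _ _ (wrB_pos _ _ _))
  have h1 := (ppoly_net (r := r) hL hν x).thresh (fun j : Fin (J + 1) => -F + (j : ℕ) * η)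
  have hkey : ∀ θ θ' : ParamIdx d r L → ℝ, ∀ k,
      (∀ kj : Fin m × Fin (J + 1),
        0 ≤ netOfParams ν d r L θ (x kj.1) - (-F + (kj.2 : ℕ) * η) ↔
        0 ≤ netOfParams ν d r L θ' (x kj.1) - (-F + (kj.2 : ℕ) * η)) →
      ¬ η < trunc F (netOfParams ν d r L θ (x k)) - trunc F (netOfParams ν d r L θ' (x k)) := by
    intro θ θ' k h hlt
    set a := trunc F (netOfParams ν d r L θ (x k)) with ha
    set b := trunc F (netOfParams ν d r L θ' (x k)) with hb
    have hb1 : -F ≤ b := neg_le_trunc hF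
    have ha1 : a ≤ F := trunc_le
    have hn0 : 0 ≤ (b + F) / η := div_nonneg (by linarith) hη.le
    let j : ℕ := ⌊(b + F) / η⌋₊ + 1
    have hj1 : (b + F) / η < (j : ℝ) := by simp only [j]; push_cast; exact Nat.lt_floor_add_one _
    have hj2 : (j : ℝ) ≤ (b + F) / η + 1 := by
      simp only [j]; push_cast; linarith [Nat.floor_le hn0]
    have hj3 : b + F < (j : ℝ) * η := by rwa [div_lt_iff₀ hη] at hj1
    have hj4 : (j : ℝ) * η ≤ b + F + η := by
      calc (j : ℝ) * η ≤ ((b + F) / η + 1) * η := by gcongr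
        _ = b + F + η := by field_simp
    have hjJ : j < J + 1 := by
      have : (j : ℝ) ≤ 2 * F / η := by
        rw [le_div_iff₀ hη]; linarith
      have : (j : ℝ) ≤ J := this.trans hJ
      have : j ≤ J := by exact_mod_cast this
      omega
    have hτ1 : -F < -F + (j : ℝ) * η := by linarith
    have hτ2 : -F + (j : ℝ) * η ≤ F := by linarith
    have e1 : -F + (j : ℝ) * η ≤ a := by linarith
    have e2 : ¬ (-F + (j : ℝ) * η ≤ b) := by linarith
    rw [ha, le_trunc_iff hτ1 hτ2] at e1
    rw [hb, le_trunc_iff hτ1 hτ2] at e2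
    have := h (k, ⟨j, hjJ⟩)
    simp only [sub_nonneg] at this
    exact e2 (this.1 e1)
  have h2 := h1.count A (by
    intro θ hθ θ' hθ' h
    by_contra hne
    obtain ⟨k, hk⟩ := hA θ hθ θ' hθ' hne
    rcases lt_abs.1 hk with h3 | h3
    · exact hkey θ θ' k h h3
    · rw [neg_sub] at h3
      exact hkey θ' θ k (fun kj => (h kj).symm) h3)
  refine h2.trans ?_
  rw [pow_succ]
  gcongr
  · apply wrB_mono _ le_rfl
    exact Nat.mul_le_mul_left _ (by omega)
  · apply wrB_mono _ le_rfl
    simp only [Fintype.card_prod, Fintype.card_fin]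
    exact Nat.mul_le_mul_left _ (by omega)

end NetCount

section Cover

lemma continuous_lrelu (ν : ℝ) : Continuous (lrelu ν) := by
  unfold lrelu
  fun_prop

lemma continuous_trunc (F : ℝ) : Continuous (trunc F) := by
  unfold trunc
  fun_prop

lemma cont_sigm : Continuous sigmoid := by
  unfold sigmoid
  refine Continuous.inv₀ (by fun_prop) (fun z => ?_)
  positivity

lemma continuous_net_foldl {E : Type*} [TopologicalSpace E] {r : ℕ} {Λ : Type*} (ν : ℝ)
    (w : Λ → Fin r → Fin r → E → ℝ) (b : Λ → Fin r → E → ℝ)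
    (hw : ∀ l i j, Continuous (w l i j)) (hb : ∀ l i, Continuous (b l i)) (ls : List Λ) :
    ∀ h : E → Fin r → ℝ, Continuous h →
      Continuous (fun e => ls.foldl (fun (v : Fin r → ℝ) l => fun i =>
        lrelu ν ((∑ j, w l i j e * v j) + b l i e)) (h e)) := by
  induction ls with
  | nil => intro h hh; simpa using hh
  | cons l ls ih =>
    intro h hh
    simp only [List.foldl_cons]
    apply ih
    refine continuous_pi fun i => (continuous_lrelu ν).comp ?_
    refine Continuous.add (continuous_finsetSum _ fun j _ => (hw l i j).mul ?_) (hb l i)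
    exact (continuous_apply j).comp hh

lemma continuous_net (ν : ℝ) (d r L : ℕ) :
    Continuous (fun p : (ParamIdx d r L → ℝ) × (Fin d → ℝ) => netOfParams ν d r L p.1 p.2) := by
  unfold netOfParams
  refine Continuous.add (continuous_finsetSum _ fun i _ => Continuous.mul (by fun_prop) ?_)
    (by fun_prop)
  refine (continuous_apply i).comp (continuous_net_foldl ν
    (fun l i j (p : (ParamIdx d r L → ℝ) × (Fin d → ℝ)) =>
      p.1 (Sum.inr (Sum.inr (Sum.inl (l, i, j)))))
    (fun l i p => p.1 (Sum.inr (Sum.inr (Sum.inr (Sum.inl (l, i))))))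
    (by intros; fun_prop) (by intros; fun_prop) _ _ ?_)
  refine continuous_pi fun i => (continuous_lrelu ν).comp ?_
  fun_prop

lemma integral_sq_le_of_prob {X : Type*} [MeasurableSpace X] (PX : Measure X)
    [IsProbabilityMeasure PX] (u : X → ℝ) (hu : Measurable u) {F δ : ℝ} (hF : 0 < F)
    (hb : ∀ x, |u x| ≤ 2 * F) (hs : δ ^ 2 < ∫ x, u x ^ 2 ∂PX) :
    PX.real {x | |u x| ≤ δ / 2} ≤ 1 - 3 * δ ^ 2 / (16 * F ^ 2) := by
  have hm : MeasurableSet {x | |u x| ≤ δ / 2} := measurableSet_le hu.norm measurable_const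
  have h1 : ∫ x, u x ^ 2 ∂PX ≤
      ∫ x, (δ ^ 2 / 4 + (4 * F ^ 2) * ({x | |u x| ≤ δ / 2}ᶜ).indicator (fun _ => (1 : ℝ)) x) ∂PX := by
    apply integral_mono_of_nonneg
    · exact Eventually.of_forall fun x => sq_nonneg _
    · apply Integrable.add (integrable_const _)
      apply Integrable.const_mul
      exact (integrable_const _).indicator hm.compl
    · refine Eventually.of_forall fun x => ?_
      dsimp only
      by_cases hx : |u x| ≤ δ / 2
      · rw [Set.indicator_of_notMem (by simpa using hx)]
        have : u x ^ 2 ≤ (δ / 2) ^ 2 := by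
          rw [← sq_abs]; gcongr
        linarith
      · rw [Set.indicator_of_mem (by simpa using hx)]
        have : u x ^ 2 ≤ (2 * F) ^ 2 := by
          rw [← sq_abs]; gcongr; exact hb x
        nlinarith
  rw [integral_add (integrable_const _)
    (((integrable_const _).indicator hm.compl).const_mul _), integral_const_mul,
    integral_indicator hm.compl] at h1
  simp only [integral_const, probReal_univ, smul_eq_mul, one_mul, mul_one, measureReal_restrict_apply_univ] at h1
  rw [probReal_compl_eq_one_sub hm] at h1
  have h2 : 3 * δ ^ 2 / 4 ≤ 4 * F ^ 2 * (1 - PX.real {x | |u x| ≤ δ / 2}) := by linarith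
  have h3 : 3 * δ ^ 2 / (16 * F ^ 2) ≤ 1 - PX.real {x | |u x| ≤ δ / 2} := by
    rw [div_le_iff₀ (by positivity)]
    linarith
  linarith

lemma exists_sep_points {X α : Type*} [MeasurableSpace X] (PX : Measure X)
    [IsProbabilityMeasure PX] (g : α → X → ℝ) (hg : ∀ a, Measurable (g a)) {F δ : ℝ} (hF : 0 < F)
    (hδ : 0 < δ) (hb : ∀ a x, |g a x| ≤ F) (A : Finset α)
    (hs : ∀ a ∈ A, ∀ b ∈ A, a ≠ b → δ ^ 2 < ∫ x, (g a x - g b x) ^ 2 ∂PX) (m : ℕ)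
    (hm : (A.card : ℝ) ^ 2 * (1 - 3 * δ ^ 2 / (16 * F ^ 2)) ^ m < 1) :
    ∃ x : Fin m → X, ∀ a ∈ A, ∀ b ∈ A, a ≠ b → ∃ k, δ / 2 < |g a (x k) - g b (x k)| := by
  classical
  by_contra hcon
  push Not at hcon
  let Q : α × α → Set (Fin m → X) := fun ab =>
    Set.univ.pi fun _ : Fin m => {x | |g ab.1 x - g ab.2 x| ≤ δ / 2}
  have hcov : (Set.univ : Set (Fin m → X)) ⊆ ⋃ ab ∈ A.offDiag, Q ab := by
    intro x _
    obtain ⟨a, ha, b, hb, hne, h⟩ := hcon x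
    simp only [Set.mem_iUnion]
    exact ⟨(a, b), Finset.mem_offDiag.2 ⟨ha, hb, hne⟩, fun k _ => h k⟩
  have h1 : (1 : ℝ) ≤ ∑ ab ∈ A.offDiag, (Measure.pi fun _ : Fin m => PX).real (Q ab) := by
    calc (1 : ℝ) = (Measure.pi fun _ : Fin m => PX).real Set.univ := by simp
      _ ≤ (Measure.pi fun _ : Fin m => PX).real (⋃ ab ∈ A.offDiag, Q ab) :=
        measureReal_mono hcov (measure_ne_top _ _)
      _ ≤ _ := measureReal_biUnion_finset_le _ _
  have h2 : ∀ ab ∈ A.offDiag, (Measure.pi fun _ : Fin m => PX).real (Q ab) ≤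
      (1 - 3 * δ ^ 2 / (16 * F ^ 2)) ^ m := by
    rintro ⟨a, b⟩ hab
    rw [Finset.mem_offDiag] at hab
    have h3 := integral_sq_le_of_prob PX (fun x => g a x - g b x) ((hg a).sub (hg b)) hF
      (fun x => by
        have h1 := abs_le.1 (hb a x); have h2 := abs_le.1 (hb b x)
        rw [abs_le]; constructor <;> linarith [h1.1, h1.2, h2.1, h2.2])
      (hs a hab.1 b hab.2.1 hab.2.2)
    have h4 : (Measure.pi fun _ : Fin m => PX).real (Q (a, b)) =
        (PX.real {x | |g a x - g b x| ≤ δ / 2}) ^ m := by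
      simp only [Q, measureReal_def, Measure.pi_pi]
      simp
    rw [h4]
    gcongr
  have h5 := h1.trans (Finset.sum_le_sum h2)
  rw [Finset.sum_const, nsmul_eq_mul] at h5
  have hp0 : 0 ≤ (1 - 3 * δ ^ 2 / (16 * F ^ 2)) ^ m := by
    by_contra hneg
    push Not at hneg
    have : (A.offDiag.card : ℝ) * (1 - 3 * δ ^ 2 / (16 * F ^ 2)) ^ m ≤ 0 :=
      mul_nonpos_of_nonneg_of_nonpos (by positivity) hneg.le
    linarith
  have h6 : (A.offDiag.card : ℝ) ≤ (A.card : ℝ) ^ 2 := by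
    rw [Finset.offDiag_card]
    have : A.card * A.card - A.card ≤ A.card ^ 2 := by rw [sq]; omega
    exact_mod_cast this
  have h7 := mul_le_mul_of_nonneg_right h6 hp0
  linarith

lemma exists_cover {α : Type*} (R : α → α → Prop) (hsymm : ∀ a b, R a b → R b a) (N : ℕ)
    (hN : ∀ A : Finset α, A.card = N → (∀ a ∈ A, ∀ b ∈ A, a ≠ b → ¬ R a b) → False)
    (hrefl : ∀ a, R a a) :
    ∃ S : Finset α, S.card ≤ N ∧ ∀ a, ∃ b ∈ S, R a b := by
  classical
  have key : ∀ k : ℕ, (∃ A : Finset α, A.card = k ∧ ∀ a ∈ A, ∀ b ∈ A, a ≠ b → ¬ R a b) ∨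
      ∃ S : Finset α, S.card ≤ k ∧ ∀ a, ∃ b ∈ S, R a b := by
    intro k
    induction k with
    | zero => exact Or.inl ⟨∅, by simp, by simp⟩
    | succ k ih =>
      rcases ih with ⟨A, hA, hsep⟩ | ⟨S, hS, hc⟩
      · by_cases hc : ∀ a, ∃ b ∈ A, R a b
        · exact Or.inr ⟨A, by omega, hc⟩
        · push Not at hc
          obtain ⟨a, ha⟩ := hc
          have haA : a ∉ A := fun h => ha a h (hrefl a)
          refine Or.inl ⟨insert a A, by rw [Finset.card_insert_of_notMem haA, hA], ?_⟩
          intro x hx y hy hne hR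
          rcases Finset.mem_insert.1 hx with rfl | hx2
          · rcases Finset.mem_insert.1 hy with rfl | hy2
            · exact hne rfl
            · exact ha y hy2 hR
          · rcases Finset.mem_insert.1 hy with rfl | hy2
            · exact ha x hx2 (hsymm _ _ hR)
            · exact hsep x hx2 y hy2 hne hR
      · exact Or.inr ⟨S, by omega, hc⟩
  rcases key N with ⟨A, hA, hsep⟩ | h
  · exact (hN A hA hsep).elim
  · exact h

lemma net_cover {d r L : ℕ} (hL : 1 ≤ L) {ν : ℝ} (hν : ν < 1) {F δ : ℝ} (hF : 0 < F)
    (hδ : 0 < δ) (PX : Measure (Fin d → ℝ)) [IsProbabilityMeasure PX] (m J N₀ : ℕ)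
    (hJ : 2 * F / (δ / 2) ≤ J) (h1 : (N₀ : ℝ) ^ 2 * (1 - 3 * δ ^ 2 / (16 * F ^ 2)) ^ m < 1)
    (h2 : (wrB (Fintype.card (ParamIdx d r L)) (m * (r + (J + 1))) (L + 1)) ^ (L + 1) < N₀) :
    ∃ S : Finset (ParamIdx d r L → ℝ), S.card ≤ N₀ ∧ ∀ θ, ∃ θ' ∈ S,
      ∫ x, (trunc F (netOfParams ν d r L θ x) - trunc F (netOfParams ν d r L θ' x)) ^ 2 ∂PX
        ≤ δ ^ 2 := by
  apply exists_cover
  · intro a b h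
    refine le_of_eq_of_le ?_ h
    congr 1
    funext x
    ring
  · intro A hA hsep
    obtain ⟨x, hx⟩ := exists_sep_points PX (fun θ x => trunc F (netOfParams ν d r L θ x))
      (fun θ => ((continuous_trunc F).comp ((continuous_net ν d r L).comp
        (Continuous.prodMk_right θ))).measurable) hF hδ
      (fun θ x => trunc_abs_le hF.le) A
      (fun a ha b hb hne => not_le.1 (hsep a ha b hb hne)) m (by rw [hA]; exact h1)
    have := net_sep_count hL hν (half_pos hδ) J hJ x A hx
    omega
  · intro a
    simp
    positivity

end Cover


section Posterior

lemma lintegral_pi_prod {Z : Type*} [MeasurableSpace Z] (μ : Measure Z) [IsProbabilityMeasure μ]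
    (n : ℕ) (h : Z → ℝ≥0∞) (hh : Measurable h) :
    ∫⁻ D, ∏ i, h (D i) ∂(Measure.pi fun _ : Fin n => μ) = (∫⁻ z, h z ∂μ) ^ n := by
  have hind : iIndepFun (fun (i : Fin n) (D : Fin n → Z) => h (D i))
      (Measure.pi fun _ : Fin n => μ) :=
    iIndepFun_pi (μ := fun _ : Fin n => μ) (X := fun _ => h) (fun _ => hh.aemeasurable)
  rw [lintegral_prod_eq_prod_lintegral_of_indepFun Finset.univ _ hind
    (fun i => hh.comp (measurable_pi_apply i))]
  have : ∀ i : Fin n, ∫⁻ D, h (D i) ∂(Measure.pi fun _ : Fin n => μ) = ∫⁻ z, h z ∂μ := fun i =>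
    (measurePreserving_eval (fun _ : Fin n => μ) i).lintegral_comp hh
  simp [this]

lemma markov_pi {Z : Type*} [MeasurableSpace Z] (μ : Measure Z)
    (h : Z → ℝ≥0∞) (hh : Measurable h) (c e : ℝ≥0∞) (hc : c ≠ 0) (hc' : c ≠ ⊤)
    (he : ∫⁻ z, h z ∂μ ≤ e) : μ {z | c ≤ h z} ≤ e / c :=
  (meas_ge_le_lintegral_div hh.aemeasurable hc hc').trans (by gcongr)

variable {Z Ω : Type*} [MeasurableSpace Z] [MeasurableSpace Ω]

lemma lintegral_swap_bound (μ : Measure Z) [IsProbabilityMeasure μ] (Pr : Measure Ω) [IsProbabilityMeasure Pr]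
    (n : ℕ) (h : Ω → Z → ℝ≥0∞) (hh : Measurable (Function.uncurry h)) (A : Set Ω) (k : ℝ≥0∞)
    (hk : ∀ p ∈ A, ∫⁻ z, h p z ∂μ ≤ k) :
    ∫⁻ D, ∫⁻ p in A, ∏ i, h p (D i) ∂Pr ∂(Measure.pi fun _ : Fin n => μ) ≤ k ^ n * Pr A := by
  have hm : Measurable (Function.uncurry fun (D : Fin n → Z) (p : Ω) => ∏ i, h p (D i)) := by
    apply Finset.measurable_prod
    intro i _
    exact hh.comp (measurable_snd.prodMk ((measurable_pi_apply i).comp measurable_fst))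
  rw [lintegral_lintegral_swap hm.aemeasurable]
  calc _ ≤ ∫⁻ p in A, k ^ n ∂Pr := by
        apply setLIntegral_mono measurable_const
        intro p hp
        rw [lintegral_pi_prod μ n (h p) (hh.comp measurable_prodMk_left)]
        gcongr
        exact hk p hp
    _ = _ := by rw [setLIntegral_const]

lemma evidence_bound (μ : Measure Z) [IsProbabilityMeasure μ] (Pr : Measure Ω)
    [IsProbabilityMeasure Pr] (n : ℕ) (ρ : Ω → Z → ℝ≥0∞) (hρ : Measurable (Function.uncurry ρ))
    (hfin : ∀ p z, ρ p z ≠ ⊤) (B : Set Ω) (χ : ℝ≥0∞)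
    (hB : ∀ p ∈ B, ∫⁻ z, (ρ p z)⁻¹ ∂μ ≤ χ) (b : ℝ≥0∞) (hb0 : b ≠ 0) (hb : b ≤ Pr B)
    (y : ℝ≥0∞) (hy0 : y ≠ 0) (hy : y ≠ ⊤) :
    Measure.pi (fun _ : Fin n => μ) {D | ∫⁻ p, ∏ i, ρ p (D i) ∂Pr ≤ y} ≤ 4 * y * χ ^ n / b := by
  have hm : Measurable (Function.uncurry fun (D : Fin n → Z) (p : Ω) => ∏ i, (ρ p (D i))⁻¹) := by
    apply Finset.measurable_prod
    intro i _
    exact (hρ.comp (measurable_snd.prodMk ((measurable_pi_apply i).comp measurable_fst))).inv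
  have hm2 : ∀ D : Fin n → Z, Measurable fun p => ∏ i, ρ p (D i) := by
    intro D
    apply Finset.measurable_prod
    intro i _
    exact hρ.comp (measurable_id.prodMk measurable_const)
  set β := Pr B with hβ
  have hβ0 : β ≠ 0 := fun h => hb0 (by rw [h] at hb; exact le_antisymm hb bot_le)
  have hβt : β ≠ ⊤ := measure_ne_top _ _
  have hsub : {D : Fin n → Z | ∫⁻ p, ∏ i, ρ p (D i) ∂Pr ≤ y} ⊆
      {D | β ^ 2 / (4 * y) ≤ ∫⁻ p in B, ∏ i, (ρ p (D i))⁻¹ ∂Pr} := by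
    intro D hD
    have hD' : ∫⁻ p, ∏ i, ρ p (D i) ∂Pr ≤ y := hD
    change β ^ 2 / (4 * y) ≤ ∫⁻ p in B, ∏ i, (ρ p (D i))⁻¹ ∂Pr
    set Λ := ∫⁻ p in B, ∏ i, (ρ p (D i))⁻¹ ∂Pr with hΛ
    have hcpos : β / (2 * y) ≠ 0 := by
      apply ENNReal.div_ne_zero.2
      exact ⟨hβ0, ENNReal.mul_ne_top (by simp) hy⟩
    have hct : β / (2 * y) ≠ ⊤ := ENNReal.div_ne_top hβt (mul_ne_zero (by simp) hy0)
    set c := β / (2 * y) with hc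
    have h1 : β ≤ c * y + c⁻¹ * Λ := by
      calc β = ∫⁻ p in B, 1 ∂Pr := by simp [hβ]
        _ ≤ ∫⁻ p in B, (c * ∏ i, ρ p (D i) + c⁻¹ * ∏ i, (ρ p (D i))⁻¹) ∂Pr := by
          apply lintegral_mono
          intro p
          dsimp only
          rw [← ENNReal.prod_inv_distrib (fun i _ j _ _ => Or.inr (hfin _ _)),
            ← ENNReal.mul_inv (Or.inl hcpos) (Or.inl hct)]
          rcases le_total 1 (c * ∏ i, ρ p (D i)) with h | h
          · exact h.trans le_self_add
          · exact (ENNReal.one_le_inv.2 h).trans le_add_self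
        _ = c * (∫⁻ p in B, ∏ i, ρ p (D i) ∂Pr) + c⁻¹ * Λ := by
          rw [lintegral_add_left ((hm2 D).const_mul c), lintegral_const_mul _ (hm2 D),
            lintegral_const_mul _ (show Measurable fun p => ∏ i, (ρ p (D i))⁻¹ from
              hm.comp measurable_prodMk_left)]
        _ ≤ _ := by
          gcongr
          exact (setLIntegral_le_lintegral _ _).trans hD'
    by_cases hΛt : Λ = ⊤
    · rw [hΛt]; exact le_top
    have hyR : 0 < y.toReal := ENNReal.toReal_pos hy0 hy
    have hβR : 0 < β.toReal := ENNReal.toReal_pos hβ0 hβt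
    rw [← ENNReal.toReal_le_toReal (ENNReal.div_ne_top (by simpa using hβt)
      (mul_ne_zero (by simp) hy0)) hΛt]
    have h2 := ENNReal.toReal_mono (ENNReal.add_ne_top.2 ⟨ENNReal.mul_ne_top hct hy,
      ENNReal.mul_ne_top (ENNReal.inv_ne_top.2 hcpos) hΛt⟩) h1
    rw [ENNReal.toReal_add (ENNReal.mul_ne_top hct hy)
      (ENNReal.mul_ne_top (ENNReal.inv_ne_top.2 hcpos) hΛt)] at h2
    simp only [hc, ENNReal.toReal_mul, ENNReal.toReal_div, ENNReal.toReal_inv,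
      ENNReal.toReal_ofNat, ENNReal.toReal_pow] at h2 ⊢
    rw [div_le_iff₀ (by positivity)]
    have h3 : β.toReal / (2 * y.toReal) * y.toReal = β.toReal / 2 := by field_simp
    have h4 : (β.toReal / (2 * y.toReal))⁻¹ * Λ.toReal = 2 * y.toReal * Λ.toReal / β.toReal := by
      field_simp
    rw [h3, h4] at h2
    have h5 : β.toReal / 2 ≤ 2 * y.toReal * Λ.toReal / β.toReal := by linarith
    rw [le_div_iff₀ hβR] at h5
    nlinarith
  refine (measure_mono hsub).trans ?_
  refine (markov_pi _ _ hm.lintegral_prod_right' _ (χ ^ n * β) ?_ ?_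
    (lintegral_swap_bound μ Pr n (fun p z => (ρ p z)⁻¹) hρ.inv B χ hB)).trans ?_
  · exact ENNReal.div_ne_zero.2 ⟨pow_ne_zero _ hβ0, ENNReal.mul_ne_top (by simp) hy⟩
  · exact ENNReal.div_ne_top (by simpa using hβt) (mul_ne_zero (by simp) hy0)
  · have : χ ^ n * β / (β ^ 2 / (4 * y)) = 4 * y * χ ^ n / β := by
      rw [div_eq_mul_inv, ENNReal.inv_div (Or.inr (by simpa using hβt))
        (Or.inr (pow_ne_zero _ hβ0)), sq, div_eq_mul_inv, div_eq_mul_inv,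
        ENNReal.mul_inv (Or.inl hβ0) (Or.inl hβt)]
      calc χ ^ n * β * (4 * y * (β⁻¹ * β⁻¹)) = 4 * y * χ ^ n * β⁻¹ * (β * β⁻¹) := by ring
        _ = _ := by rw [ENNReal.mul_inv_cancel hβ0 hβt, mul_one]
    rw [this]
    gcongr

lemma post_bound (μ : Measure Z) [IsProbabilityMeasure μ] (Pr : Measure Ω)
    [IsProbabilityMeasure Pr] (n : ℕ) (ρ : Ω → Z → ℝ≥0∞) (hρ : Measurable (Function.uncurry ρ))
    (hfin : ∀ p z, ρ p z ≠ ⊤) {κ : Type*} [Fintype κ] (A : Set Ω) (Aj : κ → Set Ω)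
    (hA : A ⊆ ⋃ j, Aj j) (k : ℝ≥0∞)
    (hw : ∀ j, ∃ w : Z → ℝ≥0∞, Measurable w ∧ (∀ z, w z ≠ 0 ∧ w z ≠ ⊤) ∧
      (∀ p ∈ Aj j, ∫⁻ z, ρ p z * w z ∂μ ≤ k) ∧ ∫⁻ z, (w z)⁻¹ ∂μ ≤ k)
    (B : Set Ω) (χ : ℝ≥0∞)
    (hB : ∀ p ∈ B, ∫⁻ z, (ρ p z)⁻¹ ∂μ ≤ χ) (b : ℝ≥0∞) (hb0 : b ≠ 0) (hb : b ≤ Pr B)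
    (y : ℝ≥0∞) (hy0 : y ≠ 0) (hy : y ≠ ⊤) (δ : ℝ≥0∞) (hδ : δ ≠ 0) (hδt : δ ≠ ⊤) :
    Measure.pi (fun _ : Fin n => μ)
      {D | δ < (∫⁻ p in A, ∏ i, ρ p (D i) ∂Pr) / ∫⁻ p, ∏ i, ρ p (D i) ∂Pr} ≤
      4 * y * χ ^ n / b + (Fintype.card κ * k ^ n + Fintype.card κ * k ^ n / (δ * y)) := by
  choose w hwm hwf hw1 hw2 using hw
  have hmj : ∀ j, Measurable (Function.uncurry fun (p : Ω) (z : Z) => ρ p z * w j z) := fun j =>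
    hρ.mul ((hwm j).comp measurable_snd)
  have hmj2 : ∀ j, Measurable (Function.uncurry fun (D : Fin n → Z) (p : Ω) =>
      ∏ i, (ρ p (D i) * w j (D i))) := by
    intro j
    apply Finset.measurable_prod
    intro i _
    exact (hmj j).comp (measurable_snd.prodMk ((measurable_pi_apply i).comp measurable_fst))
  have hmS : Measurable fun D : Fin n → Z =>
      ∑ j, ∫⁻ p in Aj j, ∏ i, (ρ p (D i) * w j (D i)) ∂Pr :=
    Finset.measurable_sum _ fun j _ => (hmj2 j).lintegral_prod_right'
  have hsub : {D : Fin n → Z | δ < (∫⁻ p in A, ∏ i, ρ p (D i) ∂Pr) / ∫⁻ p, ∏ i, ρ p (D i) ∂Pr} ⊆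
      {D | ∫⁻ p, ∏ i, ρ p (D i) ∂Pr ≤ y} ∪ ((⋃ j, {D | 1 ≤ ∏ i, (w j (D i))⁻¹}) ∪
        {D | δ * y ≤ ∑ j, ∫⁻ p in Aj j, ∏ i, (ρ p (D i) * w j (D i)) ∂Pr}) := by
    intro D hD
    by_contra hcon
    simp only [Set.mem_union, Set.mem_iUnion, Set.mem_ofPred_eq, not_or, not_exists, not_le] at hcon
    obtain ⟨h1, h2, h3⟩ := hcon
    have hD' : δ < (∫⁻ p in A, ∏ i, ρ p (D i) ∂Pr) / ∫⁻ p, ∏ i, ρ p (D i) ∂Pr := hD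
    rw [ENNReal.lt_div_iff_mul_lt (Or.inr hδt) (Or.inr hδ)] at hD'
    refine absurd h3 (not_lt.2 ?_)
    calc δ * y ≤ δ * ∫⁻ p, ∏ i, ρ p (D i) ∂Pr := by gcongr
      _ ≤ ∫⁻ p in A, ∏ i, ρ p (D i) ∂Pr := hD'.le
      _ ≤ ∫⁻ p in ⋃ j, Aj j, ∏ i, ρ p (D i) ∂Pr := lintegral_mono_set hA
      _ ≤ ∑' j, ∫⁻ p in Aj j, ∏ i, ρ p (D i) ∂Pr := lintegral_iUnion_le _ _
      _ = ∑ j, ∫⁻ p in Aj j, ∏ i, ρ p (D i) ∂Pr := tsum_fintype _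
      _ ≤ _ := by
        apply Finset.sum_le_sum
        intro j _
        apply lintegral_mono
        intro p
        dsimp only
        rw [Finset.prod_mul_distrib]
        have h4 := h2 j
        rw [← ENNReal.prod_inv_distrib (fun i _ i' _ _ => Or.inr (hwf _ _).2),
          ENNReal.inv_lt_one] at h4
        exact le_mul_of_one_le_right zero_le h4.le
  refine (measure_mono hsub).trans ((measure_union_le _ _).trans (add_le_add
    (evidence_bound μ Pr n ρ hρ hfin B χ hB b hb0 hb y hy0 hy)
    ((measure_union_le _ _).trans (add_le_add ?_ ?_))))
  · refine (measure_iUnion_le _).trans ?_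
    rw [tsum_fintype]
    calc _ ≤ ∑ j : κ, k ^ n := by
          apply Finset.sum_le_sum
          intro j _
          refine (markov_pi _ _ ?_ 1 (k ^ n) one_ne_zero ENNReal.one_ne_top ?_).trans (by simp)
          · apply Finset.measurable_prod
            intro i _
            exact ((hwm j).comp (measurable_pi_apply i)).inv
          · rw [lintegral_pi_prod μ n (fun z => (w j z)⁻¹) (hwm j).inv]
            gcongr
            exact hw2 j
      _ = _ := by simp
  · apply markov_pi _ _ hmS _ _ (mul_ne_zero hδ hy0) (ENNReal.mul_ne_top hδt hy)
    rw [lintegral_finsetSum _ fun j _ => (show Measurable fun D : Fin n → Z =>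
      ∫⁻ p in Aj j, ∏ i, (ρ p (D i) * w j (D i)) ∂Pr from (hmj2 j).lintegral_prod_right')]
    calc _ ≤ ∑ j : κ, k ^ n := by
          apply Finset.sum_le_sum
          intro j _
          refine (lintegral_swap_bound μ Pr n (fun p z => ρ p z * w j z) (hmj j) (Aj j) k
            (hw1 j)).trans ?_
          calc k ^ n * Pr (Aj j) ≤ k ^ n * 1 := by gcongr; exact prob_le_one
            _ = _ := mul_one _
      _ = _ := by simp

lemma postMass_eq_ratio (Pr : Measure Ω) {n : ℕ} (D : Fin n → Z) (ℓ : Ω → Z → ℝ≥0∞)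
    (hℓ : Measurable (Function.uncurry ℓ))
    (ℓ0 : Z → ℝ≥0∞) (h0 : ∀ i, ℓ0 (D i) ≠ 0) (ht : ∀ i, ℓ0 (D i) ≠ ⊤) (lik : Ω → ℝ)
    (hlik : ∀ p, ENNReal.ofReal (lik p) = ∏ i, ℓ p (D i)) (A : Set Ω) :
    postMass Pr lik A = (∫⁻ p in A, ∏ i, (ℓ p (D i) / ℓ0 (D i)) ∂Pr) /
      ∫⁻ p, ∏ i, (ℓ p (D i) / ℓ0 (D i)) ∂Pr := by
  have hc0 : ∏ i, ℓ0 (D i) ≠ 0 := Finset.prod_ne_zero_iff.2 fun i _ => h0 i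
  have hct : ∏ i, ℓ0 (D i) ≠ ⊤ := ENNReal.prod_ne_top fun i _ => ht i
  have h1 : ∀ p, ENNReal.ofReal (lik p) = (∏ i, ℓ0 (D i)) * ∏ i, (ℓ p (D i) / ℓ0 (D i)) := by
    intro p
    rw [hlik, ← Finset.prod_mul_distrib]
    refine Finset.prod_congr rfl fun i _ => ?_
    rw [ENNReal.mul_div_cancel (h0 i) (ht i)]
  have hm : Measurable fun p => ∏ i, (ℓ p (D i) / ℓ0 (D i)) := by
    apply Finset.measurable_prod
    intro i _
    exact (hℓ.comp (measurable_id.prodMk measurable_const)).div_const _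
  unfold postMass
  simp only [h1]
  rw [lintegral_const_mul _ hm, lintegral_const_mul _ hm, ENNReal.mul_div_mul_left _ _ hc0 hct]

end Posterior


section Laws

lemma gauss_lintegral {d : ℕ} (PX : Measure (Fin d → ℝ)) (f₀ : (Fin d → ℝ) → ℝ)
    (hf : Measurable f₀) {v : ℝ} (hv : 0 < v) (h : (Fin d → ℝ) × ℝ → ℝ≥0∞) (hh : Measurable h) :
    ∫⁻ z, h z ∂(gaussRegLaw d PX f₀ (Real.toNNReal v)) =
      ∫⁻ x, (∫⁻ y, h (x, y) * ENNReal.ofReal (gpdf (f₀ x) v y)) ∂PX := by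
  have hv' : Real.toNNReal v ≠ 0 := by simpa using hv
  have hker : Measurable fun x => (gaussianReal (f₀ x) (Real.toNNReal v)).map fun y => (x, y) := by
    refine Measure.measurable_of_measurable_coe _ fun s hs => ?_
    have h1 : ∀ x, ((gaussianReal (f₀ x) (Real.toNNReal v)).map fun y => (x, y)) s =
        gaussianReal 0 (Real.toNNReal v)
          (Prod.mk x ⁻¹' ((fun p : (Fin d → ℝ) × ℝ => (p.1, f₀ p.1 + p.2)) ⁻¹' s)) := by
      intro x
      rw [Measure.map_apply measurable_prodMk_left hs]
      have h2 := gaussianReal_map_const_add (μ := 0) (v := Real.toNNReal v) (f₀ x)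
      rw [zero_add] at h2
      rw [← h2, Measure.map_apply (measurable_const_add _) (measurable_prodMk_left hs)]
      rfl
    simp only [h1]
    apply measurable_measure_prodMk_left
    refine measurableSet_preimage ?_ hs
    exact measurable_fst.prodMk ((hf.comp measurable_fst).add measurable_snd)
  unfold gaussRegLaw
  rw [Measure.lintegral_bind hker.aemeasurable hh.aemeasurable]
  refine lintegral_congr fun x => ?_
  rw [lintegral_map hh measurable_prodMk_left, gaussianReal_of_var_ne_zero _ hv',
    lintegral_withDensity_eq_lintegral_mul _ (measurable_gaussianPDF _ _)
      (show Measurable fun y => h (x, y) from hh.comp measurable_prodMk_left)]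
  refine lintegral_congr fun y => ?_
  simp only [Pi.mul_apply, Function.comp, gaussianPDF, gaussianPDFReal, gpdf, Real.coe_toNNReal v hv.le]
  rw [mul_comm]

lemma sigmoid_mem (z : ℝ) : 0 < sigmoid z ∧ sigmoid z < 1 := by
  unfold sigmoid
  have := Real.exp_pos (-z)
  refine ⟨by positivity, ?_⟩
  apply inv_lt_one_of_one_lt₀
  linarith

lemma logis_lintegral {d : ℕ} (PX : Measure (Fin d → ℝ)) (f₀ : (Fin d → ℝ) → ℝ)
    (hf : Measurable f₀) (h : (Fin d → ℝ) × ℝ → ℝ≥0∞) (hh : Measurable h) :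
    ∫⁻ z, h z ∂(logisticLaw d PX f₀) =
      ∫⁻ x, (ENNReal.ofReal (sigmoid (f₀ x)) * h (x, 1) +
        ENNReal.ofReal (1 - sigmoid (f₀ x)) * h (x, 0)) ∂PX := by
  have hs1 : Measurable fun x => sigmoid (f₀ x) := cont_sigm.measurable.comp hf
  have hmap : ∀ x, (bern (sigmoid (f₀ x))).map (fun y => (x, y)) =
      ENNReal.ofReal (sigmoid (f₀ x)) • Measure.dirac (x, (1 : ℝ)) +
        ENNReal.ofReal (1 - sigmoid (f₀ x)) • Measure.dirac (x, (0 : ℝ)) := by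
    intro x
    unfold bern
    rw [Measure.map_add _ _ measurable_prodMk_left, Measure.map_smul, Measure.map_smul,
      Measure.map_dirac' measurable_prodMk_left, Measure.map_dirac' measurable_prodMk_left]
  unfold logisticLaw
  have hker : Measurable fun x => (bern (sigmoid (f₀ x))).map (fun y => (x, y)) := by
    refine Measure.measurable_of_measurable_coe _ fun s hs => ?_
    simp only [hmap, Measure.add_apply, Measure.smul_apply, Measure.dirac_apply' _ hs, smul_eq_mul]
    refine Measurable.add (hs1.ennreal_ofReal.mul ?_)
      ((measurable_const.sub hs1).ennreal_ofReal.mul ?_)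
    · exact (measurable_one.indicator hs).comp measurable_prodMk_right
    · exact (measurable_one.indicator hs).comp measurable_prodMk_right
  rw [Measure.lintegral_bind hker.aemeasurable hh.aemeasurable]
  refine lintegral_congr fun x => ?_
  rw [hmap, lintegral_add_measure, lintegral_smul_measure, lintegral_smul_measure,
    lintegral_dirac' _ hh, lintegral_dirac' _ hh]
  rfl

lemma exp_le_quad {z : ℝ} (hz : |z| ≤ 1) : Real.exp z ≤ 1 + z + z ^ 2 := by
  have := Real.abs_exp_sub_one_sub_id_le hz
  linarith [(abs_le.1 this).2]

/-- Integrating a quadratic upper bound. -/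
lemma quad_bound {X : Type*} [MeasurableSpace X] (PX : Measure X) [IsProbabilityMeasure PX]
    (h : X → ℝ≥0∞) (u v : X → ℝ) (hu : Measurable u) (hv : Measurable v) (C : ℝ)
    (hub : ∀ x, |u x| ≤ C) (hvb : ∀ x, |v x| ≤ C) (α β : ℝ)
    (hh : ∀ x, ∃ φ : ℝ, 0 ≤ φ ∧ φ ≤ 1 - α * u x ^ 2 + β * v x ^ 2 ∧ h x ≤ ENNReal.ofReal φ) :
    ∫⁻ x, h x ∂PX ≤
      ENNReal.ofReal (Real.exp (-(α * ∫ x, u x ^ 2 ∂PX) + β * ∫ x, v x ^ 2 ∂PX)) := by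
  have hsq : ∀ w : X → ℝ, Measurable w → (∀ x, |w x| ≤ C) → Integrable (fun x => w x ^ 2) PX := by
    intro w hw hb
    refine Integrable.of_bound (hw.pow_const 2).aestronglyMeasurable (C ^ 2)
      (Eventually.of_forall fun x => ?_)
    rw [Real.norm_eq_abs, abs_pow]
    gcongr
    exact hb x
  have hi : Integrable (fun x => 1 - α * u x ^ 2 + β * v x ^ 2) PX :=
    ((integrable_const _).sub ((hsq u hu hub).const_mul α)).add ((hsq v hv hvb).const_mul β)
  calc ∫⁻ x, h x ∂PX ≤ ∫⁻ x, ENNReal.ofReal (1 - α * u x ^ 2 + β * v x ^ 2) ∂PX := by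
        apply lintegral_mono
        intro x
        obtain ⟨φ, _, h1, h2⟩ := hh x
        exact h2.trans (ENNReal.ofReal_le_ofReal h1)
    _ = ENNReal.ofReal (∫ x, (1 - α * u x ^ 2 + β * v x ^ 2) ∂PX) := by
        rw [ofReal_integral_eq_lintegral_ofReal hi]
        refine Eventually.of_forall fun x => ?_
        obtain ⟨φ, h0, h1, _⟩ := hh x
        exact h0.trans h1
    _ ≤ _ := by
        apply ENNReal.ofReal_le_ofReal
        rw [integral_add (show Integrable (fun x => 1 - α * u x ^ 2) PX from
          (integrable_const _).sub ((hsq u hu hub).const_mul α))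
          ((hsq v hv hvb).const_mul β), integral_sub (integrable_const _)
          ((hsq u hu hub).const_mul α), integral_const_mul, integral_const_mul]
        simp only [integral_const, probReal_univ, smul_eq_mul, mul_one]
        have := Real.add_one_le_exp (-(α * ∫ x, u x ^ 2 ∂PX) + β * ∫ x, v x ^ 2 ∂PX)
        linarith

lemma integral_sq_tri {X : Type*} [MeasurableSpace X] (PX : Measure X) [IsProbabilityMeasure PX]
    (f g h : X → ℝ) (hf : Measurable f) (hg : Measurable g) (hh : Measurable h) (C : ℝ)
    (hfb : ∀ x, |f x| ≤ C) (hgb : ∀ x, |g x| ≤ C) (hhb : ∀ x, |h x| ≤ C) :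
    ∫ x, (f x - h x) ^ 2 ∂PX ≤ 2 * ∫ x, (h x - g x) ^ 2 ∂PX + 2 * ∫ x, (f x - g x) ^ 2 ∂PX := by
  have hsq : ∀ w w' : X → ℝ, Measurable w → Measurable w' → (∀ x, |w x| ≤ C) →
      (∀ x, |w' x| ≤ C) → Integrable (fun x => (w x - w' x) ^ 2) PX := by
    intro w w' hw hw' hb hb'
    refine Integrable.of_bound ((hw.sub hw').pow_const 2).aestronglyMeasurable ((C + C) ^ 2)
      (Eventually.of_forall fun x => ?_)
    rw [Real.norm_eq_abs, abs_pow]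
    gcongr
    exact (abs_sub _ _).trans (add_le_add (hb x) (hb' x))
  rw [← integral_const_mul, ← integral_const_mul, ← integral_add ((hsq h g hh hg hhb hgb).const_mul 2)
    ((hsq f g hf hg hfb hgb).const_mul 2)]
  apply integral_mono (hsq f h hf hh hfb hhb)
    (((hsq h g hh hg hhb hgb).const_mul 2).add ((hsq f g hf hg hfb hgb).const_mul 2))
  intro x
  dsimp only [Pi.add_apply]
  nlinarith [sq_nonneg (f x - g x + (h x - g x))]

end Laws


section Logistic

/-- Bernoulli density in the form used by the likelihood. -/
def bl (η y : ℝ) : ℝ := η ^ y * (1 - η) ^ (1 - y)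

lemma bl_pos {η y : ℝ} (h : 0 < η ∧ η < 1) : 0 < bl η y :=
  mul_pos (Real.rpow_pos_of_pos h.1 _) (Real.rpow_pos_of_pos (by linarith [h.2]) _)

lemma bl_one {η : ℝ} : bl η 1 = η := by simp [bl]

lemma bl_zero {η : ℝ} : bl η 0 = 1 - η := by simp [bl]

lemma measurable_bl : Measurable (Function.uncurry bl) := by
  unfold bl Function.uncurry
  fun_prop

lemma logis_int {d : ℕ} (PX : Measure (Fin d → ℝ)) (f₀ : (Fin d → ℝ) → ℝ)
    (hf : Measurable f₀) (e : (Fin d → ℝ) → ℝ) (he : Measurable e)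
    (w : (Fin d → ℝ) × ℝ → ℝ≥0∞) (hw : Measurable w) :
    ∫⁻ z, ENNReal.ofReal (bl (e z.1) z.2) / ENNReal.ofReal (bl (sigmoid (f₀ z.1)) z.2) * w z
      ∂(logisticLaw d PX f₀) =
    ∫⁻ x, (ENNReal.ofReal (e x) * w (x, 1) + ENNReal.ofReal (1 - e x) * w (x, 0)) ∂PX := by
  have hs1 : Measurable fun x => sigmoid (f₀ x) := cont_sigm.measurable.comp hf
  rw [logis_lintegral PX f₀ hf]
  · refine lintegral_congr fun x => ?_
    simp only [bl_one, bl_zero]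
    have h1 := sigmoid_mem (f₀ x)
    rw [← mul_assoc, ← mul_assoc, ENNReal.mul_div_cancel, ENNReal.mul_div_cancel]
    · simp; exact h1.2
    · exact ENNReal.ofReal_ne_top
    · simp; exact h1.1
    · exact ENNReal.ofReal_ne_top
  · refine Measurable.mul (Measurable.div ?_ ?_) hw
    · exact (measurable_bl.comp ((he.comp measurable_fst).prodMk measurable_snd)).ennreal_ofReal
    · exact (measurable_bl.comp ((hs1.comp measurable_fst).prodMk measurable_snd)).ennreal_ofReal

lemma logis_quad {e e0 ej c1 c0 : ℝ} (he : 0 < e ∧ e < 1) (he0 : 0 < e0 ∧ e0 < 1)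
    (hej : 0 < ej ∧ ej < 1) (h1 : c1 = (1 / 8) * (e0 - ej) * (1 - (e0 + ej) / 2))
    (h0 : c0 = (1 / 8) * (e0 - ej) * (0 - (e0 + ej) / 2)) :
    e * Real.exp c1 + (1 - e) * Real.exp c0 ≤
      1 - (1 / 32) * (e0 - ej) ^ 2 + (1 / 4) * (e - ej) ^ 2 ∧
    e0 * Real.exp (-c1) + (1 - e0) * Real.exp (-c0) ≤ 1 - (1 / 32) * (e0 - ej) ^ 2 := by
  set u := e0 - ej with hu
  set c := (e0 + ej) / 2 with hc
  have hu1 : |u| ≤ 1 := by rw [abs_le]; constructor <;> linarith [he0.1, he0.2, hej.1, hej.2]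
  have hc1 : |1 - c| ≤ 1 := by rw [abs_le]; constructor <;> linarith [he0.1, he0.2, hej.1, hej.2]
  have hc0 : |0 - c| ≤ 1 := by rw [abs_le]; constructor <;> linarith [he0.1, he0.2, hej.1, hej.2]
  have key : ∀ s : ℝ, |s| ≤ 1 → |1 / 8 * u * s| ≤ 1 ∧ (1 / 8 * u * s) ^ 2 ≤ u ^ 2 / 64 := by
    intro s hs
    have hs2 : s ^ 2 ≤ 1 := by rw [← sq_abs]; nlinarith [abs_nonneg s]
    constructor
    · rw [abs_mul, abs_mul]
      have : |(1 / 8 : ℝ)| = 1 / 8 := by norm_num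
      rw [this]
      have := mul_le_mul hu1 hs (abs_nonneg s) zero_le_one
      linarith
    · nlinarith [sq_nonneg u, mul_le_mul_of_nonneg_left hs2 (sq_nonneg u)]
  obtain ⟨k1, k1'⟩ := key (1 - c) hc1
  obtain ⟨k0, k0'⟩ := key (0 - c) hc0
  rw [← h1] at k1 k1'
  rw [← h0] at k0 k0'
  have E1 := exp_le_quad k1
  have E0 := exp_le_quad k0
  have E1' := exp_le_quad (z := -c1) (by rwa [abs_neg])
  have E0' := exp_le_quad (z := -c0) (by rwa [abs_neg])
  constructor
  · have a1 : e * Real.exp c1 ≤ e * (1 + c1 + u ^ 2 / 64) :=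
      mul_le_mul_of_nonneg_left (by linarith) he.1.le
    have a0 : (1 - e) * Real.exp c0 ≤ (1 - e) * (1 + c0 + u ^ 2 / 64) :=
      mul_le_mul_of_nonneg_left (by linarith) (by linarith [he.2])
    have a2 : e * (1 + c1 + u ^ 2 / 64) + (1 - e) * (1 + c0 + u ^ 2 / 64) =
        1 + (1 / 8) * u * ((e - ej) - u / 2) + u ^ 2 / 64 := by
      rw [h1, h0, hc, hu]; ring
    have a3 : 0 ≤ (u / 8 - (e - ej) / 2) ^ 2 := sq_nonneg _
    have a4 : 1 + (1 / 8) * u * ((e - ej) - u / 2) + u ^ 2 / 64 =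
        1 - (1 / 32) * u ^ 2 + (1 / 4) * (e - ej) ^ 2 - (u / 8 - (e - ej) / 2) ^ 2 := by ring
    linarith
  · have a1 : e0 * Real.exp (-c1) ≤ e0 * (1 - c1 + u ^ 2 / 64) :=
      mul_le_mul_of_nonneg_left (by linarith) he0.1.le
    have a0 : (1 - e0) * Real.exp (-c0) ≤ (1 - e0) * (1 - c0 + u ^ 2 / 64) :=
      mul_le_mul_of_nonneg_left (by linarith) (by linarith [he0.2])
    have a2 : e0 * (1 - c1 + u ^ 2 / 64) + (1 - e0) * (1 - c0 + u ^ 2 / 64) =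
        1 - (1 / 8) * u * (u / 2) + u ^ 2 / 64 := by
      rw [h1, h0, hc, hu]; ring
    nlinarith [sq_nonneg u]

lemma logis_test {d : ℕ} (PX : Measure (Fin d → ℝ)) [IsProbabilityMeasure PX]
    (f₀ : (Fin d → ℝ) → ℝ) (hf : Measurable f₀)
    (ej : (Fin d → ℝ) → ℝ) (hej : Measurable ej) (hejm : ∀ x, 0 < ej x ∧ ej x < 1) :
    ∃ w : (Fin d → ℝ) × ℝ → ℝ≥0∞, Measurable w ∧ (∀ z, w z ≠ 0 ∧ w z ≠ ⊤) ∧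
      (∫⁻ z, (w z)⁻¹ ∂(logisticLaw d PX f₀) ≤
        ENNReal.ofReal (Real.exp (-((1 / 32) * ∫ x, (sigmoid (f₀ x) - ej x) ^ 2 ∂PX)))) ∧
      ∀ e : (Fin d → ℝ) → ℝ, Measurable e → (∀ x, 0 < e x ∧ e x < 1) →
        ∫⁻ z, ENNReal.ofReal (bl (e z.1) z.2) / ENNReal.ofReal (bl (sigmoid (f₀ z.1)) z.2) * w z
          ∂(logisticLaw d PX f₀) ≤
        ENNReal.ofReal (Real.exp (-((1 / 32) * ∫ x, (sigmoid (f₀ x) - ej x) ^ 2 ∂PX) +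
          (1 / 4) * ∫ x, (e x - ej x) ^ 2 ∂PX)) := by
  have hs1 : Measurable fun x => sigmoid (f₀ x) := cont_sigm.measurable.comp hf
  let g : (Fin d → ℝ) × ℝ → ℝ := fun z =>
    (1 / 8) * (sigmoid (f₀ z.1) - ej z.1) * (z.2 - (sigmoid (f₀ z.1) + ej z.1) / 2)
  have hg : Measurable g := by
    have h1 : Measurable fun z : (Fin d → ℝ) × ℝ => sigmoid (f₀ z.1) := hs1.comp measurable_fst
    have h2 : Measurable fun z : (Fin d → ℝ) × ℝ => ej z.1 := hej.comp measurable_fst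
    exact ((h1.sub h2).const_mul _).mul (measurable_snd.sub ((h1.add h2).div_const _))
  have hb01 : ∀ a b : ℝ, (0 < a ∧ a < 1) → (0 < b ∧ b < 1) → |a - b| ≤ 1 := by
    intro a b ha hb
    rw [abs_le]; constructor <;> linarith [ha.1, ha.2, hb.1, hb.2]
  refine ⟨fun z => ENNReal.ofReal (Real.exp (g z)), hg.exp.ennreal_ofReal,
    fun z => ⟨by simp [Real.exp_pos], ENNReal.ofReal_ne_top⟩, ?_, ?_⟩
  · rw [logis_lintegral PX f₀ hf (fun z => (ENNReal.ofReal (Real.exp (g z)))⁻¹)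
      hg.exp.ennreal_ofReal.inv]
    have := quad_bound PX (fun x => (ENNReal.ofReal (sigmoid (f₀ x)) *
        (ENNReal.ofReal (Real.exp (g (x, 1))))⁻¹ + ENNReal.ofReal (1 - sigmoid (f₀ x)) *
        (ENNReal.ofReal (Real.exp (g (x, 0))))⁻¹)) (fun x => sigmoid (f₀ x) - ej x)
        (fun x => sigmoid (f₀ x) - ej x)
        (hs1.sub hej) (hs1.sub hej) 1 (fun x => hb01 _ _ (sigmoid_mem _) (hejm x))
        (fun x => hb01 _ _ (sigmoid_mem _) (hejm x)) (1 / 32) 0 ?_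
    · simpa using this
    · intro x
      have hm := sigmoid_mem (f₀ x)
      have hm' : 0 < 1 - sigmoid (f₀ x) := by linarith [hm.2]
      refine ⟨sigmoid (f₀ x) * Real.exp (-(g (x, 1))) + (1 - sigmoid (f₀ x)) *
        Real.exp (-(g (x, 0))), ?_, ?_, ?_⟩
      · have := hm.1
        positivity
      · have := (logis_quad (hejm x) hm (hejm x) (c1 := g (x, 1)) (c0 := g (x, 0)) rfl rfl).2
        simpa using this
      · rw [← ENNReal.ofReal_inv_of_pos (Real.exp_pos _), ← ENNReal.ofReal_inv_of_pos (Real.exp_pos _),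
          ← ENNReal.ofReal_mul hm.1.le, ← ENNReal.ofReal_mul hm'.le,
          ← ENNReal.ofReal_add (by have := hm.1; positivity) (by positivity),
          ← Real.exp_neg, ← Real.exp_neg]
  · intro e he hem
    rw [logis_int PX f₀ hf e he (fun z => ENNReal.ofReal (Real.exp (g z))) hg.exp.ennreal_ofReal]
    apply quad_bound PX _ (fun x => sigmoid (f₀ x) - ej x) (fun x => e x - ej x)
      (hs1.sub hej) (he.sub hej) 1 (fun x => hb01 _ _ (sigmoid_mem _) (hejm x))
        (fun x => hb01 _ _ (hem x) (hejm x))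
    intro x
    have hm := hem x
    have hm' : 0 < 1 - e x := by linarith [hm.2]
    refine ⟨e x * Real.exp (g (x, 1)) + (1 - e x) * Real.exp (g (x, 0)), ?_, ?_, ?_⟩
    · have := hm.1
      positivity
    · exact (logis_quad hm (sigmoid_mem (f₀ x)) (hejm x) (c1 := g (x, 1)) (c0 := g (x, 0)) rfl rfl).1
    · rw [← ENNReal.ofReal_mul hm.1.le, ← ENNReal.ofReal_mul hm'.le,
          ← ENNReal.ofReal_add (by have := hm.1; positivity) (by positivity)]

lemma logis_chi {d : ℕ} (PX : Measure (Fin d → ℝ)) [IsProbabilityMeasure PX]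
    (f₀ : (Fin d → ℝ) → ℝ) (hf : Measurable f₀)
    (e : (Fin d → ℝ) → ℝ) (he : Measurable e) (hem : ∀ x, 0 < e x ∧ e x < 1) {c₀ τ : ℝ}
    (hc₀ : 0 < c₀) (hc : ∀ x, c₀ ≤ e x * (1 - e x))
    (hτ : ∀ᵐ x ∂PX, |e x - sigmoid (f₀ x)| ≤ τ) :
    ∫⁻ z, (ENNReal.ofReal (bl (e z.1) z.2) / ENNReal.ofReal (bl (sigmoid (f₀ z.1)) z.2))⁻¹
      ∂(logisticLaw d PX f₀) ≤ ENNReal.ofReal (Real.exp (τ ^ 2 / c₀)) := by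
  have hs1 : Measurable fun x => sigmoid (f₀ x) := cont_sigm.measurable.comp hf
  rw [logis_lintegral PX f₀ hf]
  swap
  · refine Measurable.inv (Measurable.div ?_ ?_)
    · exact (measurable_bl.comp ((he.comp measurable_fst).prodMk measurable_snd)).ennreal_ofReal
    · exact (measurable_bl.comp ((hs1.comp measurable_fst).prodMk measurable_snd)).ennreal_ofReal
  calc _ ≤ ∫⁻ x, ENNReal.ofReal (Real.exp (τ ^ 2 / c₀)) ∂PX := by
        apply lintegral_mono_ae
        filter_upwards [hτ] with x hx
        simp only [bl_one, bl_zero]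
        have hm := hem x
        have hs := sigmoid_mem (f₀ x)
        set s := sigmoid (f₀ x)
        have hm' : 0 < 1 - e x := by linarith [hm.2]
        have hs' : 0 < 1 - s := by linarith [hs.2]
        have hm1 := hm.1
        have hs1 := hs.1
        rw [← ENNReal.ofReal_div_of_pos hs.1, ← ENNReal.ofReal_div_of_pos hs',
          ← ENNReal.ofReal_inv_of_pos (by positivity), ← ENNReal.ofReal_inv_of_pos (by positivity),
          ← ENNReal.ofReal_mul hs.1.le, ← ENNReal.ofReal_mul hs'.le,
          ← ENNReal.ofReal_add (by positivity) (by positivity)]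
        apply ENNReal.ofReal_le_ofReal
        have h1 : s * (e x / s)⁻¹ + (1 - s) * ((1 - e x) / (1 - s))⁻¹ =
            1 + (e x - s) ^ 2 / (e x * (1 - e x)) := by
          field_simp
          ring
        rw [h1]
        have h2 : (e x - s) ^ 2 / (e x * (1 - e x)) ≤ τ ^ 2 / c₀ := by
          have : (e x - s) ^ 2 ≤ τ ^ 2 := by
            rw [← sq_abs]; gcongr
          gcongr
          exact hc x
        linarith [Real.add_one_le_exp (τ ^ 2 / c₀)]
    _ = _ := by simp

lemma sigmoid_lip (a b : ℝ) : |sigmoid a - sigmoid b| ≤ |a - b| := by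
  wlog hab : b ≤ a generalizing a b
  · rw [abs_sub_comm, abs_sub_comm a b]
    exact this b a (not_le.1 hab).le
  have h1 := sigmoid_mem a
  have h2 := sigmoid_mem b
  have e1 : Real.exp (-a) = (1 - sigmoid a) / sigmoid a := by
    unfold sigmoid; field_simp; ring
  have hle : Real.exp (-a) ≤ Real.exp (-b) := Real.exp_le_exp.2 (by linarith)
  have p1 := Real.exp_pos (-a)
  have p2 := Real.exp_pos (-b)
  have hmono : sigmoid b ≤ sigmoid a := by
    unfold sigmoid
    gcongr
  rw [abs_of_nonneg (by linarith), abs_of_nonneg (by linarith)]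
  have hd : sigmoid a - sigmoid b = (Real.exp (-b) - Real.exp (-a)) /
      ((1 + Real.exp (-a)) * (1 + Real.exp (-b))) := by
    unfold sigmoid
    field_simp
    ring
  rw [hd, div_le_iff₀ (by positivity)]
  have h3 : Real.exp (-a) ≥ Real.exp (-b) * (1 - (a - b)) := by
    have : Real.exp (-a) = Real.exp (-b) * Real.exp (-(a - b)) := by
      rw [← Real.exp_add]; ring_nf
    rw [this]
    have := Real.add_one_le_exp (-(a - b))
    gcongr
    linarith
  nlinarith [mul_pos p1 p2, mul_nonneg (sub_nonneg.2 hab) p1.le, mul_nonneg (sub_nonneg.2 hab) (mul_pos p1 p2).le]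

lemma sigmoid_lower {F z : ℝ} (hz : |z| ≤ F) :
    (sigmoid (-F)) ^ 2 ≤ sigmoid z * (1 - sigmoid z) := by
  have hmono : ∀ a b : ℝ, b ≤ a → sigmoid b ≤ sigmoid a := by
    intro a b hab
    unfold sigmoid
    gcongr
  have h1 : 1 - sigmoid z = sigmoid (-z) := by
    unfold sigmoid
    have : Real.exp (- -z) = (Real.exp (-z))⁻¹ := by rw [Real.exp_neg]
    rw [this]
    have := Real.exp_pos (-z)
    field_simp
    ring
  rw [h1, sq]
  have h2 := abs_le.1 hz
  exact mul_le_mul (hmono _ _ h2.1) (hmono _ _ (by linarith [h2.2])) (sigmoid_mem _).1.le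
    (sigmoid_mem _).1.le

end Logistic



section Gauss

lemma gl_one {A : ℝ} (hA : 0 < A) (m C : ℝ) :
    ∫⁻ y : ℝ, ENNReal.ofReal (Real.exp (-A * (y - m) ^ 2 + C)) =
      ENNReal.ofReal (Real.sqrt (Real.pi / A) * Real.exp C) := by
  have hi : Integrable fun y : ℝ => Real.exp (-A * (y - m) ^ 2 + C) := by
    have := ((integrable_exp_neg_mul_sq hA).comp_sub_right m).mul_const (Real.exp C)
    refine this.congr (ae_of_all _ fun y => ?_)
    simp only [Real.exp_add]
  rw [← ofReal_integral_eq_lintegral_ofReal hi (ae_of_all _ fun y => (Real.exp_pos _).le)]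
  congr 1
  simp only [Real.exp_add]
  rw [integral_mul_const, integral_sub_right_eq_self (fun y : ℝ => Real.exp (-A * y ^ 2)) m,
    integral_gaussian]

lemma gpdf_nonneg (m s y : ℝ) : 0 ≤ gpdf m s y := by
  unfold gpdf; positivity

lemma gpdf_pos {m s y : ℝ} (hs : 0 < s) : 0 < gpdf m s y := by
  have := Real.pi_pos
  unfold gpdf; positivity

lemma gpdf_of_nonpos {m s y : ℝ} (hs : s ≤ 0) : gpdf m s y = 0 := by
  have : Real.sqrt (2 * Real.pi * s) = 0 :=
    Real.sqrt_eq_zero_of_nonpos (mul_nonpos_of_nonneg_of_nonpos (by positivity) hs)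
  unfold gpdf; rw [this]; simp

lemma measurable_gpdf : Measurable fun p : ℝ × ℝ × ℝ => gpdf p.1 p.2.1 p.2.2 := by
  unfold gpdf
  fun_prop

lemma gl_sq {s t : ℝ} (hs : 0 < s) (ht : 0 < 1 + 2 * t * s) (m c : ℝ) :
    ∫⁻ y : ℝ, ENNReal.ofReal (gpdf m s y) * ENNReal.ofReal (Real.exp (-t * (y - c) ^ 2)) =
      ENNReal.ofReal ((Real.sqrt (1 + 2 * t * s))⁻¹ *
        Real.exp (-t * (m - c) ^ 2 / (1 + 2 * t * s))) := by
  have hpi := Real.pi_pos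
  have e : ∀ y : ℝ, ENNReal.ofReal (gpdf m s y) * ENNReal.ofReal (Real.exp (-t * (y - c) ^ 2)) =
      ENNReal.ofReal ((Real.sqrt (2 * Real.pi * s))⁻¹) * ENNReal.ofReal (Real.exp
        (-((1 + 2 * t * s) / (2 * s)) * (y - (m + 2 * t * s * c) / (1 + 2 * t * s)) ^ 2 +
          (-t * (m - c) ^ 2 / (1 + 2 * t * s)))) := by
    intro y
    rw [← ENNReal.ofReal_mul (gpdf_nonneg _ _ _), ← ENNReal.ofReal_mul (by positivity)]
    congr 1
    unfold gpdf
    rw [mul_assoc, ← Real.exp_add]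
    congr 2
    obtain ⟨q, hq⟩ : ∃ q, q = 1 + 2 * t * s := ⟨_, rfl⟩
    rw [← hq] at ht ⊢
    field_simp
    rw [hq]
    ring
  simp_rw [e]
  rw [lintegral_const_mul _ (by fun_prop), gl_one (by positivity),
    ← ENNReal.ofReal_mul (by positivity)]
  congr 1
  rw [← mul_assoc]
  congr 1
  rw [← Real.sqrt_inv, ← Real.sqrt_inv, ← Real.sqrt_mul (by positivity)]
  congr 1
  field_simp

lemma gl_lin {s : ℝ} (hs : 0 < s) (b m c : ℝ) :
    ∫⁻ y : ℝ, ENNReal.ofReal (gpdf m s y) * ENNReal.ofReal (Real.exp (b * (y - c))) =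
      ENNReal.ofReal (Real.exp (b * (m - c) + b ^ 2 * s / 2)) := by
  have hpi := Real.pi_pos
  have e : ∀ y : ℝ, ENNReal.ofReal (gpdf m s y) * ENNReal.ofReal (Real.exp (b * (y - c))) =
      ENNReal.ofReal ((Real.sqrt (2 * Real.pi * s))⁻¹) * ENNReal.ofReal (Real.exp
        (-(1 / (2 * s)) * (y - (m + b * s)) ^ 2 + (b * (m - c) + b ^ 2 * s / 2))) := by
    intro y
    rw [← ENNReal.ofReal_mul (gpdf_nonneg _ _ _), ← ENNReal.ofReal_mul (by positivity)]
    congr 1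
    unfold gpdf
    rw [mul_assoc, ← Real.exp_add]
    congr 2
    field_simp
    ring
  simp_rw [e]
  rw [lintegral_const_mul _ (by fun_prop), gl_one (by positivity),
    ← ENNReal.ofReal_mul (by positivity)]
  congr 1
  rw [← mul_assoc]
  have : (Real.sqrt (2 * Real.pi * s))⁻¹ * Real.sqrt (Real.pi / (1 / (2 * s))) = 1 := by
    rw [← Real.sqrt_inv, ← Real.sqrt_mul (by positivity)]
    rw [show (2 * Real.pi * s)⁻¹ * (Real.pi / (1 / (2 * s))) = 1 by field_simp]
    simp
  rw [this, one_mul]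

lemma gl_chi {v0 s : ℝ} (hv : 0 < v0) (hs : v0 ≤ s) (f f0 : ℝ) :
    ∫⁻ y : ℝ, (ENNReal.ofReal (gpdf f s y) / ENNReal.ofReal (gpdf f0 v0 y))⁻¹ *
      ENNReal.ofReal (gpdf f0 v0 y) ≤
      ENNReal.ofReal (Real.exp ((s - v0) ^ 2 / v0 ^ 2 + (f - f0) ^ 2 / v0)) := by
  have hpi := Real.pi_pos
  have hs0 : 0 < s := hv.trans_le hs
  have h2 : 0 < 2 * s - v0 := by linarith
  have e : ∀ y : ℝ, (ENNReal.ofReal (gpdf f s y) / ENNReal.ofReal (gpdf f0 v0 y))⁻¹ *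
      ENNReal.ofReal (gpdf f0 v0 y) =
      ENNReal.ofReal (Real.sqrt (2 * Real.pi * s) / (2 * Real.pi * v0)) * ENNReal.ofReal (Real.exp
        (-((2 * s - v0) / (2 * s * v0)) * (y - (2 * s * f0 - v0 * f) / (2 * s - v0)) ^ 2 +
          (f - f0) ^ 2 / (2 * s - v0))) := by
    intro y
    rw [← ENNReal.ofReal_div_of_pos (gpdf_pos hv),
      ← ENNReal.ofReal_inv_of_pos (div_pos (gpdf_pos hs0) (gpdf_pos hv)),
      ← ENNReal.ofReal_mul (inv_nonneg.2 (div_nonneg (gpdf_nonneg _ _ _) (gpdf_nonneg _ _ _))),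
      ← ENNReal.ofReal_mul (by positivity)]
    congr 1
    have h3 : Real.sqrt (2 * Real.pi * v0) * Real.sqrt (2 * Real.pi * v0) = 2 * Real.pi * v0 :=
      Real.mul_self_sqrt (by positivity)
    have hq : 0 < Real.sqrt (2 * Real.pi * v0) := by positivity
    have hq' : 0 < Real.sqrt (2 * Real.pi * s) := by positivity
    have h4 : (gpdf f s y / gpdf f0 v0 y)⁻¹ * gpdf f0 v0 y =
        Real.sqrt (2 * Real.pi * s) / (2 * Real.pi * v0) *
        (Real.exp (-((y - f0) ^ 2) / (2 * v0)) * Real.exp (-((y - f0) ^ 2) / (2 * v0)) *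
          (Real.exp (-((y - f) ^ 2) / (2 * s)))⁻¹) := by
      rw [← h3]
      unfold gpdf
      field_simp
    rw [h4, ← Real.exp_neg, ← Real.exp_add, ← Real.exp_add]
    congr 2
    field_simp
    ring
  simp_rw [e]
  rw [lintegral_const_mul _ (by fun_prop), gl_one (by positivity),
    ← ENNReal.ofReal_mul (by positivity)]
  apply ENNReal.ofReal_le_ofReal
  rw [← mul_assoc, Real.exp_add]
  have h5 : (f - f0) ^ 2 / (2 * s - v0) ≤ (f - f0) ^ 2 / v0 := by
    gcongr; linarith
  refine mul_le_mul ?_ (Real.exp_le_exp.2 h5) (Real.exp_pos _).le (Real.exp_pos _).le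
  have h6 : Real.sqrt (2 * Real.pi * s) / (2 * Real.pi * v0) *
      Real.sqrt (Real.pi / ((2 * s - v0) / (2 * s * v0))) =
      Real.sqrt (s ^ 2 / (v0 * (2 * s - v0))) := by
    rw [← Real.sqrt_sq (show 0 ≤ 2 * Real.pi * v0 by positivity),
      ← Real.sqrt_div (by positivity), ← Real.sqrt_mul (by positivity)]
    congr 1
    field_simp
  rw [h6]
  apply Real.sqrt_le_iff.2 ⟨(Real.exp_pos _).le, ?_⟩
  have h7 : s ^ 2 / (v0 * (2 * s - v0)) ≤ 1 + (s - v0) ^ 2 / v0 ^ 2 := by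
    have : s ^ 2 / (v0 * (2 * s - v0)) = 1 + (s - v0) ^ 2 / (v0 * (2 * s - v0)) := by
      have h2' : v0 * (2 * s - v0) ≠ 0 := by positivity
      rw [eq_comm, ← div_self h2', ← add_div]
      congr 1; ring
    rw [this]
    have : (s - v0) ^ 2 / (v0 * (2 * s - v0)) ≤ (s - v0) ^ 2 / v0 ^ 2 := by
      gcongr
      nlinarith
    linarith
  have h8 := Real.add_one_le_exp ((s - v0) ^ 2 / v0 ^ 2)
  have h9 : 0 ≤ (s - v0) ^ 2 / v0 ^ 2 := by positivity
  nlinarith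

end Gauss


section GaussTests

/-- One-observation likelihood ratio in the Gaussian model. -/
def grho {d : ℕ} (f f₀ : (Fin d → ℝ) → ℝ) (s v : ℝ) (z : (Fin d → ℝ) × ℝ) : ℝ≥0∞ :=
  ENNReal.ofReal (gpdf (f z.1) s z.2) / ENNReal.ofReal (gpdf (f₀ z.1) v z.2)

lemma measurable_gp {d : ℕ} {f : (Fin d → ℝ) → ℝ} (hf : Measurable f) (s : ℝ) :
    Measurable fun z : (Fin d → ℝ) × ℝ => ENNReal.ofReal (gpdf (f z.1) s z.2) :=
  (measurable_gpdf.comp ((hf.comp measurable_fst).prodMk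
    (measurable_const.prodMk measurable_snd))).ennreal_ofReal

lemma measurable_grho {d : ℕ} {f f₀ : (Fin d → ℝ) → ℝ} (hf : Measurable f) (hf₀ : Measurable f₀)
    (s v : ℝ) : Measurable (grho f f₀ s v) :=
  (measurable_gp hf s).div (measurable_gp hf₀ v)

lemma gauss_int {d : ℕ} (PX : Measure (Fin d → ℝ)) {f f₀ : (Fin d → ℝ) → ℝ}
    (hf : Measurable f) (hf₀ : Measurable f₀) {s v : ℝ} (hv : 0 < v)
    (w : (Fin d → ℝ) × ℝ → ℝ≥0∞) (hw : Measurable w) :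
    ∫⁻ z, grho f f₀ s v z * w z ∂(gaussRegLaw d PX f₀ (Real.toNNReal v)) =
      ∫⁻ x, (∫⁻ y, ENNReal.ofReal (gpdf (f x) s y) * w (x, y)) ∂PX := by
  rw [gauss_lintegral PX f₀ hf₀ hv (fun z => grho f f₀ s v z * w z)
    ((measurable_grho hf hf₀ s v).mul hw)]
  refine lintegral_congr fun x => lintegral_congr fun y => ?_
  unfold grho
  simp only
  rw [mul_right_comm, ENNReal.div_mul_cancel]
  · simpa using gpdf_pos hv
  · exact ENNReal.ofReal_ne_top

lemma gauss_inv {d : ℕ} (PX : Measure (Fin d → ℝ)) {f₀ : (Fin d → ℝ) → ℝ}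
    (hf₀ : Measurable f₀) {v : ℝ} (hv : 0 < v)
    (w : (Fin d → ℝ) × ℝ → ℝ≥0∞) (hw : Measurable w) :
    ∫⁻ z, (w z)⁻¹ ∂(gaussRegLaw d PX f₀ (Real.toNNReal v)) =
      ∫⁻ x, (∫⁻ y, ENNReal.ofReal (gpdf (f₀ x) v y) * (w (x, y))⁻¹) ∂PX := by
  rw [gauss_lintegral PX f₀ hf₀ hv (fun z => (w z)⁻¹) hw.inv]
  refine lintegral_congr fun x => lintegral_congr fun y => ?_
  rw [mul_comm]

lemma gauss_chi {d : ℕ} (PX : Measure (Fin d → ℝ)) [IsProbabilityMeasure PX]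
    {f f₀ : (Fin d → ℝ) → ℝ}
    (hf : Measurable f) (hf₀ : Measurable f₀) {s v h τ : ℝ} (hv : 0 < v) (hs : v ≤ s)
    (hs' : s ≤ v + h) (hτ : ∀ᵐ x ∂PX, |f x - f₀ x| ≤ τ) :
    ∫⁻ z, (grho f f₀ s v z)⁻¹ ∂(gaussRegLaw d PX f₀ (Real.toNNReal v)) ≤
      ENNReal.ofReal (Real.exp (h ^ 2 / v ^ 2 + τ ^ 2 / v)) := by
  rw [gauss_lintegral PX f₀ hf₀ hv (fun z => (grho f f₀ s v z)⁻¹)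
    (measurable_grho hf hf₀ s v).inv]
  calc _ ≤ ∫⁻ x, ENNReal.ofReal (Real.exp (h ^ 2 / v ^ 2 + τ ^ 2 / v)) ∂PX := by
        apply lintegral_mono_ae
        filter_upwards [hτ] with x hx
        refine (gl_chi hv hs (f x) (f₀ x)).trans (ENNReal.ofReal_le_ofReal (Real.exp_le_exp.2 ?_))
        have h1 : (s - v) ^ 2 ≤ h ^ 2 := by
          apply pow_le_pow_left₀ <;> linarith
        have h2 : (f x - f₀ x) ^ 2 ≤ τ ^ 2 := by
          rw [← sq_abs]; gcongr
        gcongr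
    _ = _ := by simp

lemma sqrt_exp_aux {A B e : ℝ} (hA : 0 < A)
    (h : Real.exp (2 * e) ≤ A * B) : (Real.sqrt A)⁻¹ * (Real.sqrt B)⁻¹ ≤ Real.exp (-e) := by
  rw [← mul_inv, ← Real.sqrt_mul hA.le, Real.exp_neg]
  apply inv_anti₀ (Real.exp_pos _)
  apply Real.le_sqrt_of_sq_le
  rw [sq, ← Real.exp_add, ← two_mul]
  exact h

lemma gauss_test_a {d : ℕ} (PX : Measure (Fin d → ℝ)) [IsProbabilityMeasure PX]
    {f₀ : (Fin d → ℝ) → ℝ} (hf₀ : Measurable f₀) {v e : ℝ} (hv : 0 < v) (he0 : 0 < e) (he1 : e ≤ 1) :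
    ∃ w : (Fin d → ℝ) × ℝ → ℝ≥0∞, Measurable w ∧ (∀ z, w z ≠ 0 ∧ w z ≠ ⊤) ∧
      (∫⁻ z, (w z)⁻¹ ∂(gaussRegLaw d PX f₀ (Real.toNNReal v)) ≤
        ENNReal.ofReal (Real.exp (-(e ^ 2 / 64)))) ∧
      ∀ f : (Fin d → ℝ) → ℝ, Measurable f → ∀ s : ℝ, v * (1 + e) ≤ s →
        ∫⁻ z, grho f f₀ s v z * w z ∂(gaussRegLaw d PX f₀ (Real.toNNReal v)) ≤
          ENNReal.ofReal (Real.exp (-(e ^ 2 / 64))) := by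
  have hq : 0 < 1 - e / 4 := by linarith
  have hsq : 0 < Real.sqrt (1 - e / 4) := Real.sqrt_pos.2 hq
  obtain ⟨t, ht⟩ : ∃ t, t = e / (8 * v) := ⟨_, rfl⟩
  have htv : t * v = e / 8 := by rw [ht]; field_simp
  have ht0 : 0 < t := by rw [ht]; positivity
  obtain ⟨k, hk⟩ : ∃ k, k = (Real.sqrt (1 - e / 4))⁻¹ * Real.exp (e ^ 2 / 64) := ⟨_, rfl⟩
  have hk0 : 0 < k := by rw [hk]; positivity
  have hwm : Measurable fun z : (Fin d → ℝ) × ℝ =>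
      ENNReal.ofReal k * ENNReal.ofReal (Real.exp (-t * (z.2 - f₀ z.1) ^ 2)) := by
    have h1 : Measurable fun z : (Fin d → ℝ) × ℝ => f₀ z.1 := hf₀.comp measurable_fst
    fun_prop
  refine ⟨_, hwm, fun z => ⟨by simp [Real.exp_pos, hk0],
    ENNReal.mul_ne_top ENNReal.ofReal_ne_top ENNReal.ofReal_ne_top⟩, ?_, ?_⟩
  · rw [gauss_inv PX hf₀ hv _ hwm]
    calc _ = ∫⁻ x, ENNReal.ofReal (Real.exp (-(e ^ 2 / 64))) ∂PX := by
          refine lintegral_congr fun x => ?_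
          have : ∀ y : ℝ, ENNReal.ofReal (gpdf (f₀ x) v y) * (ENNReal.ofReal k *
              ENNReal.ofReal (Real.exp (-t * (y - f₀ x) ^ 2)))⁻¹ =
              ENNReal.ofReal k⁻¹ * (ENNReal.ofReal (gpdf (f₀ x) v y) *
                ENNReal.ofReal (Real.exp (-(-t) * (y - f₀ x) ^ 2))) := by
            intro y
            rw [← ENNReal.ofReal_mul hk0.le, ← ENNReal.ofReal_inv_of_pos (by positivity),
              mul_inv, ← Real.exp_neg, ENNReal.ofReal_mul (by positivity)]
            ring_nf
          simp only [this]
          have h1 : 1 + 2 * -t * v = 1 - e / 4 := by linear_combination (-2) * htv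
          rw [lintegral_const_mul' _ _ ENNReal.ofReal_ne_top, gl_sq hv (by rw [h1]; exact hq), h1,
            ← ENNReal.ofReal_mul (by positivity)]
          congr 1
          rw [hk, Real.exp_neg, mul_inv, inv_inv, mul_right_comm, ← mul_assoc]
          simp [hsq.ne']
      _ ≤ _ := by simp
  · intro f hf s hs
    rw [gauss_int PX hf hf₀ hv _ hwm]
    have hs0 : 0 < s := by nlinarith
    calc _ ≤ ∫⁻ x, ENNReal.ofReal (Real.exp (-(e ^ 2 / 64))) ∂PX := by
          refine lintegral_mono fun x => ?_
          have : ∀ y : ℝ, ENNReal.ofReal (gpdf (f x) s y) * (ENNReal.ofReal k *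
              ENNReal.ofReal (Real.exp (-t * (y - f₀ x) ^ 2))) =
              ENNReal.ofReal k * (ENNReal.ofReal (gpdf (f x) s y) *
                ENNReal.ofReal (Real.exp (-t * (y - f₀ x) ^ 2))) := by
            intro y
            ring
          simp only [this]
          have hp : 0 < 1 + 2 * t * s := by positivity
          rw [lintegral_const_mul' _ _ ENNReal.ofReal_ne_top, gl_sq hs0 hp,
            ← ENNReal.ofReal_mul (by positivity)]
          apply ENNReal.ofReal_le_ofReal
          have h1 : Real.exp (-t * (f x - f₀ x) ^ 2 / (1 + 2 * t * s)) ≤ 1 := by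
            rw [Real.exp_le_one_iff]
            apply div_nonpos_of_nonpos_of_nonneg _ hp.le
            nlinarith [sq_nonneg (f x - f₀ x)]
          have hts : e / 8 * (1 + e) ≤ t * s := by
            rw [← htv, mul_assoc]; gcongr
          have h2 := sqrt_exp_aux (A := 1 - e / 4) (B := 1 + 2 * t * s) (e := e ^ 2 / 32) hq (by
            have := exp_le_quad (z := 2 * (e ^ 2 / 32)) (by
              rw [abs_of_nonneg (by positivity)]; nlinarith)
            have h3 : (1 - e / 4) * (1 + 2 * (e / 8 * (1 + e))) ≤ (1 - e / 4) * (1 + 2 * t * s) := by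
              apply mul_le_mul_of_nonneg_left _ hq.le
              linarith
            have h4 : e ^ 3 ≤ e ^ 2 := pow_le_pow_of_le_one he0.le he1 (by norm_num)
            have h5 : e ^ 4 ≤ e ^ 2 := pow_le_pow_of_le_one he0.le he1 (by norm_num)
            nlinarith)
          calc _ ≤ k * ((Real.sqrt (1 + 2 * t * s))⁻¹ * 1) := by gcongr
            _ = Real.exp (e ^ 2 / 64) * ((Real.sqrt (1 - e / 4))⁻¹ *
                (Real.sqrt (1 + 2 * t * s))⁻¹) := by rw [hk]; ring
            _ ≤ Real.exp (e ^ 2 / 64) * Real.exp (-(e ^ 2 / 32)) := by gcongr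
            _ = _ := by rw [← Real.exp_add]; ring_nf
      _ = _ := by simp

lemma gauss_test_b {d : ℕ} (PX : Measure (Fin d → ℝ)) [IsProbabilityMeasure PX]
    {f₀ : (Fin d → ℝ) → ℝ} (hf₀ : Measurable f₀) {v e F : ℝ} (hv : 0 < v) (he0 : 0 < e) (he1 : e ≤ 1)
    (heF : e * F ^ 2 ≤ v) (g : (Fin d → ℝ) → ℝ) (hg : Measurable g) (hgF : ∀ x, |g x| ≤ F) :
    ∃ w : (Fin d → ℝ) × ℝ → ℝ≥0∞, Measurable w ∧ (∀ z, w z ≠ 0 ∧ w z ≠ ⊤) ∧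
      (∫⁻ z, (w z)⁻¹ ∂(gaussRegLaw d PX f₀ (Real.toNNReal v)) ≤
        ENNReal.ofReal (Real.exp (-(e ^ 2 / 64)))) ∧
      ∀ f : (Fin d → ℝ) → ℝ, Measurable f → (∀ x, |f x| ≤ F) → ∀ s : ℝ, s ≤ v * (1 - e) →
        ∫ x, (f x - g x) ^ 2 ∂PX ≤ e * v / 16 →
        ∫⁻ z, grho f f₀ s v z * w z ∂(gaussRegLaw d PX f₀ (Real.toNNReal v)) ≤
          ENNReal.ofReal (Real.exp (-(e ^ 2 / 64))) := by
  have hq : 0 < 1 + e / 4 := by linarith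
  have hsq : 0 < Real.sqrt (1 + e / 4) := Real.sqrt_pos.2 hq
  obtain ⟨t, ht⟩ : ∃ t, t = e / (8 * v) := ⟨_, rfl⟩
  have htv : t * v = e / 8 := by rw [ht]; field_simp
  have ht0 : 0 < t := by rw [ht]; positivity
  obtain ⟨k, hk⟩ : ∃ k, k = (Real.sqrt (1 + e / 4))⁻¹ * Real.exp (e ^ 2 / 64) := ⟨_, rfl⟩
  have hk0 : 0 < k := by rw [hk]; positivity
  have hwm : Measurable fun z : (Fin d → ℝ) × ℝ =>
      ENNReal.ofReal k * ENNReal.ofReal (Real.exp (-(-t) * (z.2 - g z.1) ^ 2)) := by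
    have h1 : Measurable fun z : (Fin d → ℝ) × ℝ => g z.1 := hg.comp measurable_fst
    fun_prop
  refine ⟨_, hwm, fun z => ⟨by simp [Real.exp_pos, hk0],
    ENNReal.mul_ne_top ENNReal.ofReal_ne_top ENNReal.ofReal_ne_top⟩, ?_, ?_⟩
  · rw [gauss_inv PX hf₀ hv _ hwm]
    calc _ ≤ ∫⁻ x, ENNReal.ofReal (Real.exp (-(e ^ 2 / 64))) ∂PX := by
          refine lintegral_mono fun x => ?_
          have : ∀ y : ℝ, ENNReal.ofReal (gpdf (f₀ x) v y) * (ENNReal.ofReal k *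
              ENNReal.ofReal (Real.exp (-(-t) * (y - g x) ^ 2)))⁻¹ =
              ENNReal.ofReal k⁻¹ * (ENNReal.ofReal (gpdf (f₀ x) v y) *
                ENNReal.ofReal (Real.exp (-t * (y - g x) ^ 2))) := by
            intro y
            rw [← ENNReal.ofReal_mul hk0.le, ← ENNReal.ofReal_inv_of_pos (by positivity),
              mul_inv, ← Real.exp_neg, ENNReal.ofReal_mul (by positivity)]
            ring_nf
          simp only [this]
          have h1 : 1 + 2 * t * v = 1 + e / 4 := by linear_combination 2 * htv
          rw [lintegral_const_mul' _ _ ENNReal.ofReal_ne_top, gl_sq hv (by rw [h1]; exact hq), h1,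
            ← ENNReal.ofReal_mul (by positivity)]
          apply ENNReal.ofReal_le_ofReal
          have h2 : Real.exp (-t * (f₀ x - g x) ^ 2 / (1 + e / 4)) ≤ 1 := by
            rw [Real.exp_le_one_iff]
            apply div_nonpos_of_nonpos_of_nonneg _ hq.le
            nlinarith [sq_nonneg (f₀ x - g x)]
          calc _ ≤ k⁻¹ * ((Real.sqrt (1 + e / 4))⁻¹ * 1) := by gcongr
            _ = _ := by
              rw [hk, Real.exp_neg]
              simp
              field_simp
      _ = _ := by simp
  · intro f hf hfF s hs hV
    rw [gauss_int PX hf hf₀ hv _ hwm]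
    rcases le_or_gt s 0 with hs0 | hs0
    · simp [gpdf_of_nonpos hs0]
    have hts : t * s ≤ e / 8 * (1 - e) := by
      rw [← htv, mul_assoc]; gcongr
    have hts0 : 0 < t * s := by positivity
    have hp : 0 < 1 + 2 * (-t) * s := by nlinarith
    have hp34 : 3 / 4 ≤ 1 + 2 * (-t) * s := by nlinarith
    have h2 := sqrt_exp_aux (A := 1 + e / 4) (B := 1 + 2 * (-t) * s) (e := e ^ 2 / 16) hq (by
      have := exp_le_quad (z := 2 * (e ^ 2 / 16)) (by
        rw [abs_of_nonneg (by positivity)]; nlinarith)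
      have h3 : (1 + e / 4) * (1 - 2 * (e / 8 * (1 - e))) ≤ (1 + e / 4) * (1 + 2 * (-t) * s) := by
        apply mul_le_mul_of_nonneg_left _ hq.le
        linarith
      have h4 : 0 ≤ e ^ 3 := by positivity
      have h5 : e ^ 4 ≤ e ^ 2 := pow_le_pow_of_le_one he0.le he1 (by norm_num)
      nlinarith)
    have hb : ∀ x, |f x - g x| ≤ 2 * F := fun x =>
      (abs_sub _ _).trans (by linarith [hfF x, hgF x])
    have htF : t * F ^ 2 ≤ 1 / 8 := by
      have : t * F ^ 2 = (e * F ^ 2) / (8 * v) := by rw [ht]; ring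
      rw [this, div_le_iff₀ (by positivity)]; linarith
    have hquad := quad_bound PX (fun x => ENNReal.ofReal
      (Real.exp (t * (f x - g x) ^ 2 / (1 + 2 * (-t) * s)))) (fun x => f x - g x)
      (fun x => f x - g x) (hf.sub hg) (hf.sub hg) (2 * F) hb hb 0 (8 / 3 * t) (by
        intro x
        refine ⟨_, (Real.exp_pos _).le, ?_, le_rfl⟩
        have h4F : (f x - g x) ^ 2 ≤ 4 * F ^ 2 := by
          rw [← sq_abs]
          nlinarith [abs_nonneg (f x - g x), hb x]
        have hz0 : 0 ≤ t * (f x - g x) ^ 2 := by positivity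
        have hz : t * (f x - g x) ^ 2 / (1 + 2 * (-t) * s) ≤ 4 / 3 * (t * (f x - g x) ^ 2) := by
          rw [div_le_iff₀ hp]
          nlinarith
        have hz1 : t * (f x - g x) ^ 2 ≤ 1 / 2 := by nlinarith
        have hz2 : 0 ≤ t * (f x - g x) ^ 2 / (1 + 2 * (-t) * s) := by positivity
        have := exp_le_quad (z := t * (f x - g x) ^ 2 / (1 + 2 * (-t) * s))
          (by rw [abs_of_nonneg hz2]; linarith)
        have hz3 : (t * (f x - g x) ^ 2 / (1 + 2 * (-t) * s)) ^ 2 ≤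
          t * (f x - g x) ^ 2 / (1 + 2 * (-t) * s) := by nlinarith
        linarith)
    have : ∀ x, ∫⁻ y : ℝ, ENNReal.ofReal (gpdf (f x) s y) * (ENNReal.ofReal k *
        ENNReal.ofReal (Real.exp (-(-t) * (y - g x) ^ 2))) =
        ENNReal.ofReal (k * (Real.sqrt (1 + 2 * (-t) * s))⁻¹) * ENNReal.ofReal
          (Real.exp (t * (f x - g x) ^ 2 / (1 + 2 * (-t) * s))) := by
      intro x
      have : ∀ y : ℝ, ENNReal.ofReal (gpdf (f x) s y) * (ENNReal.ofReal k *
              ENNReal.ofReal (Real.exp (-(-t) * (y - g x) ^ 2))) =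
              ENNReal.ofReal k * (ENNReal.ofReal (gpdf (f x) s y) *
                ENNReal.ofReal (Real.exp (-(-t) * (y - g x) ^ 2))) := by
        intro y
        ring
      simp only [this]
      rw [lintegral_const_mul' _ _ ENNReal.ofReal_ne_top, gl_sq hs0 hp,
        ← ENNReal.ofReal_mul (by positivity), ← ENNReal.ofReal_mul (by positivity)]
      congr 1
      rw [neg_neg]; ring
    simp only [this]
    rw [lintegral_const_mul' _ _ ENNReal.ofReal_ne_top]
    refine (mul_le_mul' le_rfl hquad).trans ?_
    rw [← ENNReal.ofReal_mul (by positivity)]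
    apply ENNReal.ofReal_le_ofReal
    have hV' : 8 / 3 * t * ∫ x, (f x - g x) ^ 2 ∂PX ≤ e ^ 2 / 32 := by
      calc _ ≤ 8 / 3 * t * (e * v / 16) := by gcongr
        _ = e / 6 * (t * v) := by ring
        _ ≤ _ := by rw [htv]; nlinarith
    calc _ ≤ k * (Real.sqrt (1 + 2 * (-t) * s))⁻¹ * Real.exp (e ^ 2 / 32) := by
          gcongr; linarith
      _ = Real.exp (e ^ 2 / 64) * ((Real.sqrt (1 + e / 4))⁻¹ *
          (Real.sqrt (1 + 2 * (-t) * s))⁻¹) * Real.exp (e ^ 2 / 32) := by rw [hk]; ring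
      _ ≤ Real.exp (e ^ 2 / 64) * Real.exp (-(e ^ 2 / 16)) * Real.exp (e ^ 2 / 32) := by gcongr
      _ = _ := by rw [← Real.exp_add, ← Real.exp_add]; ring_nf

lemma lin_quad {t F v s u w : ℝ} (ht0 : 0 < t) (ht : t * (v + 16 * F ^ 2) ≤ 1 / 8)
    (hF : 0 < F) (hv : 0 < v) (htv : 2 * t * v ≤ 1) (hs0 : 0 < s) (hs : s ≤ 2 * v)
    (hu : |u| ≤ 2 * F) (hw : |w| ≤ 2 * F) {z : ℝ}
    (hz : z = t * u * w - t * u ^ 2 / 2 + t ^ 2 * u ^ 2 * s / 2) :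
    Real.exp z ≤ 1 - t / 4 * u ^ 2 + 2 * t * w ^ 2 := by
  have hts : t * s ≤ 1 := by nlinarith
  have hts0 : 0 < t * s := by positivity
  have h1 : z = t * u * (w - u / 2 + t * s * u / 2) := by rw [hz]; ring
  have h2 : |w - u / 2 + t * s * u / 2| ≤ 4 * F := by
    have a1 := abs_le.1 hu
    have a2 := abs_le.1 hw
    rw [abs_le]
    constructor <;> nlinarith
  have h3 : z ^ 2 ≤ 16 * F ^ 2 * t ^ 2 * u ^ 2 := by
    rw [h1, mul_pow]
    have : (w - u / 2 + t * s * u / 2) ^ 2 ≤ (4 * F) ^ 2 := by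
      rw [← sq_abs]; gcongr
    calc _ ≤ (t * u) ^ 2 * (4 * F) ^ 2 := by gcongr
      _ = _ := by ring
  have h4 : u ^ 2 ≤ 4 * F ^ 2 := by
    rw [← sq_abs]; nlinarith [abs_nonneg u]
  have hF2 : t * F ^ 2 ≤ 1 / 128 := by nlinarith [mul_pos ht0 hv]
  have h5 : |z| ≤ 1 := by
    refine abs_le_of_sq_le_sq ?_ zero_le_one
    calc z ^ 2 ≤ 16 * F ^ 2 * t ^ 2 * u ^ 2 := h3
      _ ≤ 16 * F ^ 2 * t ^ 2 * (4 * F ^ 2) := by gcongr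
      _ = 64 * (t * F ^ 2) ^ 2 := by ring
      _ ≤ 1 ^ 2 := by nlinarith [mul_pos ht0 (pow_pos hF 2)]
  have h6 := exp_le_quad h5
  have h7 : t * u * w ≤ t / 8 * u ^ 2 + 2 * t * w ^ 2 := by
    have : 0 ≤ t * (u - 4 * w) ^ 2 := by positivity
    nlinarith
  have h8 : t ^ 2 * u ^ 2 * s / 2 ≤ t ^ 2 * u ^ 2 * v := by
    have : 0 ≤ t ^ 2 * u ^ 2 := by positivity
    nlinarith
  have h9 : t ^ 2 * u ^ 2 * v + 16 * F ^ 2 * t ^ 2 * u ^ 2 ≤ t * u ^ 2 * (1 / 8) := by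
    calc _ = t * u ^ 2 * (t * (v + 16 * F ^ 2)) := by ring
      _ ≤ _ := by gcongr
  rw [hz] at h6 h3 ⊢
  nlinarith

lemma gauss_test_c {d : ℕ} (PX : Measure (Fin d → ℝ)) [IsProbabilityMeasure PX]
    {f₀ : (Fin d → ℝ) → ℝ} (hf₀ : Measurable f₀) {v t F : ℝ} (hv : 0 < v) (hF : 0 < F)
    (ht0 : 0 < t) (ht : t * (v + 16 * F ^ 2) ≤ 1 / 8) (htv : 2 * t * v ≤ 1)
    (hf₀F : ∀ x, |f₀ x| ≤ F) (g : (Fin d → ℝ) → ℝ) (hg : Measurable g) (hgF : ∀ x, |g x| ≤ F) :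
    ∃ w : (Fin d → ℝ) × ℝ → ℝ≥0∞, Measurable w ∧ (∀ z, w z ≠ 0 ∧ w z ≠ ⊤) ∧
      (∫⁻ z, (w z)⁻¹ ∂(gaussRegLaw d PX f₀ (Real.toNNReal v)) ≤
        ENNReal.ofReal (Real.exp (-(t / 4 * ∫ x, (f₀ x - g x) ^ 2 ∂PX)))) ∧
      ∀ f : (Fin d → ℝ) → ℝ, Measurable f → (∀ x, |f x| ≤ F) → ∀ s : ℝ, 0 < s → s ≤ 2 * v →
        ∫⁻ z, grho f f₀ s v z * w z ∂(gaussRegLaw d PX f₀ (Real.toNNReal v)) ≤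
          ENNReal.ofReal (Real.exp (-(t / 4 * ∫ x, (f₀ x - g x) ^ 2 ∂PX) +
            2 * t * ∫ x, (f x - g x) ^ 2 ∂PX)) := by
  have hwm : Measurable fun z : (Fin d → ℝ) × ℝ =>
      ENNReal.ofReal (Real.exp (t * (f₀ z.1 - g z.1) * (z.2 - (f₀ z.1 + g z.1) / 2))) := by
    have h1 : Measurable fun z : (Fin d → ℝ) × ℝ => g z.1 := hg.comp measurable_fst
    have h2 : Measurable fun z : (Fin d → ℝ) × ℝ => f₀ z.1 := hf₀.comp measurable_fst
    fun_prop
  have hb0 : ∀ x, |f₀ x - g x| ≤ 2 * F := fun x =>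
    (abs_sub _ _).trans (by linarith [hf₀F x, hgF x])
  refine ⟨_, hwm, fun z => ⟨by simp [Real.exp_pos], ENNReal.ofReal_ne_top⟩, ?_, ?_⟩
  · rw [gauss_inv PX hf₀ hv _ hwm]
    have := quad_bound PX (fun x => ∫⁻ y, ENNReal.ofReal (gpdf (f₀ x) v y) *
        (ENNReal.ofReal (Real.exp (t * (f₀ x - g x) * (y - (f₀ x + g x) / 2))))⁻¹)
      (fun x => f₀ x - g x) (fun x => f₀ x - g x) (hf₀.sub hg) (hf₀.sub hg) (2 * F) hb0 hb0
      (t / 4) 0 (by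
        intro x
        refine ⟨Real.exp (-(t * (f₀ x - g x)) * (f₀ x - (f₀ x + g x) / 2) +
          (-(t * (f₀ x - g x))) ^ 2 * v / 2), (Real.exp_pos _).le, ?_, le_of_eq ?_⟩
        · have := lin_quad (s := v) (u := f₀ x - g x) (w := 0) ht0 ht hF hv htv hv (by linarith)
            (hb0 x) (by simpa using hF.le)
            (z := -(t * (f₀ x - g x)) * (f₀ x - (f₀ x + g x) / 2) +
          (-(t * (f₀ x - g x))) ^ 2 * v / 2) (by ring)
          simpa using this
        · rw [← gl_lin hv]
          refine lintegral_congr fun y => ?_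
          rw [← ENNReal.ofReal_inv_of_pos (Real.exp_pos _), ← Real.exp_neg, neg_mul])
    simpa using this
  · intro f hf hfF s hs0 hs
    have hb : ∀ x, |f x - g x| ≤ 2 * F := fun x =>
      (abs_sub _ _).trans (by linarith [hfF x, hgF x])
    rw [gauss_int PX hf hf₀ hv _ hwm]
    apply quad_bound PX _ (fun x => f₀ x - g x) (fun x => f x - g x) (hf₀.sub hg) (hf.sub hg)
      (2 * F) hb0 hb
    intro x
    refine ⟨Real.exp ((t * (f₀ x - g x)) * (f x - (f₀ x + g x) / 2) +
          ((t * (f₀ x - g x))) ^ 2 * s / 2), (Real.exp_pos _).le, ?_, le_of_eq ?_⟩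
    · exact lin_quad (s := s) (u := f₀ x - g x) (w := f x - g x) ht0 ht hF hv htv hs0 hs
            (hb0 x) (hb x) (by ring)
    · exact gl_lin hs0 (t * (f₀ x - g x)) (f x) ((f₀ x + g x) / 2)

end GaussTests


section Nets

lemma hcs_measurable {a : ℝ} {d q : ℕ} {N : ℕ → ℕ} {P : Finset (ℝ × ℕ)} {K F CLip : ℝ}
    {f : (Fin d → ℝ) → ℝ} (h : followsHCS a d q N P K F CLip f) : Measurable f := by
  obtain ⟨hq, hN, fl, βh, dh, g, h0, h1, h2, h3⟩ := h
  have key : ∀ l, l ≤ q → ∀ i < N l, Continuous (fl l i) := by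
    intro l
    induction l with
    | zero =>
      intro _ i hi
      obtain ⟨j, hj⟩ := h0 i hi
      rw [show fl 0 i = fun x => x j from funext hj]
      exact continuous_apply j
    | succ l ih =>
      intro hl i hi
      obtain ⟨-, -, hH, -, hfl⟩ := h1 (l + 1) (by omega) hl i hi
      rw [show fl (l + 1) i = _ from funext hfl]
      refine hH.1.continuous.comp (continuous_pi fun j => ?_)
      refine ih (by omega) _ ?_
      have hs := h2 (l + 1) (by omega) hl
      simp only [Nat.add_sub_cancel] at hs ⊢
      rw [← hs]
      calc (∑ i' ∈ Finset.range i, dh (l + 1) i') + (j : ℕ) <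
            (∑ i' ∈ Finset.range i, dh (l + 1) i') + dh (l + 1) i := by
              have := j.2; omega
        _ = ∑ i' ∈ Finset.range (i + 1), dh (l + 1) i' := (Finset.sum_range_succ _ _).symm
        _ ≤ _ := Finset.sum_le_sum_of_subset (Finset.range_subset_range.2 hi)
  rw [show f = _ from funext h3]
  exact (key q le_rfl 0 (by omega)).measurable

lemma memDNN_params {ν : ℝ} {d L r : ℕ} {B : ℝ} {f : (Fin d → ℝ) → ℝ} (h : memDNN ν d L r B f) :
    1 ≤ L ∧ ∃ θ : ParamIdx d r L → ℝ, (∀ i, |θ i| ≤ B) ∧ ∀ x, f x = netOfParams ν d r L θ x := by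
  obtain ⟨net, rfl, ⟨hb1, hb2, hb3, hb4, hb5⟩, he⟩ := h
  refine ⟨by omega, fun i => match i with
    | Sum.inl (i, j) => net.W0 i j
    | Sum.inr (Sum.inl i) => net.b0 i
    | Sum.inr (Sum.inr (Sum.inl (l, i, j))) => (net.hid.get l).1 i j
    | Sum.inr (Sum.inr (Sum.inr (Sum.inl (l, i)))) => (net.hid.get l).2 i
    | Sum.inr (Sum.inr (Sum.inr (Sum.inr (Sum.inl i)))) => net.Wout i
    | Sum.inr (Sum.inr (Sum.inr (Sum.inr (Sum.inr ())))) => net.bout, ?_, ?_⟩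
  · rintro (⟨i, j⟩ | i | ⟨l, i, j⟩ | ⟨l, i⟩ | i | ⟨⟩)
    · exact hb1 i j
    · exact hb2 i
    · exact (hb3 _ (List.get_mem _ _)).1 i j
    · exact (hb3 _ (List.get_mem _ _)).2 i
    · exact hb4 i
    · exact hb5
  · intro x
    rw [he x]
    unfold LNet.eval netOfParams
    simp only
    congr 1
    apply Finset.sum_congr rfl
    intro i _
    congr 1
    conv_lhs => rw [← List.map_get_finRange net.hid]
    rw [List.foldl_map]
    rfl

lemma lrelu_abs {ν : ℝ} (h0 : 0 ≤ ν) (h1 : ν < 1) (x : ℝ) : |lrelu ν x| ≤ |x| := by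
  unfold lrelu
  rcases le_total 0 x with h | h
  · rw [max_eq_left (by nlinarith)]
  · rw [max_eq_right (by nlinarith), abs_mul, abs_of_nonneg h0]
    nlinarith [abs_nonneg x]

lemma lrelu_lip {ν : ℝ} (h0 : 0 ≤ ν) (h1 : ν < 1) (x y : ℝ) :
    |lrelu ν x - lrelu ν y| ≤ |x - y| := by
  unfold lrelu
  refine (abs_max_sub_max_le_max _ _ _ _).trans (max_le le_rfl ?_)
  rw [← mul_sub, abs_mul, abs_of_nonneg h0]
  nlinarith [abs_nonneg (x - y)]

lemma aff_inv {m : ℕ} {B δ H Q : ℝ} (hB : 0 ≤ B) (hδ : 0 ≤ δ) (hH : 1 ≤ H)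
    (hQ : ((m : ℝ) + 1) * (B + 1) ≤ Q)
    (w w' h h' : Fin m → ℝ) (b b' : ℝ) (hw : ∀ j, |w j| ≤ B) (hw' : ∀ j, |w' j| ≤ B)
    (hb : |b| ≤ B) (hb' : |b'| ≤ B) (hww : ∀ j, |w j - w' j| ≤ δ) (hbb : |b - b'| ≤ δ)
    (hh : ∀ j, |h j| ≤ H) (hh' : ∀ j, |h' j| ≤ H) (hhh : ∀ j, |h j - h' j| ≤ δ * H) :
    |(∑ j, w j * h j) + b| ≤ Q * H ∧ |(∑ j, w' j * h' j) + b'| ≤ Q * H ∧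
      |((∑ j, w j * h j) + b) - ((∑ j, w' j * h' j) + b')| ≤ δ * (Q * H) := by
  have gen : ∀ (u k : Fin m → ℝ) (c : ℝ), (∀ j, |u j| ≤ B) → (∀ j, |k j| ≤ H) → |c| ≤ B →
      |(∑ j, u j * k j) + c| ≤ Q * H := by
    intro u k c hu hk hc
    have h1 : |∑ j, u j * k j| ≤ m * (B * H) := by
      refine (Finset.abs_sum_le_sum_abs _ _).trans ?_
      refine (Finset.sum_le_card_nsmul _ _ (B * H) fun j _ => ?_).trans (by simp)
      rw [abs_mul]
      exact mul_le_mul (hu j) (hk j) (abs_nonneg _) hB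
    refine (abs_add_le _ _).trans ?_
    have h2 : ((m : ℝ) + 1) * (B + 1) * H ≤ Q * H := by gcongr
    have hm : (0 : ℝ) ≤ m := Nat.cast_nonneg m
    nlinarith [mul_nonneg hm (by linarith : 0 ≤ H)]
  refine ⟨gen w h b hw hh hb, gen w' h' b' hw' hh' hb', ?_⟩
  have e : ((∑ j, w j * h j) + b) - ((∑ j, w' j * h' j) + b') =
      (∑ j, (w j * (h j - h' j) + (w j - w' j) * h' j)) + (b - b') := by
    have : ∑ j, (w j * (h j - h' j) + (w j - w' j) * h' j) =
        ∑ j, w j * h j - ∑ j, w' j * h' j := by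
      rw [← Finset.sum_sub_distrib]
      exact Finset.sum_congr rfl fun j _ => by ring
    rw [this]; ring
  rw [e]
  have h1 : |∑ j, (w j * (h j - h' j) + (w j - w' j) * h' j)| ≤ m * (B * (δ * H) + δ * H) := by
    refine (Finset.abs_sum_le_sum_abs _ _).trans ?_
    refine (Finset.sum_le_card_nsmul _ _ (B * (δ * H) + δ * H) fun j _ => ?_).trans
      (by simp [mul_add])
    refine (abs_add_le _ _).trans ?_
    rw [abs_mul, abs_mul]
    exact add_le_add (mul_le_mul (hw j) (hhh j) (abs_nonneg _) hB)
      (mul_le_mul (hww j) (hh' j) (abs_nonneg _) hδ)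
  refine (abs_add_le _ _).trans ?_
  have h2 : δ * (((m : ℝ) + 1) * (B + 1) * H) ≤ δ * (Q * H) := by gcongr
  have hm : (0 : ℝ) ≤ m := Nat.cast_nonneg m
  have h3 : δ ≤ δ * H := by nlinarith
  have h4 : 0 ≤ B * (δ * H) := by positivity
  nlinarith

lemma net_lip {ν : ℝ} (h0 : 0 ≤ ν) (h1 : ν < 1) {d r L : ℕ} (hL : 1 ≤ L) {a B δ Q : ℝ}
    (ha : 1 ≤ a) (hB : 0 ≤ B) (hδ : 0 ≤ δ)
    (hQr : ((r : ℝ) + 1) * (B + 1) ≤ Q) (hQd : ((d : ℝ) + 1) * (B + 1) ≤ Q)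
    (θ θ' : ParamIdx d r L → ℝ) (hθ : ∀ i, |θ i| ≤ B) (hθ' : ∀ i, |θ' i| ≤ B)
    (hθθ : ∀ i, |θ i - θ' i| ≤ δ) (x : Fin d → ℝ) (hx : x ∈ cube a d) :
    |netOfParams ν d r L θ x - netOfParams ν d r L θ' x| ≤ δ * (Q ^ (L + 1) * a) := by
  have hQ1 : 1 ≤ Q := by
    have : (0 : ℝ) ≤ r := Nat.cast_nonneg r
    nlinarith
  have hpow : ∀ k, 1 ≤ Q ^ k * a := fun k => by
    have := one_le_pow₀ hQ1 (n := k)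
    nlinarith
  have hfold : ∀ (ls : List (Fin (L - 1))) (k : ℕ) (h h' : Fin r → ℝ),
      (∀ i, |h i| ≤ Q ^ k * a ∧ |h' i| ≤ Q ^ k * a ∧ |h i - h' i| ≤ δ * (Q ^ k * a)) →
      ∀ i, |ls.foldl (fun h l => fun i =>
        lrelu ν ((∑ j, θ (Sum.inr (Sum.inr (Sum.inl (l, i, j)))) * h j) +
        θ (Sum.inr (Sum.inr (Sum.inr (Sum.inl (l, i))))))) h i| ≤ Q ^ (k + ls.length) * a ∧
        |ls.foldl (fun h l => fun i =>
        lrelu ν ((∑ j, θ' (Sum.inr (Sum.inr (Sum.inl (l, i, j)))) * h j) +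
        θ' (Sum.inr (Sum.inr (Sum.inr (Sum.inl (l, i))))))) h' i| ≤ Q ^ (k + ls.length) * a ∧
        |ls.foldl (fun h l => fun i =>
        lrelu ν ((∑ j, θ (Sum.inr (Sum.inr (Sum.inl (l, i, j)))) * h j) +
        θ (Sum.inr (Sum.inr (Sum.inr (Sum.inl (l, i))))))) h i - ls.foldl (fun h l => fun i =>
        lrelu ν ((∑ j, θ' (Sum.inr (Sum.inr (Sum.inl (l, i, j)))) * h j) +
        θ' (Sum.inr (Sum.inr (Sum.inr (Sum.inl (l, i))))))) h' i| ≤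
          δ * (Q ^ (k + ls.length) * a) := by
    intro ls
    induction ls with
    | nil => intro k h h' hh i; simpa using hh i
    | cons l ls ih =>
      intro k h h' hh i
      simp only [List.foldl_cons, List.length_cons]
      rw [show k + (ls.length + 1) = (k + 1) + ls.length by ring]
      refine ih (k + 1) _ _ ?_ i
      intro i
      obtain ⟨a1, a2, a3⟩ := aff_inv hB hδ (hpow k) hQr
        (fun j => θ (Sum.inr (Sum.inr (Sum.inl (l, i, j)))))
        (fun j => θ' (Sum.inr (Sum.inr (Sum.inl (l, i, j))))) h h'
        (θ (Sum.inr (Sum.inr (Sum.inr (Sum.inl (l, i))))))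
        (θ' (Sum.inr (Sum.inr (Sum.inr (Sum.inl (l, i)))))) (fun _ => hθ _) (fun _ => hθ' _)
        (hθ _) (hθ' _) (fun _ => hθθ _) (hθθ _) (fun j => (hh j).1) (fun j => (hh j).2.1)
        (fun j => (hh j).2.2)
      rw [show Q ^ (k + 1) * a = Q * (Q ^ k * a) by ring]
      exact ⟨(lrelu_abs h0 h1 _).trans a1, (lrelu_abs h0 h1 _).trans a2,
        (lrelu_lip h0 h1 _ _).trans a3⟩
  have hx' : ∀ j, |x j| ≤ a := fun j => abs_le.2 (hx j)
  have hfirst : ∀ i, |lrelu ν ((∑ j, θ (Sum.inl (i, j)) * x j) + θ (Sum.inr (Sum.inl i)))| ≤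
      Q ^ 1 * a ∧ |lrelu ν ((∑ j, θ' (Sum.inl (i, j)) * x j) + θ' (Sum.inr (Sum.inl i)))| ≤
      Q ^ 1 * a ∧ |lrelu ν ((∑ j, θ (Sum.inl (i, j)) * x j) + θ (Sum.inr (Sum.inl i))) -
      lrelu ν ((∑ j, θ' (Sum.inl (i, j)) * x j) + θ' (Sum.inr (Sum.inl i)))| ≤
        δ * (Q ^ 1 * a) := by
    intro i
    obtain ⟨a1, a2, a3⟩ := aff_inv hB hδ ha hQd
        (fun j => θ (Sum.inl (i, j))) (fun j => θ' (Sum.inl (i, j))) x x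
        (θ (Sum.inr (Sum.inl i))) (θ' (Sum.inr (Sum.inl i))) (fun _ => hθ _) (fun _ => hθ' _)
        (hθ _) (hθ' _) (fun _ => hθθ _) (hθθ _) hx' hx'
        (fun j => by simp; positivity)
    rw [pow_one]
    exact ⟨(lrelu_abs h0 h1 _).trans a1, (lrelu_abs h0 h1 _).trans a2,
        (lrelu_lip h0 h1 _ _).trans a3⟩
  have hlast := hfold (List.finRange (L - 1)) 1 _ _ hfirst
  have := (aff_inv hB hδ (hpow _) hQr
    (fun i => θ (Sum.inr (Sum.inr (Sum.inr (Sum.inr (Sum.inl i))))))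
    (fun i => θ' (Sum.inr (Sum.inr (Sum.inr (Sum.inr (Sum.inl i)))))) _ _
    (θ (Sum.inr (Sum.inr (Sum.inr (Sum.inr (Sum.inr ()))))))
    (θ' (Sum.inr (Sum.inr (Sum.inr (Sum.inr (Sum.inr ())))))) (fun _ => hθ _) (fun _ => hθ' _)
        (hθ _) (hθ' _) (fun _ => hθθ _) (hθθ _) (fun j => (hlast j).1) (fun j => (hlast j).2.1)
        (fun j => (hlast j).2.2)).2.2
  refine le_of_le_of_eq this ?_
  rw [List.length_finRange, show L + 1 = (1 + (L - 1)) + 1 by omega, pow_succ]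
  ring

lemma prior_box {ι : Type*} [Fintype ι] (Pr : Measure (ι → ℝ)) (p : (ι → ℝ) → ℝ)
    (hp : Pr = volume.withDensity fun θ => ENNReal.ofReal (p θ)) {κ δκ δ : ℝ} (hδκ : 0 < δκ)
    (hδ : 0 < δ)
    (hlow : ∀ θ : ι → ℝ, (∀ i, |θ i| ≤ κ) → δκ ^ Fintype.card ι ≤ p θ)
    (θ₀ : ι → ℝ) (hθ₀ : ∀ i, |θ₀ i| + δ ≤ κ) :
    ENNReal.ofReal ((δκ * (2 * δ)) ^ Fintype.card ι) ≤ Pr {θ | ∀ i, |θ i - θ₀ i| ≤ δ} := by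
  have hset : {θ : ι → ℝ | ∀ i, |θ i - θ₀ i| ≤ δ} =
      Set.pi Set.univ fun i => Set.Icc (θ₀ i - δ) (θ₀ i + δ) := by
    ext θ
    simp only [Set.mem_ofPred_eq, Set.mem_pi, Set.mem_univ, true_implies, Set.mem_Icc, abs_le]
    exact forall_congr' fun i => ⟨fun h => ⟨by linarith [h.1], by linarith [h.2]⟩,
      fun h => ⟨by linarith [h.1], by linarith [h.2]⟩⟩
  have hm : MeasurableSet {θ : ι → ℝ | ∀ i, |θ i - θ₀ i| ≤ δ} := by
    rw [hset]; exact MeasurableSet.univ_pi fun i => measurableSet_Icc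
  rw [hp, withDensity_apply _ hm]
  have hvol : volume {θ : ι → ℝ | ∀ i, |θ i - θ₀ i| ≤ δ} =
      ENNReal.ofReal ((2 * δ) ^ Fintype.card ι) := by
    rw [hset, volume_pi_pi]
    simp only [Real.volume_Icc]
    rw [Finset.prod_congr rfl (g := fun _ => ENNReal.ofReal (2 * δ))
      (fun i _ => by congr 1; ring), Finset.prod_const, Finset.card_univ,
      ENNReal.ofReal_pow (by positivity)]
  calc ENNReal.ofReal ((δκ * (2 * δ)) ^ Fintype.card ι) =
        ENNReal.ofReal (δκ ^ Fintype.card ι) * volume {θ : ι → ℝ | ∀ i, |θ i - θ₀ i| ≤ δ} := by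
        rw [hvol, ← ENNReal.ofReal_mul (by positivity), mul_pow]
    _ = ∫⁻ θ in {θ : ι → ℝ | ∀ i, |θ i - θ₀ i| ≤ δ}, ENNReal.ofReal (δκ ^ Fintype.card ι) := by
        rw [setLIntegral_const]
    _ ≤ _ := by
        refine setLIntegral_mono' hm fun θ hθ => ENNReal.ofReal_le_ofReal (hlow θ fun i => ?_)
        have h1 := hθ i
        have h2 := hθ₀ i
        have h3 := abs_add_le (θ i - θ₀ i) (θ₀ i)
        rw [sub_add_cancel] at h3
        linarith

lemma sigma_box (Pr : Measure ℝ) (p : ℝ → ℝ) (v : ℝ) (hv : 0 < v)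
    (hp : Pr = volume.withDensity fun s => ENNReal.ofReal (p s))
    (hc : ContinuousOn p (Set.Ioo 0 (2 * v))) (hpos : ∀ s ∈ Set.Ioo 0 (2 * v), 0 < p s) :
    ∃ c η : ℝ, 0 < c ∧ 0 < η ∧ ∀ h, 0 < h → h ≤ η →
      ENNReal.ofReal (c * h) ≤ Pr (Set.Icc v (v + h)) := by
  have hvm : v ∈ Set.Ioo 0 (2 * v) := ⟨hv, by linarith⟩
  have hca : ContinuousAt p v := hc.continuousAt (Ioo_mem_nhds hvm.1 hvm.2)
  have hev : ∀ᶠ s in nhds v, p v / 2 < p s :=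
    hca.eventually (lt_mem_nhds (by linarith [hpos v hvm]))
  obtain ⟨η, hη, hball⟩ := Metric.eventually_nhds_iff.1 hev
  refine ⟨p v / 2, η / 2, by linarith [hpos v hvm], by linarith, fun h hh hle => ?_⟩
  rw [hp, withDensity_apply _ measurableSet_Icc]
  calc ENNReal.ofReal (p v / 2 * h) = ENNReal.ofReal (p v / 2) * volume (Set.Icc v (v + h)) := by
        rw [Real.volume_Icc, ← ENNReal.ofReal_mul (by linarith [hpos v hvm])]
        congr 2; ring
    _ = ∫⁻ s in Set.Icc v (v + h), ENNReal.ofReal (p v / 2) := by rw [setLIntegral_const]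
    _ ≤ _ := by
        refine setLIntegral_mono' measurableSet_Icc fun s hs =>
          ENNReal.ofReal_le_ofReal (hball ?_).le
        rw [Real.dist_eq, abs_of_nonneg (by linarith [hs.1])]
        linarith [hs.2]

end Nets


section Rates

variable {P : Finset (ℝ × ℕ)} {hP : P.Nonempty}

lemma log_ge_one {n : ℕ} (hn : 3 ≤ n) : 1 ≤ Real.log n := by
  rw [Real.le_log_iff_exp_le (by positivity)]
  have h := Real.exp_one_lt_d9
  have : (3 : ℝ) ≤ n := by exact_mod_cast hn
  linarith

lemma W_ge_one (hpos : ∀ p ∈ P, 0 < p.1) {n : ℕ} (hn : 1 ≤ n) : 1 ≤ maxWidthExp P hP n := by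
  obtain ⟨p, hp⟩ := hP
  unfold maxWidthExp
  refine le_trans ?_ (Finset.le_sup' (fun p : ℝ × ℕ => (n : ℝ) ^ ((p.2 : ℝ) / (2 * (2 * p.1 + p.2)))) hp)
  have := hpos p hp
  exact Real.one_le_rpow (by exact_mod_cast hn) (by positivity)

lemma W_sq_le (hpos : ∀ p ∈ P, 0 < p.1) {n : ℕ} (hn : 1 ≤ n) : maxWidthExp P hP n ^ 2 ≤ n := by
  have hn0 : (0 : ℝ) ≤ n := Nat.cast_nonneg n
  have h1 : maxWidthExp P hP n ≤ Real.sqrt n := by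
    unfold maxWidthExp
    refine Finset.sup'_le _ _ fun p hp => ?_
    rw [Real.sqrt_eq_rpow]
    apply Real.rpow_le_rpow_of_exponent_le (by exact_mod_cast hn)
    have := hpos p hp
    rw [div_le_div_iff₀ (by positivity) (by norm_num)]
    nlinarith
  have h2 := W_ge_one (hP := hP) hpos hn
  calc _ ≤ Real.sqrt n ^ 2 := by gcongr
    _ = n := Real.sq_sqrt hn0

lemma rate_eq (hpos : ∀ p ∈ P, 0 < p.1) {n : ℕ} (hn : 1 ≤ n) :
    maxRate P hP n = (n : ℝ) ^ (-(1 / 2) : ℝ) * maxWidthExp P hP n := by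
  have hn0 : (0 : ℝ) < n := by exact_mod_cast hn
  have key : ∀ p ∈ P, (n : ℝ) ^ (-(p.1 / (2 * p.1 + p.2))) =
      (n : ℝ) ^ (-(1 / 2) : ℝ) * (n : ℝ) ^ ((p.2 : ℝ) / (2 * (2 * p.1 + p.2))) := by
    intro p hp
    rw [← Real.rpow_add hn0]
    congr 1
    have := hpos p hp
    have h2 : 2 * p.1 + (p.2 : ℝ) ≠ 0 := by positivity
    field_simp
    ring
  have hc : 0 < (n : ℝ) ^ (-(1 / 2) : ℝ) := Real.rpow_pos_of_pos hn0 _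
  unfold maxRate maxWidthExp
  apply le_antisymm
  · refine Finset.sup'_le _ _ fun p hp => ?_
    rw [key p hp]
    gcongr
    exact Finset.le_sup' (fun p : ℝ × ℕ => (n : ℝ) ^ ((p.2 : ℝ) / (2 * (2 * p.1 + p.2)))) hp
  · obtain ⟨p, hp, he⟩ := Finset.exists_mem_eq_sup' hP
      (fun p : ℝ × ℕ => (n : ℝ) ^ ((p.2 : ℝ) / (2 * (2 * p.1 + p.2))))
    rw [he, ← key p hp]
    exact Finset.le_sup' (fun p : ℝ × ℕ => (n : ℝ) ^ (-(p.1 / (2 * p.1 + p.2)))) hp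

lemma rate_pos (hpos : ∀ p ∈ P, 0 < p.1) {n : ℕ} (hn : 1 ≤ n) : 0 < maxRate P hP n := by
  rw [rate_eq hpos hn]
  have hn0 : (0 : ℝ) < n := by exact_mod_cast hn
  have := W_ge_one (hP := hP) hpos hn
  positivity

lemma rate_sq (hpos : ∀ p ∈ P, 0 < p.1) {n : ℕ} (hn : 1 ≤ n) :
    n * maxRate P hP n ^ 2 = maxWidthExp P hP n ^ 2 := by
  rw [rate_eq hpos hn]
  have hn0 : (0 : ℝ) < n := by exact_mod_cast hn
  rw [mul_pow, ← Real.rpow_natCast, ← Real.rpow_mul hn0.le, ← mul_assoc]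
  norm_num
  rw [Real.rpow_neg_one, mul_inv_cancel₀ hn0.ne', one_mul]

lemma rate_le_one (hpos : ∀ p ∈ P, 0 < p.1) {n : ℕ} (hn : 1 ≤ n) : maxRate P hP n ≤ 1 := by
  unfold maxRate
  refine Finset.sup'_le _ _ fun p hp => ?_
  have := hpos p hp
  exact Real.rpow_le_one_of_one_le_of_nonpos (by exact_mod_cast hn) (by
    have : 0 ≤ p.1 / (2 * p.1 + p.2) := by positivity
    linarith)

lemma rate_ge (hpos : ∀ p ∈ P, 0 < p.1) {n : ℕ} (hn : 1 ≤ n) : 1 / (n : ℝ) ≤ maxRate P hP n := by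
  have hn1 : (1 : ℝ) ≤ n := by exact_mod_cast hn
  have h1 := rate_sq (hP := hP) hpos hn
  have h2 := W_ge_one (hP := hP) hpos hn
  have h3 := rate_pos (hP := hP) hpos hn
  have h4 := rate_le_one (hP := hP) hpos hn
  rw [div_le_iff₀ (by linarith)]
  have h5 : maxRate P hP n ^ 2 ≤ maxRate P hP n := by nlinarith
  have h6 : (1 : ℝ) ≤ maxWidthExp P hP n ^ 2 := one_le_pow₀ h2
  have h7 : (n : ℝ) * maxRate P hP n ^ 2 ≤ n * maxRate P hP n := by gcongr
  linarith

variable {ε : ℕ → ℝ} {γ : ℝ}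

lemma logpow_ge (hγ : 2 < γ) {n : ℕ} (hn : 3 ≤ n) : Real.log n ^ 2 ≤ Real.log n ^ γ := by
  rw [← Real.rpow_two]
  exact Real.rpow_le_rpow_of_exponent_le (log_ge_one hn) hγ.le

lemma eps_ge (hpos : ∀ p ∈ P, 0 < p.1) (hγ : 2 < γ)
    (hε : ∀ n : ℕ, ε n = maxRate P hP n * Real.log n ^ γ) {n : ℕ} (hn : 3 ≤ n) :
    maxRate P hP n ≤ ε n := by
  rw [hε]
  have h1 := logpow_ge hγ hn
  have h2 := log_ge_one hn
  have h3 := rate_pos (hP := hP) hpos (show 1 ≤ n by omega)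
  have h4 : 1 ≤ Real.log n ^ 2 := one_le_pow₀ h2
  nlinarith

lemma dominate (hpos : ∀ p ∈ P, 0 < p.1) (hγ : 2 < γ)
    (hε : ∀ n : ℕ, ε n = maxRate P hP n * Real.log n ^ γ) {c : ℝ} (hc : 0 < c) (C : ℝ) :
    ∀ᶠ n : ℕ in atTop, C * (maxWidthExp P hP n ^ 2 * Real.log n ^ 3) ≤ c * (n * ε n ^ 2) := by
  have hlog : Tendsto (fun n : ℕ => Real.log n) atTop atTop :=
    Real.tendsto_log_atTop.comp tendsto_natCast_atTop_atTop
  filter_upwards [hlog.eventually_ge_atTop (C / c), eventually_ge_atTop 3] with n h1 hn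
  have h2 := log_ge_one hn
  have h3 := logpow_ge hγ hn
  rw [div_le_iff₀ hc] at h1
  have h4 : (n : ℝ) * ε n ^ 2 = maxWidthExp P hP n ^ 2 * (Real.log n ^ γ) ^ 2 := by
    rw [← rate_sq hpos (by omega : 1 ≤ n), hε]; ring
  rw [h4]
  have h5 : (Real.log n ^ 2) ^ 2 ≤ (Real.log n ^ γ) ^ 2 := by gcongr
  have h0 : 0 ≤ maxWidthExp P hP n ^ 2 := sq_nonneg _
  calc C * (maxWidthExp P hP n ^ 2 * Real.log n ^ 3) ≤
        (Real.log n * c) * (maxWidthExp P hP n ^ 2 * Real.log n ^ 3) := by gcongr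
    _ = c * (maxWidthExp P hP n ^ 2 * (Real.log n ^ 2) ^ 2) := by ring
    _ ≤ _ := by gcongr

lemma eps_tendsto (hpos : ∀ p ∈ P, 0 < p.1)
    (hε : ∀ n : ℕ, ε n = maxRate P hP n * Real.log n ^ γ) : Tendsto ε atTop (nhds 0) := by
  have key : ∀ p ∈ P, Tendsto (fun n : ℕ => (n : ℝ) ^ (-(p.1 / (2 * p.1 + p.2))) * Real.log n ^ γ)
      atTop (nhds 0) := by
    intro p hp
    have hp0 := hpos p hp
    have h1 : (fun x : ℝ => Real.log x ^ γ) =o[atTop] fun x => x ^ (p.1 / (2 * p.1 + p.2)) :=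
      isLittleO_log_rpow_rpow_atTop γ (by positivity)
    have h2 := (h1.tendsto_div_nhds_zero).comp tendsto_natCast_atTop_atTop
    refine h2.congr fun n => ?_
    simp only [Function.comp]
    rw [Real.rpow_neg (Nat.cast_nonneg n), div_eq_inv_mul]
  have hsum : Tendsto (fun n : ℕ => ∑ p ∈ P, (n : ℝ) ^ (-(p.1 / (2 * p.1 + p.2))) * Real.log n ^ γ)
      atTop (nhds 0) := by
    have := tendsto_finsetSum P key
    simpa using this
  refine tendsto_of_tendsto_of_tendsto_of_le_of_le' tendsto_const_nhds hsum ?_ ?_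
  · filter_upwards [eventually_ge_atTop 3] with n hn
    rw [hε]
    have h2 := log_ge_one hn
    have h3 := rate_pos (hP := hP) hpos (show 1 ≤ n by omega)
    positivity
  · filter_upwards [eventually_ge_atTop 3] with n hn
    rw [hε, ← Finset.sum_mul]
    have h2 := log_ge_one hn
    gcongr
    unfold maxRate
    refine Finset.sup'_le _ _ fun p hp => ?_
    exact Finset.single_le_sum (f := fun p : ℝ × ℕ => (n : ℝ) ^ (-(p.1 / (2 * p.1 + p.2))))
      (fun p _ => by positivity) hp

lemma neps_tendsto (hpos : ∀ p ∈ P, 0 < p.1) (hγ : 2 < γ)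
    (hε : ∀ n : ℕ, ε n = maxRate P hP n * Real.log n ^ γ) :
    Tendsto (fun n : ℕ => (n : ℝ) * ε n ^ 2) atTop atTop := by
  have hlog : Tendsto (fun n : ℕ => Real.log n) atTop atTop :=
    Real.tendsto_log_atTop.comp tendsto_natCast_atTop_atTop
  refine tendsto_atTop_mono' _ ?_ hlog
  filter_upwards [dominate (hP := hP) hpos hγ hε one_pos 1, eventually_ge_atTop 3] with n h1 hn
  have h2 := log_ge_one hn
  have h3 : 1 ≤ maxWidthExp P hP n ^ 2 := one_le_pow₀ (W_ge_one hpos (by omega))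
  have h4 : Real.log n ≤ Real.log n ^ 3 := by
    calc _ = Real.log n ^ 1 := (pow_one _).symm
      _ ≤ _ := pow_le_pow_right₀ h2 (by norm_num)
  nlinarith [pow_pos (show 0 < Real.log n by linarith) 3]

lemma arch_bounds (hpos : ∀ p ∈ P, 0 < p.1) (d : ℕ) {CL Cr : ℝ} (hCL : 0 < CL) (hCr : 0 < Cr) :
    ∃ C : ℝ, 1 ≤ C ∧ ∀ n : ℕ, 3 ≤ n → 1 ≤ LdepthH CL n ∧
      (rwidthH Cr P hP n : ℝ) ≤ C * maxWidthExp P hP n ∧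
      ((LdepthH CL n : ℝ) + 1) ≤ C * Real.log n ∧
      (Fintype.card (ParamIdx d (rwidthH Cr P hP n) (LdepthH CL n)) : ℝ) ≤
        C * (maxWidthExp P hP n ^ 2 * Real.log n) := by
  have hl2 : 0 < Real.log 2 := Real.log_pos (by norm_num)
  set A := CL / Real.log 2 + 2 with hA
  set R := Cr + 1 with hR
  have hA2 : 2 ≤ A := by have : 0 < CL / Real.log 2 := by positivity
                         linarith
  have hR1 : 1 ≤ R := by linarith
  refine ⟨A + R + ((d + 2) * R + A * (2 * R ^ 2) + 1), by
    have : 0 ≤ ((d : ℝ) + 2) * R + A * (2 * R ^ 2) := by positivity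
    linarith, fun n hn => ?_⟩
  have hl := log_ge_one hn
  have hW := W_ge_one (hP := hP) hpos (show 1 ≤ n by omega)
  set W := maxWidthExp P hP n with hWdef
  set ℓ := Real.log n with hℓ
  have hlogb : Real.logb 2 n = ℓ / Real.log 2 := rfl
  have hL1 : 1 ≤ LdepthH CL n := by
    unfold LdepthH
    rw [Nat.one_le_ceil_iff, hlogb]
    positivity
  have hLb : (LdepthH CL n : ℝ) + 1 ≤ A * ℓ := by
    unfold LdepthH
    have := (Nat.ceil_lt_add_one (show 0 ≤ CL * Real.logb 2 n by rw [hlogb]; positivity)).le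
    rw [hlogb] at this ⊢
    have e : CL * (ℓ / Real.log 2) = CL / Real.log 2 * ℓ := by ring
    rw [e] at this ⊢
    rw [hA]
    nlinarith
  have hrb : (rwidthH Cr P hP n : ℝ) ≤ R * W := by
    unfold rwidthH
    have := (Nat.ceil_lt_add_one (show 0 ≤ Cr * W by positivity)).le
    rw [hR]
    nlinarith
  have hpd : 0 ≤ ((d : ℝ) + 2) * R + A * (2 * R ^ 2) + 1 := by positivity
  refine ⟨hL1, hrb.trans (by gcongr; linarith), hLb.trans (by gcongr; linarith), ?_⟩
  set r := rwidthH Cr P hP n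
  set L := LdepthH CL n
  have hcard : (Fintype.card (ParamIdx d r L) : ℝ) ≤ (d + 2) * r + L * (r ^ 2 + r) + 1 := by
    simp only [Fintype.card_sum, Fintype.card_prod, Fintype.card_fin, Fintype.card_unit]
    have hc : ((L - 1 : ℕ) : ℝ) ≤ L := by exact_mod_cast Nat.sub_le _ _
    push_cast
    have : (0 : ℝ) ≤ (r : ℝ) ^ 2 + r := by positivity
    nlinarith
  have hr0 : (0 : ℝ) ≤ r := Nat.cast_nonneg _
  have hWW : W ≤ W ^ 2 := by nlinarith
  have hWl : W ^ 2 ≤ W ^ 2 * ℓ := by nlinarith [sq_nonneg W]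
  have hRW : 1 ≤ R * W := by nlinarith
  have hLA : (L : ℝ) ≤ A * ℓ := by linarith
  calc _ ≤ _ := hcard
    _ ≤ (d + 2) * (R * W) + (A * ℓ) * ((R * W) ^ 2 + (R * W) ^ 2) + 1 := by
        have h1 : (r : ℝ) ^ 2 ≤ (R * W) ^ 2 := by gcongr
        have h2 : (r : ℝ) ≤ (R * W) ^ 2 := by nlinarith
        gcongr
    _ ≤ (d + 2) * (R * (W ^ 2 * ℓ)) + A * (2 * R ^ 2) * (W ^ 2 * ℓ) + 1 * (W ^ 2 * ℓ) := by
        have h1 : W ≤ W ^ 2 * ℓ := hWW.trans hWl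
        have h2 : (A * ℓ) * ((R * W) ^ 2 + (R * W) ^ 2) = A * (2 * R ^ 2) * (W ^ 2 * ℓ) := by ring
        rw [h2]
        have h3 : 1 ≤ W ^ 2 * ℓ := hW.trans h1
        gcongr
        linarith
    _ = ((d + 2) * R + A * (2 * R ^ 2) + 1) * (W ^ 2 * ℓ) := by ring
    _ ≤ _ := by
        refine mul_le_mul_of_nonneg_right ?_ (by positivity)
        linarith

end Rates


section Rates2

lemma polylog {n : ℕ} (hn : 3 ≤ n) {C x : ℝ} (hC : 1 ≤ C) (hx : 0 < x) (k : ℕ)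
    (h : x ≤ C * (n : ℝ) ^ k) : Real.log x ≤ (Real.log C + k) * Real.log n := by
  have hl := log_ge_one hn
  have hn0 : (0 : ℝ) < n := by positivity
  have hC0 : 0 ≤ Real.log C := Real.log_nonneg hC
  calc Real.log x ≤ Real.log (C * (n : ℝ) ^ k) := Real.log_le_log hx h
    _ = Real.log C + k * Real.log n := by
        rw [Real.log_mul (by positivity) (by positivity), Real.log_pow]
    _ ≤ _ := by nlinarith

variable {P : Finset (ℝ × ℕ)} {hP : P.Nonempty} {ε : ℕ → ℝ} {γ : ℝ}

set_option maxHeartbeats 2000000 in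
lemma net_entropy_core {n d r L T : ℕ} (hn : 3 ≤ n) (hL1 : 1 ≤ L)
    (hTd : Fintype.card (ParamIdx d r L) = T) {C W ℓ ε ξ F c CJ C3 : ℝ} {k : ℕ} (hℓ : ℓ = Real.log n)
    (hr : (r : ℝ) ≤ C * W) (hL : (L : ℝ) + 1 ≤ C * ℓ) (hT : (T : ℝ) ≤ C * (W ^ 2 * ℓ))
    (hW : 1 ≤ W) (hW2 : W ^ 2 ≤ n) (heps : 1 / (n : ℝ) ≤ ε) (hF : 0 < F) (hξ : 0 < ξ) (hC1 : 1 ≤ C)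
    (hk : 2 * c < k * (3 * ξ ^ 2 / (16 * F ^ 2))) (hCJ : CJ = 4 * F / ξ + 2)
    (hC3 : C3 = 1 + C * (k * (C + CJ) * C + 1))
    (hne : 3 * ξ ^ 2 / (16 * F ^ 2) * ε ^ 2 ≤ 1)
    (hdom : (1 + C * C * (Real.log C3 + (5 : ℕ))) * (W ^ 2 * ℓ ^ 3) ≤ c * (n * ε ^ 2))
    {ν : ℝ} (hν : ν < 1) (PX : Measure (Fin d → ℝ)) [IsProbabilityMeasure PX] :
    ∃ S : Finset (ParamIdx d r L → ℝ),
      (S.card : ℝ) ≤ Real.exp (c * (n * ε ^ 2)) ∧ ∀ θ, ∃ θ' ∈ S,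
      ∫ x, (trunc F (netOfParams ν d r L θ x) - trunc F (netOfParams ν d r L θ' x)) ^ 2 ∂PX
        ≤ (ξ * ε) ^ 2 := by
  have hl : 1 ≤ ℓ := hℓ ▸ log_ge_one hn
  have hn3 : (3 : ℝ) ≤ n := by exact_mod_cast hn
  have hn0 : (0 : ℝ) < n := by linarith
  have heps0 : 0 < ε := lt_of_lt_of_le (by positivity) heps
  have hlogn : ℓ ≤ n := by
    rw [hℓ]
    exact (Real.log_le_sub_one_of_pos hn0).trans (by linarith)
  have hCJ0 : 0 < CJ := by rw [hCJ]; positivity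
  have hC31 : 1 ≤ C3 := by
    have : 0 ≤ C * (k * (C + CJ) * C + 1) := by positivity
    linarith
  have hC30 : 0 ≤ Real.log C3 := Real.log_nonneg hC31
  set J := ⌈2 * F / (ξ * ε / 2)⌉₊ with hJ
  have hJb : (J : ℝ) + 1 ≤ CJ * n := by
    have h1 := (Nat.ceil_lt_add_one (show 0 ≤ 2 * F / (ξ * ε / 2) by positivity)).le
    have h2 : 2 * F / (ξ * ε / 2) ≤ 4 * F / ξ * n := by
      rw [div_le_iff₀ (by positivity)]
      have h3 : 1 ≤ n * ε := by rw [div_le_iff₀ hn0] at heps; linarith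
      have h4 : 4 * F / ξ * n * (ξ * ε / 2) = 2 * F * (n * ε) := by field_simp; ring
      rw [h4]
      nlinarith
    rw [hCJ]
    have h5 : (J : ℝ) ≤ 2 * F / (ξ * ε / 2) + 1 := h1
    nlinarith
  have hWn : W ≤ n := by nlinarith
  have hX : ((1 + T * (k * n * (r + (J + 1)) * (L + 1) + 1) : ℕ) : ℝ) ≤ C3 * (n : ℝ) ^ 5 := by
    push_cast
    have e1 : (T : ℝ) ≤ C * (n * n) := hT.trans (by gcongr)
    have e2 : (r : ℝ) ≤ C * n := hr.trans (by gcongr)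
    have e3 : (L : ℝ) + 1 ≤ C * n := hL.trans (by gcongr)
    have hT0 : (0 : ℝ) ≤ T := Nat.cast_nonneg _
    have e4 : (1 : ℝ) ≤ (n : ℝ) ^ 3 := one_le_pow₀ (by linarith)
    have e5 : (1 : ℝ) ≤ (n : ℝ) ^ 5 := one_le_pow₀ (by linarith)
    calc (1 : ℝ) + T * (k * n * (r + (J + 1)) * (L + 1) + 1)
        ≤ (n : ℝ) ^ 5 + C * (n * n) * (k * n * (C * n + CJ * n) * (C * n) + n ^ 3) := by gcongr
      _ = C3 * (n : ℝ) ^ 5 := by rw [hC3]; ring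
  have hXpos : (0 : ℝ) < ((1 + T * (k * n * (r + (J + 1)) * (L + 1) + 1) : ℕ) : ℝ) := by
    push_cast; positivity
  have hlogX := polylog hn hC31 hXpos 5 hX
  rw [← hℓ] at hlogX
  set X := (1 + T * (k * n * (r + (J + 1)) * (L + 1) + 1) : ℕ) with hXdef
  have hwr : (wrB T (k * n * (r + (J + 1))) (L + 1)) ^ (L + 1) = X ^ (T * (L + 1)) := by
    unfold wrB
    rw [← pow_mul]
  have hbig : ((X ^ (T * (L + 1)) : ℕ) : ℝ) + 1 ≤ Real.exp (c * (n * ε ^ 2)) := by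
    have hX1 : (1 : ℝ) ≤ ((X ^ (T * (L + 1)) : ℕ) : ℝ) := by
      have : 0 < X := by rw [hXdef]; omega
      exact_mod_cast Nat.one_le_iff_ne_zero.2 (pow_pos this _).ne'
    have h1 : ((X ^ (T * (L + 1)) : ℕ) : ℝ) =
        Real.exp ((T : ℝ) * (L + 1) * Real.log X) := by
      push_cast
      have : (T : ℝ) * (L + 1) * Real.log X = ((T * (L + 1) : ℕ) : ℝ) * Real.log X := by push_cast; ring
      rw [this, Real.exp_nat_mul, Real.exp_log hXpos]
    calc ((X ^ (T * (L + 1)) : ℕ) : ℝ) + 1 ≤ 2 * ((X ^ (T * (L + 1)) : ℕ) : ℝ) := by linarith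
      _ ≤ Real.exp 1 * ((X ^ (T * (L + 1)) : ℕ) : ℝ) := by
          gcongr
          linarith [Real.add_one_le_exp 1]
      _ = Real.exp (1 + (T : ℝ) * (L + 1) * Real.log X) := by rw [h1, ← Real.exp_add]
      _ ≤ _ := by
          apply Real.exp_le_exp.2
          refine le_trans ?_ hdom
          have hs : 1 ≤ W ^ 2 * ℓ ^ 3 := one_le_mul_of_one_le_of_one_le (one_le_pow₀ hW) (one_le_pow₀ hl)
          have h3 : (T : ℝ) * (L + 1) * Real.log X ≤
              (C * (W ^ 2 * ℓ)) * (C * ℓ) * ((Real.log C3 + (5 : ℕ)) * ℓ) := by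
            by_cases hneg : 0 ≤ Real.log X
            · gcongr
            · have : 0 ≤ (C * (W ^ 2 * ℓ)) * (C * ℓ) * ((Real.log C3 + (5 : ℕ)) * ℓ) := by positivity
              have h0 : 0 ≤ (T : ℝ) * (L + 1) := by positivity
              nlinarith
          calc _ ≤ W ^ 2 * ℓ ^ 3 + (C * (W ^ 2 * ℓ)) * (C * ℓ) * ((Real.log C3 + (5 : ℕ)) * ℓ) := by
                linarith
            _ = _ := by ring
  obtain ⟨S, hS1, hS2⟩ := net_cover (d := d) (r := r) (L := L) hL1 hν hF
    (δ := ξ * ε) (by positivity) PX (k * n) J ⌊Real.exp (c * (n * ε ^ 2))⌋₊ (Nat.le_ceil _)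
    (by
      have hfl : ((⌊Real.exp (c * (n * ε ^ 2))⌋₊ : ℕ) : ℝ) ≤ Real.exp (c * (n * ε ^ 2)) :=
        Nat.floor_le (Real.exp_pos _).le
      have e0 : 3 * (ξ * ε) ^ 2 / (16 * F ^ 2) = 3 * ξ ^ 2 / (16 * F ^ 2) * ε ^ 2 := by ring
      rw [e0]
      set x := 3 * ξ ^ 2 / (16 * F ^ 2)
      have e1 : (1 - x * ε ^ 2) ^ (k * n) ≤ Real.exp (-(x * k * (n * ε ^ 2))) := by
        calc (1 - x * ε ^ 2) ^ (k * n) ≤ (Real.exp (-(x * ε ^ 2))) ^ (k * n) := by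
              refine pow_le_pow_left₀ (by linarith) ?_ _
              linarith [Real.add_one_le_exp (-(x * ε ^ 2))]
          _ = _ := by
              rw [← Real.exp_nat_mul]
              congr 1
              push_cast
              ring
      have hne0 : 0 < n * ε ^ 2 := by positivity
      calc _ ≤ Real.exp (c * (n * ε ^ 2)) ^ 2 * Real.exp (-(x * k * (n * ε ^ 2))) := by
            gcongr
        _ = Real.exp ((2 * c - x * k) * (n * ε ^ 2)) := by
            rw [← Real.exp_nat_mul, ← Real.exp_add]
            congr 1
            push_cast
            ring
        _ < 1 := by
            rw [Real.exp_lt_one_iff]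
            apply mul_neg_of_neg_of_pos _ hne0
            linarith)
    (by
      rw [hTd, hwr]
      apply Nat.lt_of_succ_le
      apply Nat.le_floor
      push_cast at hbig ⊢
      linarith)
  refine ⟨S, ?_, hS2⟩
  calc (S.card : ℝ) ≤ ((⌊Real.exp (c * (n * ε ^ 2))⌋₊ : ℕ) : ℝ) := by exact_mod_cast hS1
    _ ≤ _ := Nat.floor_le (Real.exp_pos _).le

lemma net_entropy (hpos : ∀ p ∈ P, 0 < p.1) (hγ : 2 < γ)
    (hε : ∀ n : ℕ, ε n = maxRate P hP n * Real.log n ^ γ) {d : ℕ} {CL Cr : ℝ}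
    (hCL : 0 < CL) (hCr : 0 < Cr) {ν : ℝ} (hν : ν < 1) {F : ℝ} (hF : 0 < F)
    (PX : Measure (Fin d → ℝ)) [IsProbabilityMeasure PX] {c ξ : ℝ} (hc : 0 < c) (hξ : 0 < ξ) :
    ∀ᶠ n : ℕ in atTop, ∃ S : Finset (ParamIdx d (rwidthH Cr P hP n) (LdepthH CL n) → ℝ),
      (S.card : ℝ) ≤ Real.exp (c * (n * ε n ^ 2)) ∧ ∀ θ, ∃ θ' ∈ S,
      ∫ x, (trunc F (netOfParams ν d (rwidthH Cr P hP n) (LdepthH CL n) θ x) -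
        trunc F (netOfParams ν d (rwidthH Cr P hP n) (LdepthH CL n) θ' x)) ^ 2 ∂PX
        ≤ (ξ * ε n) ^ 2 := by
  obtain ⟨C, hC1, hC⟩ := arch_bounds (hP := hP) hpos d hCL hCr
  obtain ⟨k, hk⟩ := exists_nat_gt (2 * c / (3 * ξ ^ 2 / (16 * F ^ 2)))
  have hx0 : 0 < 3 * ξ ^ 2 / (16 * F ^ 2) := by positivity
  rw [div_lt_iff₀ hx0] at hk
  set CJ := 4 * F / ξ + 2 with hCJ
  set C3 := 1 + C * (k * (C + CJ) * C + 1) with hC3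
  have hnear : ∀ᶠ n : ℕ in atTop, 3 * ξ ^ 2 / (16 * F ^ 2) * ε n ^ 2 ≤ 1 := by
    have h := (((eps_tendsto hpos hε).pow 2).const_mul (3 * ξ ^ 2 / (16 * F ^ 2)))
    simp only [ne_eq, OfNat.ofNat_ne_zero, not_false_eq_true, zero_pow, mul_zero] at h
    exact h.eventually_le_const one_pos
  filter_upwards [eventually_ge_atTop 3, hnear,
    dominate (hP := hP) hpos hγ hε hc (1 + C * C * (Real.log C3 + (5 : ℕ)))] with n hn hne hdom
  obtain ⟨hL1, hr, hL, hT⟩ := hC n hn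
  exact net_entropy_core hn hL1 rfl rfl hr hL hT (W_ge_one (hP := hP) hpos (show 1 ≤ n by omega))
    (W_sq_le (hP := hP) hpos (show 1 ≤ n by omega))
    ((rate_ge (hP := hP) hpos (show 1 ≤ n by omega)).trans (eps_ge hpos hγ hε hn))
    hF hξ hC1 hk hCJ hC3 hne hdom hν PX

lemma trunc_lip {F x y : ℝ} (hy : |y| ≤ F) : |trunc F x - y| ≤ |x - y| := by
  obtain ⟨h1, h2⟩ := abs_le.1 hy
  have hF : 0 ≤ F := (abs_nonneg y).trans hy
  unfold trunc
  rcases le_total x (-F) with h | h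
  · rw [max_eq_right h, min_eq_left (by linarith), abs_of_nonpos (by linarith), abs_of_nonpos (by linarith)]
    linarith
  · rw [max_eq_left h]
    rcases le_total x F with h3 | h3
    · rw [min_eq_left h3]
    · rw [min_eq_right h3, abs_of_nonneg (by linarith), abs_of_nonneg (by linarith)]
      linarith

set_option maxHeartbeats 2000000 in
lemma prior_net_core {n d r L T : ℕ} (hn : 3 ≤ n) (hL1 : 1 ≤ L)
    (hTd : Fintype.card (ParamIdx d r L) = T) {C W ℓ ε ω c a CB c₂ C5 C6 δκ : ℝ} (hℓ : ℓ = Real.log n)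
    (hr : (r : ℝ) ≤ C * W) (hL : (L : ℝ) + 1 ≤ C * ℓ) (hT : (T : ℝ) ≤ C * (W ^ 2 * ℓ))
    (hW : 1 ≤ W) (hW2 : W ^ 2 ≤ n) (hC1 : 1 ≤ C) (ha : 1 ≤ a) (hCB : 0 < CB) (hδκ : 0 < δκ)
    (hratep : 0 < ω) (hrate1 : ω ≤ 1) (hrate : 1 / (n : ℝ) ≤ ω)
    (hC5 : C5 = (C + d + 1) * (CB + 2))
    (hC6 : C6 = |Real.log (a / (2 * δκ))| + C * (Real.log C5 + (1 : ℕ)) + 1)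
    (hdom : C * C6 * (W ^ 2 * ℓ ^ 3) ≤ c * (n * ε ^ 2))
    {ν : ℝ} (hν0 : 0 ≤ ν) (hν : ν < 1) {F : ℝ}
    {f₀ g : (Fin d → ℝ) → ℝ} (hf₀bd : ∀ x, |f₀ x| ≤ F)
    (hg : memDNN ν d L r CB g) (hgf : ∀ x ∈ cube a d, |g x - f₀ x| ≤ c₂ * ω)
    (Pr : Measure (ParamIdx d r L → ℝ)) (p : (ParamIdx d r L → ℝ) → ℝ)
    (hp : Pr = volume.withDensity fun θ => ENNReal.ofReal (p θ))
    (hlow : ∀ θ : ParamIdx d r L → ℝ, (∀ i, |θ i| ≤ CB + 1) →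
      δκ ^ Fintype.card (ParamIdx d r L) ≤ p θ) :
    ∃ B : Set (ParamIdx d r L → ℝ),
      ENNReal.ofReal (Real.exp (-(c * (n * ε ^ 2)))) ≤ Pr B ∧ ∀ θ ∈ B, ∀ x ∈ cube a d,
        |trunc F (netOfParams ν d r L θ x) - f₀ x| ≤ (1 + c₂) * ω := by
  have hC51 : 1 ≤ C5 := by
    have : (1 : ℝ) ≤ C + d + 1 := by have : (0 : ℝ) ≤ d := Nat.cast_nonneg d
                                     linarith
    rw [hC5]
    nlinarith
  have hC50 : 0 ≤ Real.log C5 := Real.log_nonneg hC51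
  have hC60 : 0 ≤ C6 := by rw [hC6]; positivity
  have hl : 1 ≤ ℓ := hℓ ▸ log_ge_one hn
  have hn3 : (3 : ℝ) ≤ n := by exact_mod_cast hn
  have hn0 : (0 : ℝ) < n := by linarith
  obtain ⟨-, θ₀, hθ₀, hgθ⟩ := memDNN_params hg
  have hWn : W ≤ n := by nlinarith
  set Q := ((r : ℝ) + d + 1) * (CB + 2) with hQ
  have hr0 : (0 : ℝ) ≤ r := Nat.cast_nonneg r
  have hd0 : (0 : ℝ) ≤ d := Nat.cast_nonneg d
  have hQ1 : 1 ≤ Q := by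
    have : (1 : ℝ) ≤ r + d + 1 := by linarith
    nlinarith
  have hQb : Q ≤ C5 * (n : ℝ) ^ 1 := by
    rw [hQ, hC5, pow_one]
    have h1 : (r : ℝ) + d + 1 ≤ (C + d + 1) * n := by nlinarith
    nlinarith
  have hlogQ := polylog hn hC51 (by linarith) 1 hQb
  rw [← hℓ] at hlogQ
  have hQL : 1 ≤ Q ^ (L + 1) := one_le_pow₀ hQ1
  have haQ : 1 ≤ Q ^ (L + 1) * a := one_le_mul_of_one_le_of_one_le hQL ha
  set δ := ω / (Q ^ (L + 1) * a) with hδ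
  have hδ0 : 0 < δ := by positivity
  have hδ1 : δ ≤ 1 := (div_le_one (by linarith)).2 (by linarith)
  refine ⟨{θ | ∀ i, |θ i - θ₀ i| ≤ δ}, ?_, ?_⟩
  · refine le_trans ?_ (prior_box Pr p hp hδκ hδ0 hlow θ₀
      (fun i => by linarith [hθ₀ i]))
    apply ENNReal.ofReal_le_ofReal
    have hpp : 0 < δκ * (2 * δ) := by positivity
    have e1 : (δκ * (2 * δ)) ^ T = Real.exp (T * Real.log (δκ * (2 * δ))) := by
      rw [Real.exp_nat_mul, Real.exp_log hpp]
    rw [hTd, e1, Real.exp_le_exp]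
    have e2 : -Real.log (δκ * (2 * δ)) =
        Real.log (a / (2 * δκ)) + ((L : ℝ) + 1) * Real.log Q - Real.log ω := by
      rw [← Real.log_inv]
      have : (δκ * (2 * δ))⁻¹ = a / (2 * δκ) * Q ^ (L + 1) / ω := by
        rw [hδ]; field_simp
      rw [this, Real.log_div (by positivity) (by positivity), Real.log_mul (by positivity) (by positivity),
        Real.log_pow]
      push_cast
      ring
    have e3 : -Real.log ω ≤ ℓ := by
      rw [hℓ, ← Real.log_inv]
      apply Real.log_le_log (by positivity)
      rw [inv_le_comm₀ hratep hn0]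
      simpa using hrate
    have e4 : -Real.log (δκ * (2 * δ)) ≤ C6 * ℓ ^ 2 := by
      rw [e2]
      have h1 : ((L : ℝ) + 1) * Real.log Q ≤ (C * ℓ) * ((Real.log C5 + (1 : ℕ)) * ℓ) := by
        have := Real.log_nonneg hQ1
        gcongr
      have h2 := le_abs_self (Real.log (a / (2 * δκ)))
      have h3 : ℓ ≤ ℓ ^ 2 := by nlinarith
      have h4 : (1 : ℝ) ≤ ℓ ^ 2 := by nlinarith
      have h5 := mul_le_mul_of_nonneg_left h4 (abs_nonneg (Real.log (a / (2 * δκ))))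
      calc _ ≤ |Real.log (a / (2 * δκ))| * ℓ ^ 2 + (C * ℓ) * ((Real.log C5 + (1 : ℕ)) * ℓ) + ℓ ^ 2 := by
            rw [mul_one] at h5
            rw [sub_eq_add_neg]
            exact add_le_add (add_le_add (h2.trans h5) h1) (e3.trans h3)
        _ = C6 * ℓ ^ 2 := by rw [hC6]; ring
    have e5 : -(T * Real.log (δκ * (2 * δ))) ≤ c * (n * ε ^ 2) := by
      refine le_trans ?_ hdom
      calc -(T * Real.log (δκ * (2 * δ))) = T * (-Real.log (δκ * (2 * δ))) := by ring
        _ ≤ T * (C6 * ℓ ^ 2) := by gcongr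
        _ ≤ (C * (W ^ 2 * ℓ)) * (C6 * ℓ ^ 2) := by gcongr
        _ = _ := by ring
    linarith
  · intro θ hθ x hx
    have hθ' : ∀ i, |θ i - θ₀ i| ≤ δ := hθ
    refine (trunc_lip (hf₀bd x)).trans ?_
    have h1 := net_lip hν0 hν hL1 ha (B := CB + 1) (Q := Q) (by linarith) hδ0.le
      (by rw [hQ]; nlinarith) (by rw [hQ]; nlinarith) θ θ₀
      (fun i => by
        have := abs_sub_abs_le_abs_sub (θ i) (θ₀ i)
        linarith [hθ' i, hθ₀ i])
      (fun i => by linarith [hθ₀ i]) hθ' x hx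
    have h2 : δ * (Q ^ (L + 1) * a) = ω := by rw [hδ]; field_simp
    rw [h2, ← hgθ] at h1
    have h3 := hgf x hx
    have h4 := abs_sub_le (netOfParams ν d r L θ x) (g x) (f₀ x)
    linarith

lemma prior_net (hpos : ∀ p ∈ P, 0 < p.1) (hγ : 2 < γ)
    (hε : ∀ n : ℕ, ε n = maxRate P hP n * Real.log n ^ γ) {d : ℕ} {CL Cr CB c₂ a : ℝ} (ha : 1 ≤ a)
    (hCL : 0 < CL) (hCr : 0 < Cr) (hCB : 0 < CB) {ν : ℝ} (hν0 : 0 ≤ ν) (hν : ν < 1) {F : ℝ}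
    {f₀ : (Fin d → ℝ) → ℝ} (hf₀bd : ∀ x, |f₀ x| ≤ F)
    (happ : ∃ n₀ : ℕ, ∀ n : ℕ, n₀ ≤ n →
        ∃ g : (Fin d → ℝ) → ℝ,
          memDNN ν d (LdepthH CL n) (rwidthH Cr P hP n) CB g ∧
          ∀ x ∈ cube a d, |g x - f₀ x| ≤ c₂ * maxRate P hP n)
    (Prθ : ∀ n : ℕ, Measure (ParamIdx d (rwidthH Cr P hP n) (LdepthH CL n) → ℝ))
    (πθ : ∀ n : ℕ, (ParamIdx d (rwidthH Cr P hP n) (LdepthH CL n) → ℝ) → ℝ)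
    (hπθdens : ∀ n, Prθ n = volume.withDensity fun θ => ENNReal.ofReal (πθ n θ))
    (hπθlow : ∀ κ : ℝ, 0 < κ → ∃ δκ : ℝ, 0 < δκ ∧
      ∀ n : ℕ, ∀ θ : ParamIdx d (rwidthH Cr P hP n) (LdepthH CL n) → ℝ,
        (∀ i, |θ i| ≤ κ) →
          δκ ^ Fintype.card (ParamIdx d (rwidthH Cr P hP n) (LdepthH CL n)) ≤ πθ n θ)
    {c : ℝ} (hc : 0 < c) :
    ∀ᶠ n : ℕ in atTop, ∃ B : Set (ParamIdx d (rwidthH Cr P hP n) (LdepthH CL n) → ℝ),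
      ENNReal.ofReal (Real.exp (-(c * (n * ε n ^ 2)))) ≤ Prθ n B ∧ ∀ θ ∈ B, ∀ x ∈ cube a d,
        |trunc F (netOfParams ν d (rwidthH Cr P hP n) (LdepthH CL n) θ x) - f₀ x| ≤
          (1 + c₂) * maxRate P hP n := by
  obtain ⟨C, hC1, hC⟩ := arch_bounds (hP := hP) hpos d hCL hCr
  obtain ⟨n₀, hn₀⟩ := happ
  obtain ⟨δκ, hδκ, hlow⟩ := hπθlow (CB + 1) (by linarith)
  set C5 := (C + d + 1) * (CB + 2) with hC5
  set C6 := |Real.log (a / (2 * δκ))| + C * (Real.log C5 + (1 : ℕ)) + 1 with hC6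
  filter_upwards [eventually_ge_atTop 3, eventually_ge_atTop n₀,
    dominate (hP := hP) hpos hγ hε hc (C * C6)] with n hn hnn hdom
  obtain ⟨hL1, hr, hL, hT⟩ := hC n hn
  obtain ⟨g, hg, hgf⟩ := hn₀ n hnn
  exact prior_net_core hn hL1 rfl rfl hr hL hT (W_ge_one (hP := hP) hpos (show 1 ≤ n by omega))
    (W_sq_le (hP := hP) hpos (show 1 ≤ n by omega)) hC1 ha hCB hδκ
    (rate_pos (hP := hP) hpos (show 1 ≤ n by omega))
    (rate_le_one (hP := hP) hpos (show 1 ≤ n by omega))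
    (rate_ge (hP := hP) hpos (show 1 ≤ n by omega)) hC5 hC6 hdom hν0 hν hf₀bd hg hgf
    (Prθ n) (πθ n) (hπθdens n) (hlow n)

lemma prior_sigma (hpos : ∀ p ∈ P, 0 < p.1) (hγ : 2 < γ)
    (hε : ∀ n : ℕ, ε n = maxRate P hP n * Real.log n ^ γ) (Pr : Measure ℝ) (p : ℝ → ℝ) {v : ℝ}
    (hv : 0 < v) (hp : Pr = volume.withDensity fun s => ENNReal.ofReal (p s))
    (hcont : ContinuousOn p (Set.Ioo 0 (2 * v))) (hppos : ∀ s ∈ Set.Ioo 0 (2 * v), 0 < p s)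
    {c : ℝ} (hc : 0 < c) :
    ∀ᶠ n : ℕ in atTop, ENNReal.ofReal (Real.exp (-(c * (n * ε n ^ 2)))) ≤
      Pr (Set.Icc v (v + maxRate P hP n)) := by
  obtain ⟨c', η, hc', hη, hb⟩ := sigma_box Pr p v hv hp hcont hppos
  filter_upwards [eventually_ge_atTop 3, (eps_tendsto hpos hε).eventually_le_const hη,
    dominate (hP := hP) hpos hγ hε hc (|Real.log c'| + 1)] with n hn hle hdom
  have hl := log_ge_one hn
  have hW := W_ge_one (hP := hP) hpos (show 1 ≤ n by omega)
  have hn3 : (3 : ℝ) ≤ n := by exact_mod_cast hn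
  have hn0 : (0 : ℝ) < n := by linarith
  have hrate := rate_ge (hP := hP) hpos (show 1 ≤ n by omega)
  have hratep := rate_pos (hP := hP) hpos (show 1 ≤ n by omega)
  have h1 := eps_ge hpos hγ hε hn
  refine le_trans ?_ (hb _ hratep (h1.trans hle))
  apply ENNReal.ofReal_le_ofReal
  rw [← Real.le_log_iff_exp_le (by positivity), Real.log_mul hc'.ne' hratep.ne']
  have e3 : -Real.log (maxRate P hP n) ≤ Real.log n := by
    rw [← Real.log_inv]
    apply Real.log_le_log (by positivity)
    rw [inv_le_comm₀ hratep hn0]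
    simpa using hrate
  have h2 := neg_abs_le (Real.log c')
  have h4 : Real.log n ≤ Real.log n ^ 3 := by
    calc _ = Real.log n ^ 1 := (pow_one _).symm
      _ ≤ _ := pow_le_pow_right₀ hl (by norm_num)
  have h5 : Real.log n ^ 3 ≤ maxWidthExp P hP n ^ 2 * Real.log n ^ 3 :=
    le_mul_of_one_le_left (by positivity) (one_le_pow₀ hW)
  have h6 := mul_le_mul_of_nonneg_left (hl.trans (h4.trans h5)) (abs_nonneg (Real.log c'))
  linarith

end Rates2


section Assembly

lemma final_arith {n : ℕ} {c N δ : ℝ} (hδ : 0 < δ) (hc : 0 < c) (hN : 0 ≤ N) {m : ℕ}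
    (hm : (m : ℝ) ≤ 3 * Real.exp (c / 4 * N)) {k χ b : ℝ≥0∞}
    (hk : k ^ n ≤ ENNReal.ofReal (Real.exp (-(c * N))))
    (hχ : χ ^ n ≤ ENNReal.ofReal (Real.exp (c / 16 * N)))
    (hb : b = ENNReal.ofReal (Real.exp (-(c / 8 * N)))) {y : ℝ≥0∞}
    (hy : y = ENNReal.ofReal (Real.exp (-(c / 2 * N)))) :
    4 * y * χ ^ n / b + (m * k ^ n + m * k ^ n / (ENNReal.ofReal δ * y)) ≤
      ENNReal.ofReal ((7 + 3 / δ) * Real.exp (-(c / 4 * N))) := by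
  have hcN : 0 ≤ c * N := by positivity
  have hme : (m : ℝ≥0∞) ≤ ENNReal.ofReal (3 * Real.exp (c / 4 * N)) := by
    rw [← ENNReal.ofReal_natCast]
    exact ENNReal.ofReal_le_ofReal hm
  have t1 : 4 * y * χ ^ n / b ≤ ENNReal.ofReal (4 * Real.exp (-(c / 4 * N))) := by
    calc 4 * y * χ ^ n / b ≤ ENNReal.ofReal 4 * ENNReal.ofReal (Real.exp (-(c / 2 * N))) *
          ENNReal.ofReal (Real.exp (c / 16 * N)) / ENNReal.ofReal (Real.exp (-(c / 8 * N))) := by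
          rw [hb, hy]
          have : (4 : ℝ≥0∞) = ENNReal.ofReal 4 := by norm_num
          rw [← this]
          gcongr
      _ = ENNReal.ofReal (4 * Real.exp (-(c / 2 * N)) * Real.exp (c / 16 * N) /
          Real.exp (-(c / 8 * N))) := by
          rw [ENNReal.ofReal_div_of_pos (Real.exp_pos _), ENNReal.ofReal_mul (by positivity),
            ENNReal.ofReal_mul (by positivity)]
      _ ≤ _ := by
          apply ENNReal.ofReal_le_ofReal
          rw [mul_assoc, ← Real.exp_add, mul_div_assoc, ← Real.exp_sub]
          gcongr
          linarith
  have t2 : (m : ℝ≥0∞) * k ^ n ≤ ENNReal.ofReal (3 * Real.exp (-(c * (3 / 4) * N))) := by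
    calc (m : ℝ≥0∞) * k ^ n ≤ ENNReal.ofReal (3 * Real.exp (c / 4 * N)) *
          ENNReal.ofReal (Real.exp (-(c * N))) := by gcongr
      _ = ENNReal.ofReal (3 * Real.exp (-(c * (3 / 4) * N))) := by
          rw [← ENNReal.ofReal_mul (by positivity), mul_assoc, ← Real.exp_add]
          congr 3
          ring
  have t3 : (m : ℝ≥0∞) * k ^ n / (ENNReal.ofReal δ * y) ≤
      ENNReal.ofReal (3 / δ * Real.exp (-(c / 4 * N))) := by
    calc _ ≤ ENNReal.ofReal (3 * Real.exp (-(c * (3 / 4) * N))) / (ENNReal.ofReal δ * y) := by gcongr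
      _ = ENNReal.ofReal (3 * Real.exp (-(c * (3 / 4) * N)) / (δ * Real.exp (-(c / 2 * N)))) := by
          rw [hy, ← ENNReal.ofReal_mul hδ.le, ENNReal.ofReal_div_of_pos (by positivity)]
      _ ≤ _ := by
          apply ENNReal.ofReal_le_ofReal
          rw [mul_div_mul_comm, ← Real.exp_sub]
          gcongr
          linarith
  have t2' : (m : ℝ≥0∞) * k ^ n ≤ ENNReal.ofReal (3 * Real.exp (-(c / 4 * N))) := by
    refine t2.trans (ENNReal.ofReal_le_ofReal ?_)
    gcongr
    linarith
  calc _ ≤ ENNReal.ofReal (4 * Real.exp (-(c / 4 * N))) +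
        (ENNReal.ofReal (3 * Real.exp (-(c / 4 * N))) +
          ENNReal.ofReal (3 / δ * Real.exp (-(c / 4 * N)))) := add_le_add t1 (add_le_add t2' t3)
    _ = _ := by
        rw [← ENNReal.ofReal_add (by positivity) (by positivity),
          ← ENNReal.ofReal_add (by positivity) (by positivity)]
        congr 1
        ring

lemma triv_test {Z : Type*} [MeasurableSpace Z] (μ : Measure Z) [IsProbabilityMeasure μ] (x : ℝ) :
    ∃ w : Z → ℝ≥0∞, Measurable w ∧ (∀ z, w z ≠ 0 ∧ w z ≠ ⊤) ∧
      ∫⁻ z, (w z)⁻¹ ∂μ ≤ ENNReal.ofReal (Real.exp (-x)) := by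
  refine ⟨fun _ => ENNReal.ofReal (Real.exp x), measurable_const, fun z =>
    ⟨by simp [Real.exp_pos], ENNReal.ofReal_ne_top⟩, ?_⟩
  rw [lintegral_const, measure_univ, mul_one, ← ENNReal.ofReal_inv_of_pos (Real.exp_pos x),
    Real.exp_neg]

lemma exp_pow_le {n : ℕ} {x y : ℝ} (h : n * x ≤ y) :
    ENNReal.ofReal (Real.exp x) ^ n ≤ ENNReal.ofReal (Real.exp y) := by
  rw [← ENNReal.ofReal_pow (Real.exp_pos _).le, ← Real.exp_nat_mul]
  exact ENNReal.ofReal_le_ofReal (Real.exp_le_exp.2 h)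

lemma l2dist_gt {d : ℕ} {PX : Measure (Fin d → ℝ)} {g h : (Fin d → ℝ) → ℝ} {e : ℝ} (he : 0 ≤ e)
    (hl : e < l2dist d PX g h) : e ^ 2 < ∫ x, (g x - h x) ^ 2 ∂PX := by
  unfold l2dist at hl
  exact (Real.lt_sqrt he).1 hl

lemma meas_tnet (ν F : ℝ) (d r L : ℕ) (θ : ParamIdx d r L → ℝ) :
    Measurable fun x => trunc F (netOfParams ν d r L θ x) :=
  ((continuous_trunc F).comp ((continuous_net ν d r L).comp
    (Continuous.prodMk continuous_const continuous_id))).measurable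

lemma meas_tnet2 (ν F : ℝ) (d r L : ℕ) :
    Measurable fun p : (ParamIdx d r L → ℝ) × (Fin d → ℝ) => trunc F (netOfParams ν d r L p.1 p.2) :=
  ((continuous_trunc F).comp (continuous_net ν d r L)).measurable

lemma sig_sq_le {d : ℕ} (PX : Measure (Fin d → ℝ)) [IsProbabilityMeasure PX]
    {f g : (Fin d → ℝ) → ℝ} (hf : Measurable f) (hg : Measurable g) {F : ℝ}
    (hfb : ∀ x, |f x| ≤ F) (hgb : ∀ x, |g x| ≤ F) :
    ∫ x, (sigmoid (f x) - sigmoid (g x)) ^ 2 ∂PX ≤ ∫ x, (f x - g x) ^ 2 ∂PX := by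
  apply integral_mono_of_nonneg
  · exact ae_of_all _ fun x => sq_nonneg _
  · refine Integrable.of_bound ((hf.sub hg).pow_const 2).aestronglyMeasurable ((F + F) ^ 2)
      (ae_of_all _ fun x => ?_)
    rw [Real.norm_eq_abs, abs_pow]
    gcongr
    exact (abs_sub _ _).trans (add_le_add (hfb x) (hgb x))
  · exact ae_of_all _ fun x => sq_le_sq.2 (sigmoid_lip _ _)

set_option maxHeartbeats 1000000 in
lemma logistic_core {n d r L : ℕ} {ν F ε τ δ : ℝ} (hF : 0 < F) (hε : 0 < ε) (hδ : 0 < δ)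
    (PX : Measure (Fin d → ℝ)) [IsProbabilityMeasure PX] {f₀ : (Fin d → ℝ) → ℝ}
    (hf₀ : Measurable f₀) (μ : Measure ((Fin d → ℝ) × ℝ)) [IsProbabilityMeasure μ]
    (hμ : μ = logisticLaw d PX f₀)
    (Pr : Measure (ParamIdx d r L → ℝ)) [IsProbabilityMeasure Pr]
    (S : Finset (ParamIdx d r L → ℝ))
    (hS : (S.card : ℝ) ≤ Real.exp ((1 / 100) / 4 * (n * ε ^ 2)))
    (hcov : ∀ θ, ∃ θ' ∈ S, ∫ x, (trunc F (netOfParams ν d r L θ x) -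
      trunc F (netOfParams ν d r L θ' x)) ^ 2 ∂PX ≤ (1 / 8 * ε) ^ 2)
    (B : Set (ParamIdx d r L → ℝ))
    (hB : ENNReal.ofReal (Real.exp (-((1 / 100) / 8 * (n * ε ^ 2)))) ≤ Pr B)
    (hBτ : ∀ θ ∈ B, ∀ᵐ x ∂PX, |trunc F (netOfParams ν d r L θ x) - f₀ x| ≤ τ)
    (hτ : n * (τ ^ 2 / sigmoid (-F) ^ 2) ≤ (1 / 100) / 16 * (n * ε ^ 2))
    (A : Set (ParamIdx d r L → ℝ))
    (hA : ∀ θ ∈ A, ε < l2dist d PX (fun x => sigmoid (trunc F (netOfParams ν d r L θ x)))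
      (fun x => sigmoid (f₀ x))) :
    Measure.pi (fun _ : Fin n => μ)
      {D | ENNReal.ofReal δ < postMass Pr (bernLik ν F d r L D) A} ≤
      ENNReal.ofReal ((7 + 3 / δ) * Real.exp (-((1 / 100) / 4 * (n * ε ^ 2)))) := by
  have hsm : ∀ θ : ParamIdx d r L → ℝ,
      Measurable fun x => sigmoid (trunc F (netOfParams ν d r L θ x)) := fun θ =>
    cont_sigm.measurable.comp (meas_tnet ν F d r L θ)
  have hs0 : Measurable fun x => sigmoid (f₀ x) := cont_sigm.measurable.comp hf₀
  have hsb : ∀ z, |sigmoid z| ≤ 1 := fun z => by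
    rw [abs_of_pos (sigmoid_mem z).1]; exact (sigmoid_mem z).2.le
  let ℓ : (ParamIdx d r L → ℝ) → (Fin d → ℝ) × ℝ → ℝ≥0∞ := fun θ z =>
    ENNReal.ofReal (bl (sigmoid (trunc F (netOfParams ν d r L θ z.1))) z.2)
  let ℓ0 : (Fin d → ℝ) × ℝ → ℝ≥0∞ := fun z => ENNReal.ofReal (bl (sigmoid (f₀ z.1)) z.2)
  have hℓ : Measurable (Function.uncurry ℓ) := by
    have h1 : Measurable fun p : (ParamIdx d r L → ℝ) × ((Fin d → ℝ) × ℝ) =>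
        (sigmoid (trunc F (netOfParams ν d r L p.1 p.2.1)), p.2.2) :=
      (cont_sigm.measurable.comp ((meas_tnet2 ν F d r L).comp
        (measurable_fst.prodMk (measurable_fst.comp measurable_snd)))).prodMk
        (measurable_snd.comp measurable_snd)
    exact (measurable_bl.comp h1).ennreal_ofReal
  have hℓ0 : Measurable ℓ0 :=
    (measurable_bl.comp ((hs0.comp measurable_fst).prodMk measurable_snd)).ennreal_ofReal
  have h00 : ∀ z, ℓ0 z ≠ 0 := fun z => by
    have := bl_pos (y := z.2) (sigmoid_mem (f₀ z.1))
    simp [ℓ0, this]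
  have h0t : ∀ z, ℓ0 z ≠ ⊤ := fun z => ENNReal.ofReal_ne_top
  have hpm : ∀ D : Fin n → (Fin d → ℝ) × ℝ, postMass Pr (bernLik ν F d r L D) A =
      (∫⁻ p in A, ∏ i, (ℓ p (D i) / ℓ0 (D i)) ∂Pr) / ∫⁻ p, ∏ i, (ℓ p (D i) / ℓ0 (D i)) ∂Pr := by
    intro D
    refine postMass_eq_ratio Pr D ℓ hℓ ℓ0 (fun i => h00 _) (fun i => h0t _) _ (fun θ => ?_) A
    unfold bernLik
    rw [ENNReal.ofReal_prod_of_nonneg]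
    · rfl
    · intro i _
      exact (bl_pos (sigmoid_mem _)).le
  simp only [hpm]
  have hN : 0 ≤ n * ε ^ 2 := by positivity
  refine le_trans (post_bound μ Pr n (fun p z => ℓ p z / ℓ0 z) ?_ ?_ (κ := S) A
    (fun j => {θ | θ ∈ A ∧ ∫ x, (trunc F (netOfParams ν d r L θ x) -
      trunc F (netOfParams ν d r L j x)) ^ 2 ∂PX ≤ (1 / 8 * ε) ^ 2}) ?_
    (ENNReal.ofReal (Real.exp (-(1 / 100 * ε ^ 2)))) ?_ B
    (ENNReal.ofReal (Real.exp (τ ^ 2 / sigmoid (-F) ^ 2))) ?_ _ ?_ hB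
    (ENNReal.ofReal (Real.exp (-((1 / 100) / 2 * (n * ε ^ 2))))) ?_ ENNReal.ofReal_ne_top
    (ENNReal.ofReal δ) ?_ ENNReal.ofReal_ne_top) (final_arith (n := n) hδ (by norm_num) hN
      ?_ ?_ ?_ rfl rfl)
  · exact hℓ.div (hℓ0.comp measurable_snd)
  · exact fun p z => ENNReal.div_ne_top ENNReal.ofReal_ne_top (h00 z)
  · intro θ hθ
    obtain ⟨θ', h1, h2⟩ := hcov θ
    exact Set.mem_iUnion.2 ⟨⟨θ', h1⟩, hθ, h2⟩
  · rintro ⟨j, hj⟩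
    by_cases hne : ∃ θ₁, θ₁ ∈ A ∧ ∫ x, (trunc F (netOfParams ν d r L θ₁ x) -
      trunc F (netOfParams ν d r L j x)) ^ 2 ∂PX ≤ (1 / 8 * ε) ^ 2
    · obtain ⟨w, hw1, hw2, hw3, hw4⟩ := logis_test PX f₀ hf₀
        (fun x => sigmoid (trunc F (netOfParams ν d r L j x))) (hsm j) (fun x => sigmoid_mem _)
      have hV : ∀ θ, ∫ x, (trunc F (netOfParams ν d r L θ x) -
          trunc F (netOfParams ν d r L j x)) ^ 2 ∂PX ≤ (1 / 8 * ε) ^ 2 →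
          ∫ x, (sigmoid (trunc F (netOfParams ν d r L θ x)) -
          sigmoid (trunc F (netOfParams ν d r L j x))) ^ 2 ∂PX ≤ (1 / 8 * ε) ^ 2 := fun θ h =>
        (sig_sq_le PX (meas_tnet ν F d r L θ) (meas_tnet ν F d r L j) (F := F)
          (fun x => trunc_abs_le hF.le) (fun x => trunc_abs_le hF.le)).trans h
      have hU : 31 / 64 * ε ^ 2 ≤ ∫ x, (sigmoid (f₀ x) -
          sigmoid (trunc F (netOfParams ν d r L j x))) ^ 2 ∂PX := by
        obtain ⟨θ₁, h1, h2⟩ := hne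
        have h3 := l2dist_gt hε.le (hA θ₁ h1)
        have h4 := integral_sq_tri PX (fun x => sigmoid (trunc F (netOfParams ν d r L θ₁ x)))
          (fun x => sigmoid (trunc F (netOfParams ν d r L j x))) (fun x => sigmoid (f₀ x))
          (hsm θ₁) (hsm j) hs0 1 (fun x => hsb _) (fun x => hsb _) (fun x => hsb _)
        have h5 := hV θ₁ h2
        nlinarith
      subst hμ
      refine ⟨w, hw1, hw2, ?_, ?_⟩
      · rintro θ ⟨h1, h2⟩
        refine (hw4 _ (hsm θ) (fun x => sigmoid_mem _)).trans
          (ENNReal.ofReal_le_ofReal (Real.exp_le_exp.2 ?_))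
        have h5 := hV θ h2
        nlinarith [sq_nonneg ε]
      · refine hw3.trans (ENNReal.ofReal_le_ofReal (Real.exp_le_exp.2 ?_))
        nlinarith [sq_nonneg ε]
    · obtain ⟨w, hw1, hw2, hw3⟩ := triv_test μ (1 / 100 * ε ^ 2)
      exact ⟨w, hw1, hw2, fun θ hθ => absurd ⟨θ, hθ⟩ hne, hw3⟩
  · intro θ hθ
    subst hμ
    refine logis_chi PX f₀ hf₀ _ (hsm θ) (fun x => sigmoid_mem _) (c₀ := sigmoid (-F) ^ 2)
      (pow_pos (sigmoid_mem _).1 2) (fun x => sigmoid_lower (trunc_abs_le hF.le)) ?_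
    filter_upwards [hBτ θ hθ] with x hx
    exact (sigmoid_lip _ _).trans hx
  · simp [Real.exp_pos]
  · simp [Real.exp_pos]
  · simp [hδ]
  · rw [Fintype.card_coe]
    have := Real.exp_pos ((1 / 100) / 4 * (n * ε ^ 2))
    linarith
  · exact exp_pow_le (le_of_eq (by ring))
  · exact exp_pow_le hτ

set_option maxHeartbeats 1000000 in
lemma gauss_core {n d r L : ℕ} {ν F ε τ h δ v t c : ℝ} (hF : 0 < F) (hε : 0 < ε) (hδ : 0 < δ)
    (hv : 0 < v) (ht0 : 0 < t) (ht : t * (v + 16 * F ^ 2) ≤ 1 / 8) (htv : 2 * t * v ≤ 1)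
    (hc : 0 < c) (hc1 : c ≤ 1 / (256 * v ^ 2)) (hc2 : c ≤ t / 64)
    (he1 : ε / (2 * v) ≤ 1) (heF : ε / (2 * v) * F ^ 2 ≤ v) (heξ : ε ≤ 1)
    (PX : Measure (Fin d → ℝ)) [IsProbabilityMeasure PX] {f₀ : (Fin d → ℝ) → ℝ}
    (hf₀ : Measurable f₀) (hf₀F : ∀ x, |f₀ x| ≤ F)
    (μ : Measure ((Fin d → ℝ) × ℝ)) [IsProbabilityMeasure μ]
    (hμ : μ = gaussRegLaw d PX f₀ (Real.toNNReal v))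
    (Pr : Measure (ParamIdx d r L → ℝ)) [IsProbabilityMeasure Pr]
    (Prσ : Measure ℝ) [IsProbabilityMeasure Prσ]
    (S : Finset (ParamIdx d r L → ℝ))
    (hS : (S.card : ℝ) ≤ Real.exp (c / 4 * (n * ε ^ 2)))
    (hcov : ∀ θ, ∃ θ' ∈ S, ∫ x, (trunc F (netOfParams ν d r L θ x) -
      trunc F (netOfParams ν d r L θ' x)) ^ 2 ∂PX ≤ (1 / 16 * ε) ^ 2)
    (B : Set (ParamIdx d r L → ℝ))
    (hB : ENNReal.ofReal (Real.exp (-(c / 16 * (n * ε ^ 2)))) ≤ Pr B)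
    (hBσ : ENNReal.ofReal (Real.exp (-(c / 16 * (n * ε ^ 2)))) ≤ Prσ (Set.Icc v (v + h)))
    (hBτ : ∀ θ ∈ B, ∀ᵐ x ∂PX, |trunc F (netOfParams ν d r L θ x) - f₀ x| ≤ τ)
    (hτ : n * (h ^ 2 / v ^ 2 + τ ^ 2 / v) ≤ c / 16 * (n * ε ^ 2))
    (A : Set ((ParamIdx d r L → ℝ) × ℝ))
    (hA : ∀ p ∈ A, ε < l2dist d PX (fun x => trunc F (netOfParams ν d r L p.1 x)) f₀ + |p.2 - v|) :
    Measure.pi (fun _ : Fin n => μ)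
      {D | ENNReal.ofReal δ < postMass (Pr.prod Prσ) (gaussLik ν F d r L D) A} ≤
      ENNReal.ofReal ((7 + 3 / δ) * Real.exp (-(c / 4 * (n * ε ^ 2)))) := by
  have hsm := meas_tnet ν F d r L
  have hsb : ∀ θ : ParamIdx d r L → ℝ, ∀ x, |trunc F (netOfParams ν d r L θ x)| ≤ F :=
    fun θ x => trunc_abs_le hF.le
  let ℓ : (ParamIdx d r L → ℝ) × ℝ → (Fin d → ℝ) × ℝ → ℝ≥0∞ := fun p z =>
    ENNReal.ofReal (gpdf (trunc F (netOfParams ν d r L p.1 z.1)) p.2 z.2)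
  let ℓ0 : (Fin d → ℝ) × ℝ → ℝ≥0∞ := fun z => ENNReal.ofReal (gpdf (f₀ z.1) v z.2)
  have hℓ : Measurable (Function.uncurry ℓ) := by
    have h1 : Measurable fun p : ((ParamIdx d r L → ℝ) × ℝ) × ((Fin d → ℝ) × ℝ) =>
        (trunc F (netOfParams ν d r L p.1.1 p.2.1), p.1.2, p.2.2) :=
      ((meas_tnet2 ν F d r L).comp
        ((measurable_fst.comp measurable_fst).prodMk (measurable_fst.comp measurable_snd))).prodMk
        ((measurable_snd.comp measurable_fst).prodMk (measurable_snd.comp measurable_snd))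
    exact (measurable_gpdf.comp h1).ennreal_ofReal
  have hℓ0 : Measurable ℓ0 := measurable_gp hf₀ v
  have h00 : ∀ z, ℓ0 z ≠ 0 := fun z => by
    have := gpdf_pos (m := f₀ z.1) (y := z.2) hv
    simp [ℓ0, this]
  have h0t : ∀ z, ℓ0 z ≠ ⊤ := fun z => ENNReal.ofReal_ne_top
  have hpm : ∀ D : Fin n → (Fin d → ℝ) × ℝ, postMass (Pr.prod Prσ) (gaussLik ν F d r L D) A =
      (∫⁻ p in A, ∏ i, (ℓ p (D i) / ℓ0 (D i)) ∂(Pr.prod Prσ)) /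
        ∫⁻ p, ∏ i, (ℓ p (D i) / ℓ0 (D i)) ∂(Pr.prod Prσ) := by
    intro D
    refine postMass_eq_ratio (Pr.prod Prσ) D ℓ hℓ ℓ0 (fun i => h00 _) (fun i => h0t _) _
      (fun θ => ?_) A
    unfold gaussLik
    rw [ENNReal.ofReal_prod_of_nonneg]
    intro i _
    exact gpdf_nonneg _ _ _
  simp only [hpm]
  have hN : 0 ≤ n * ε ^ 2 := by positivity
  have he0 : 0 < ε / (2 * v) := by positivity
  have hve : v * (ε / (2 * v)) = ε / 2 := by field_simp
  have hce : c * ε ^ 2 ≤ (ε / (2 * v)) ^ 2 / 64 := by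
    have : (ε / (2 * v)) ^ 2 / 64 = 1 / (256 * v ^ 2) * ε ^ 2 := by field_simp; ring
    rw [this]
    gcongr
  let Vj : (ParamIdx d r L → ℝ) → (ParamIdx d r L → ℝ) → Prop := fun j θ =>
    ∫ x, (trunc F (netOfParams ν d r L θ x) -
      trunc F (netOfParams ν d r L j x)) ^ 2 ∂PX ≤ (1 / 16 * ε) ^ 2
  let Aj : Unit ⊕ S ⊕ S → Set ((ParamIdx d r L → ℝ) × ℝ) := fun j => match j with
    | Sum.inl _ => {p | v + ε / 2 ≤ p.2}
    | Sum.inr (Sum.inl j) => {p | p.2 ≤ v - ε / 2 ∧ Vj j p.1}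
    | Sum.inr (Sum.inr j) => {p | 0 < p.2 ∧ p.2 ≤ 2 * v ∧
        ε / 2 < l2dist d PX (fun x => trunc F (netOfParams ν d r L p.1 x)) f₀ ∧ Vj j p.1}
  refine le_trans (post_bound μ (Pr.prod Prσ) n (fun p z => ℓ p z / ℓ0 z) ?_ ?_ A Aj ?_
    (ENNReal.ofReal (Real.exp (-(c * ε ^ 2)))) ?_ (B ×ˢ Set.Icc v (v + h))
    (ENNReal.ofReal (Real.exp (h ^ 2 / v ^ 2 + τ ^ 2 / v))) ?_
    (ENNReal.ofReal (Real.exp (-(c / 8 * (n * ε ^ 2))))) ?_ ?_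
    (ENNReal.ofReal (Real.exp (-(c / 2 * (n * ε ^ 2))))) ?_ ENNReal.ofReal_ne_top
    (ENNReal.ofReal δ) ?_ ENNReal.ofReal_ne_top) (final_arith (n := n) hδ hc hN
      ?_ ?_ ?_ rfl rfl)
  · exact hℓ.div (hℓ0.comp measurable_snd)
  · exact fun p z => ENNReal.div_ne_top ENNReal.ofReal_ne_top (h00 z)
  · intro p hp
    have hp1 := hA p hp
    obtain ⟨θ', h1, h2⟩ := hcov p.1
    by_cases ha : v + ε / 2 ≤ p.2
    · exact Set.mem_iUnion.2 ⟨Sum.inl (), ha⟩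
    · by_cases hb : p.2 ≤ v - ε / 2
      · exact Set.mem_iUnion.2 ⟨Sum.inr (Sum.inl ⟨θ', h1⟩), hb, h2⟩
      · have hve2 : ε / 2 ≤ v := by rw [← hve]; nlinarith
        have habs : |p.2 - v| ≤ ε / 2 := abs_le.2 ⟨by linarith, by linarith⟩
        exact Set.mem_iUnion.2 ⟨Sum.inr (Sum.inr ⟨θ', h1⟩), by linarith, by linarith,
          by linarith, h2⟩
  · rintro (_ | ⟨j, hj⟩ | ⟨j, hj⟩)
    · subst hμ
      obtain ⟨w, hw1, hw2, hw3, hw4⟩ := gauss_test_a PX hf₀ hv he0 he1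
      refine ⟨w, hw1, hw2, ?_, ?_⟩
      · intro p hp
        have hp' : v + ε / 2 ≤ p.2 := hp
        refine (hw4 _ (hsm p.1) p.2 (by rw [mul_add, hve]; linarith)).trans
          (ENNReal.ofReal_le_ofReal (Real.exp_le_exp.2 (by linarith)))
      · exact hw3.trans (ENNReal.ofReal_le_ofReal (Real.exp_le_exp.2 (by linarith)))
    · subst hμ
      obtain ⟨w, hw1, hw2, hw3, hw4⟩ := gauss_test_b PX hf₀ hv he0 he1 heF _ (hsm j) (hsb j)
      refine ⟨w, hw1, hw2, ?_, ?_⟩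
      · rintro p ⟨hp1, hp2⟩
        refine (hw4 _ (hsm p.1) (hsb p.1) p.2 (by rw [mul_sub, hve]; linarith) ?_).trans
          (ENNReal.ofReal_le_ofReal (Real.exp_le_exp.2 (by linarith)))
        refine le_trans hp2 ?_
        have : ε / (2 * v) * v / 16 = ε / 32 := by field_simp; ring
        rw [this]
        nlinarith
      · exact hw3.trans (ENNReal.ofReal_le_ofReal (Real.exp_le_exp.2 (by linarith)))
    · by_cases hne : ∃ p₁, p₁ ∈ Aj (Sum.inr (Sum.inr ⟨j, hj⟩))
      · subst hμ
        obtain ⟨w, hw1, hw2, hw3, hw4⟩ := gauss_test_c PX hf₀ hv hF ht0 ht htv hf₀F _ (hsm j) (hsb j)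
        have hU : (1 / 8 - 1 / 256) * ε ^ 2 ≤
            ∫ x, (f₀ x - trunc F (netOfParams ν d r L j x)) ^ 2 ∂PX := by
          obtain ⟨p₁, -, -, h1, h2⟩ := hne
          have h3 := l2dist_gt (by positivity) h1
          have h4 := integral_sq_tri PX (fun x => trunc F (netOfParams ν d r L p₁.1 x))
            (fun x => trunc F (netOfParams ν d r L j x)) f₀
            (hsm p₁.1) (hsm j) hf₀ F (hsb _) (hsb _) hf₀F
          have h5 : ∫ x, (trunc F (netOfParams ν d r L p₁.1 x) -
            trunc F (netOfParams ν d r L j x)) ^ 2 ∂PX ≤ (1 / 16 * ε) ^ 2 := h2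
          nlinarith
        have hU2 := mul_le_mul_of_nonneg_left hU (show 0 ≤ t / 4 by positivity)
        have hc3 : c * ε ^ 2 ≤ t / 64 * ε ^ 2 := by gcongr
        have hte : 0 ≤ t * ε ^ 2 := by positivity
        refine ⟨w, hw1, hw2, ?_, ?_⟩
        · rintro p ⟨hp1, hp2, -, hp4⟩
          refine (hw4 _ (hsm p.1) (hsb p.1) p.2 hp1 hp2).trans
            (ENNReal.ofReal_le_ofReal (Real.exp_le_exp.2 ?_))
          have h5 : ∫ x, (trunc F (netOfParams ν d r L p.1 x) -
            trunc F (netOfParams ν d r L j x)) ^ 2 ∂PX ≤ (1 / 16 * ε) ^ 2 := hp4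
          have h6 := mul_le_mul_of_nonneg_left h5 (show 0 ≤ 2 * t by positivity)
          nlinarith
        · refine hw3.trans (ENNReal.ofReal_le_ofReal (Real.exp_le_exp.2 ?_))
          nlinarith
      · obtain ⟨w, hw1, hw2, hw3⟩ := triv_test μ (c * ε ^ 2)
        exact ⟨w, hw1, hw2, fun θ hθ => absurd ⟨θ, hθ⟩ hne, hw3⟩
  · rintro p ⟨hp1, hp2⟩
    subst hμ
    exact gauss_chi PX (hsm p.1) hf₀ hv hp2.1 hp2.2 (hBτ p.1 hp1)
  · simp [Real.exp_pos]
  · rw [Measure.prod_prod]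
    refine le_trans (le_of_eq ?_) (mul_le_mul' hB hBσ)
    rw [← ENNReal.ofReal_mul (Real.exp_pos _).le, ← Real.exp_add]
    congr 2
    ring
  · simp [Real.exp_pos]
  · simp [hδ]
  · simp only [Fintype.card_sum, Fintype.card_unit, Fintype.card_coe]
    push_cast
    have : 1 ≤ Real.exp (c / 4 * (n * ε ^ 2)) := Real.one_le_exp (by positivity)
    linarith
  · exact exp_pow_le (le_of_eq (by ring))
  · exact exp_pow_le hτ

end Assembly


lemma rate_dom {P : Finset (ℝ × ℕ)} {hP : P.Nonempty} {ε : ℕ → ℝ} {γ : ℝ}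
    (hpos : ∀ p ∈ P, 0 < p.1) (hγ : 2 < γ)
    (hε : ∀ n : ℕ, ε n = maxRate P hP n * Real.log n ^ γ) {c : ℝ} (hc : 0 < c) {C : ℝ}
    (hC : 0 ≤ C) : ∀ᶠ n : ℕ in atTop, n * (C * maxRate P hP n ^ 2) ≤ c * (n * ε n ^ 2) := by
  filter_upwards [dominate (hP := hP) hpos hγ hε hc C, eventually_ge_atTop 3] with n h1 hn
  have h2 := log_ge_one hn
  have h3 := rate_sq (hP := hP) hpos (show 1 ≤ n by omega)
  have h4 : 1 ≤ Real.log n ^ 3 := one_le_pow₀ h2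
  have h5 : maxWidthExp P hP n ^ 2 ≤ maxWidthExp P hP n ^ 2 * Real.log n ^ 3 :=
    le_mul_of_one_le_right (sq_nonneg _) h4
  calc n * (C * maxRate P hP n ^ 2) = C * (n * maxRate P hP n ^ 2) := by ring
    _ = C * maxWidthExp P hP n ^ 2 := by rw [h3]
    _ ≤ _ := (mul_le_mul_of_nonneg_left h5 hC).trans h1

lemma bound_tendsto {u : ℕ → ℝ} (hu : Tendsto u atTop atTop) (C : ℝ) {c : ℝ} (hc : 0 < c) :
    Tendsto (fun n => ENNReal.ofReal (C * Real.exp (-(c * u n)))) atTop (nhds 0) := by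
  have h1 : Tendsto (fun n => -(c * u n)) atTop atBot :=
    tendsto_neg_atTop_atBot.comp (hu.const_mul_atTop hc)
  have h2 := (Real.tendsto_exp_atBot.comp h1).const_mul C
  have h3 := ENNReal.tendsto_ofReal h2
  simpa using h3

/-- posterior concentration under hierarchical composition structure.
If the true function follows `H(N, P)`, the architecture is determined by the constants
`C̃_L, C̃_r` of the hierarchical approximation lemma, the prior on the network parameters
satisfies Assumption 1 and the prior on the noise variance satisfies Assumption 2, then for
`ε_n = max_{(β',d') ∈ P} n^{−β'/(2β'+d')} (log n)^γ`, `γ > 2`, and any `M_n → ∞`, the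
posterior mass of the bad set converges to `0` in `P₀ⁿ`-probability, both in the
nonparametric Gaussian regression model and in the nonparametric logistic regression
model. -/
theorem posterior_concentration_hierarchical_composition
    (a : ℝ) (ha : 1 ≤ a) (d : ℕ) (hd : 0 < d) (ν : ℝ) (hν0 : 0 ≤ ν) (hν1 : ν < 1)
    (q : ℕ) (N : ℕ → ℕ) (P : Finset (ℝ × ℕ)) (hP : P.Nonempty)
    (βmin βmax : ℝ) (dmax : ℕ) (hβmin : 0 < βmin)
    (hPsub : ∀ p ∈ P, βmin ≤ p.1 ∧ p.1 ≤ βmax ∧ 1 ≤ p.2 ∧ p.2 ≤ dmax)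
    (K F CLip : ℝ) (hK : 1 ≤ K) (hF : 1 ≤ F) (hCLip : 1 ≤ CLip)
    (σ₀ : ℝ) (hσ₀ : 0 < σ₀)
    -- the true function follows the hierarchical composition structure
    (f₀ : (Fin d → ℝ) → ℝ) (hf₀ : followsHCS a d q N P K F CLip f₀)
    (hf₀bd : ∀ x, |f₀ x| ≤ F)
    -- the covariate distribution, supported in the cube `[−a,a]^d`
    (PX : Measure (Fin d → ℝ)) (hPXprob : IsProbabilityMeasure PX)
    (hPXsupp : PX (cube a d) = 1)
    -- the law of one observation in the Gaussian regression model
    (μG : Measure ((Fin d → ℝ) × ℝ)) (hμGprob : IsProbabilityMeasure μG)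
    (hμG : μG = gaussRegLaw d PX f₀ (Real.toNNReal (σ₀ ^ 2)))
    -- the law of one observation in the logistic regression model
    (μB : Measure ((Fin d → ℝ) × ℝ)) (hμBprob : IsProbabilityMeasure μB)
    (hμB : μB = logisticLaw d PX f₀)
    -- the constants of the hierarchical approximation lemma
    (CL Cr CB c₂ : ℝ) (hCL : 0 < CL) (hCr : 0 < Cr) (hCB : 0 < CB) (hc₂ : 0 < c₂)
    (happrox : ∀ f : (Fin d → ℝ) → ℝ, followsHCS a d q N P K F CLip f →
      ∃ n₀ : ℕ, ∀ n : ℕ, n₀ ≤ n →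
        ∃ g : (Fin d → ℝ) → ℝ,
          memDNN ν d (LdepthH CL n) (rwidthH Cr P hP n) CB g ∧
          ∀ x ∈ cube a d, |g x - f x| ≤ c₂ * maxRate P hP n)
    -- the prior on the network parameters, with density satisfying Assumption 1
    (Prθ : ∀ n : ℕ, Measure (ParamIdx d (rwidthH Cr P hP n) (LdepthH CL n) → ℝ))
    (hPrθprob : ∀ n, IsProbabilityMeasure (Prθ n))
    (πθ : ∀ n : ℕ, (ParamIdx d (rwidthH Cr P hP n) (LdepthH CL n) → ℝ) → ℝ)
    (hπθmeas : ∀ n, Measurable (πθ n)) (hπθnn : ∀ n θ, 0 ≤ πθ n θ)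
    (hπθdens : ∀ n, Prθ n = volume.withDensity fun θ => ENNReal.ofReal (πθ n θ))
    (hπθlow : ∀ κ : ℝ, 0 < κ → ∃ δκ : ℝ, 0 < δκ ∧
      ∀ n : ℕ, ∀ θ : ParamIdx d (rwidthH Cr P hP n) (LdepthH CL n) → ℝ,
        (∀ i, |θ i| ≤ κ) →
          δκ ^ Fintype.card (ParamIdx d (rwidthH Cr P hP n) (LdepthH CL n)) ≤ πθ n θ)
    -- the prior on the noise variance, satisfying Assumption 2
    (Prσ : Measure ℝ) (hPrσprob : IsProbabilityMeasure Prσ)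
    (qσ : ℝ → ℝ) (hqσmeas : Measurable qσ) (hqσnn : ∀ s, 0 ≤ qσ s)
    (hqσdens : Prσ = volume.withDensity fun s => ENNReal.ofReal (qσ s))
    (hqσpos : Prσ {s | s ≤ 0} = 0)
    (hqσcont : ContinuousOn qσ (Set.Ioo 0 (2 * σ₀ ^ 2)))
    (hqσposOn : ∀ s ∈ Set.Ioo 0 (2 * σ₀ ^ 2), 0 < qσ s)
    (hqσtail : ∃ C : ℝ, 0 < C ∧ ∃ K₀ : ℝ, ∀ K' : ℝ, K₀ ≤ K' →
      Prσ {s | K' < s} ≤ ENNReal.ofReal (C / K'))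
    -- the rate `ε_n = max_{(β',d') ∈ P} n^{−β'/(2β'+d')} (log n)^γ` with `γ > 2`
    (γ : ℝ) (hγ : 2 < γ)
    (ε : ℕ → ℝ) (hε : ∀ n : ℕ, ε n = maxRate P hP n * Real.log n ^ γ)
    (M : ℕ → ℝ) (hM : Tendsto M atTop atTop) :
    -- Gaussian regression case
    (∀ δ : ℝ, 0 < δ →
      Tendsto
        (fun n : ℕ =>
          Measure.pi (fun _ : Fin n => μG)
            {D | ENNReal.ofReal δ <
              postMass ((Prθ n).prod Prσ)
                (gaussLik ν F d (rwidthH Cr P hP n) (LdepthH CL n) D)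
                {p | M n * ε n <
                  l2dist d PX
                    (fun x =>
                      trunc F (netOfParams ν d (rwidthH Cr P hP n) (LdepthH CL n) p.1 x))
                    f₀ + |p.2 - σ₀ ^ 2|}})
        atTop (nhds 0)) ∧
    -- logistic regression case
    (∀ δ : ℝ, 0 < δ →
      Tendsto
        (fun n : ℕ =>
          Measure.pi (fun _ : Fin n => μB)
            {D | ENNReal.ofReal δ <
              postMass (Prθ n)
                (bernLik ν F d (rwidthH Cr P hP n) (LdepthH CL n) D)
                {θ | M n * ε n <
                  l2dist d PX
                    (fun x => sigmoid
                      (trunc F (netOfParams ν d (rwidthH Cr P hP n) (LdepthH CL n) θ x)))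
                    (fun x => sigmoid (f₀ x))}})
        atTop (nhds 0)) := by
  have hpos : ∀ p ∈ P, 0 < p.1 := fun p hp => hβmin.trans_le (hPsub p hp).1
  have hf₀m : Measurable f₀ := hcs_measurable hf₀
  have hF0 : 0 < F := by linarith
  have hcubem : MeasurableSet (cube a d) := by
    have : cube a d = Set.pi Set.univ fun _ => Set.Icc (-a) a := by
      ext x; simp only [cube, Set.mem_ofPred_eq, Set.mem_pi, Set.mem_univ, forall_const]
    rw [this]
    exact MeasurableSet.univ_pi fun _ => measurableSet_Icc
  have hae : ∀ᵐ x ∂PX, x ∈ cube a d := (mem_ae_iff_prob_eq_one hcubem).2 hPXsupp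
  have hepos : ∀ n, 3 ≤ n → 0 < ε n := fun n hn =>
    (rate_pos hpos (show 1 ≤ n by omega)).trans_le (eps_ge hpos hγ hε hn)
  have hn2 := neps_tendsto hpos hγ hε
  have heps := eps_tendsto hpos hε
  refine ⟨fun δ hδ => ?_, fun δ hδ => ?_⟩
  · have hv : 0 < σ₀ ^ 2 := by positivity
    generalize σ₀ ^ 2 = v at *
    obtain ⟨t, ht⟩ : ∃ t, t = 1 / (8 * (v + 16 * F ^ 2)) := ⟨_, rfl⟩
    have ht0 : 0 < t := by rw [ht]; positivity
    have ht1 : t * (v + 16 * F ^ 2) = 1 / 8 := by rw [ht]; field_simp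
    have htv : 2 * t * v ≤ 1 := by nlinarith [mul_nonneg ht0.le (sq_nonneg F)]
    obtain ⟨c, hc⟩ : ∃ c, c = min (1 / (256 * v ^ 2)) (t / 64) := ⟨_, rfl⟩
    have hc0 : 0 < c := by rw [hc]; exact lt_min (by positivity) (by positivity)
    have hc1 : c ≤ 1 / (256 * v ^ 2) := hc ▸ min_le_left _ _
    have hc2 : c ≤ t / 64 := hc ▸ min_le_right _ _
    refine tendsto_of_tendsto_of_tendsto_of_le_of_le' tendsto_const_nhds
      (bound_tendsto hn2 (7 + 3 / δ) (show 0 < c / 4 by positivity))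
      (Eventually.of_forall fun n => zero_le) ?_
    filter_upwards [eventually_ge_atTop 3, hM.eventually_ge_atTop 1,
      heps.eventually_le_const (show (0 : ℝ) < 1 by norm_num),
      heps.eventually_le_const (show 0 < 2 * v by positivity),
      heps.eventually_le_const (show 0 < 2 * v * v / F ^ 2 by positivity),
      net_entropy hpos hγ hε hCL hCr hν1 hF0 PX (show 0 < c / 4 by positivity)
        (show (0 : ℝ) < 1 / 16 by norm_num),
      prior_net hpos hγ hε ha hCL hCr hCB hν0 hν1 hf₀bd (happrox f₀ hf₀) Prθ πθ hπθdens hπθlow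
        (show 0 < c / 16 by positivity),
      prior_sigma hpos hγ hε Prσ qσ hv hqσdens hqσcont hqσposOn (show 0 < c / 16 by positivity),
      rate_dom (hP := hP) hpos hγ hε (show 0 < c / 16 by positivity)
        (show 0 ≤ 1 / v ^ 2 + (1 + c₂) ^ 2 / v by positivity)]
      with n hn hMn he1 he2 he3 hS hB hBσ hτ
    obtain ⟨S, hS, hcov⟩ := hS
    obtain ⟨B, hB, hBτ⟩ := hB
    have hen := hepos n hn
    haveI := hPrθprob n
    refine gauss_core hF0 hen hδ hv ht0 ht1.le htv hc0 hc1 hc2 ?_ ?_ he1 PX hf₀m hf₀bd μG hμG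
      (Prθ n) Prσ S hS hcov B hB hBσ (fun θ hθ => hae.mono fun x hx => hBτ θ hθ x hx) ?_ _ ?_
    · rw [div_le_one (by positivity)]; exact he2
    · rw [le_div_iff₀ (by positivity)] at he3
      rw [div_mul_eq_mul_div, div_le_iff₀ (by positivity)]
      linarith
    · refine le_of_eq_of_le ?_ hτ
      ring
    · intro p hp
      exact (le_mul_of_one_le_left hen.le hMn).trans_lt hp
  · have hs : 0 < sigmoid (-F) := (sigmoid_mem _).1
    refine tendsto_of_tendsto_of_tendsto_of_le_of_le' tendsto_const_nhds
      (bound_tendsto hn2 (7 + 3 / δ) (show (0 : ℝ) < (1 / 100) / 4 by norm_num))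
      (Eventually.of_forall fun n => zero_le) ?_
    filter_upwards [eventually_ge_atTop 3, hM.eventually_ge_atTop 1,
      net_entropy hpos hγ hε hCL hCr hν1 hF0 PX (show (0 : ℝ) < (1 / 100) / 4 by norm_num)
        (show (0 : ℝ) < 1 / 8 by norm_num),
      prior_net hpos hγ hε ha hCL hCr hCB hν0 hν1 hf₀bd (happrox f₀ hf₀) Prθ πθ hπθdens hπθlow
        (show (0 : ℝ) < (1 / 100) / 8 by norm_num),
      rate_dom (hP := hP) hpos hγ hε (show (0 : ℝ) < (1 / 100) / 16 by norm_num)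
        (show 0 ≤ (1 + c₂) ^ 2 / sigmoid (-F) ^ 2 by positivity)]
      with n hn hMn hS hB hτ
    obtain ⟨S, hS, hcov⟩ := hS
    obtain ⟨B, hB, hBτ⟩ := hB
    have hen := hepos n hn
    haveI := hPrθprob n
    refine logistic_core hF0 hen hδ PX hf₀m μB hμB
      (Prθ n) S hS hcov B hB (fun θ hθ => hae.mono fun x hx => hBτ θ hθ x hx) ?_ _ ?_
    · refine le_of_eq_of_le ?_ hτ
      ring
    · intro p hp
      exact (le_mul_of_one_le_left hen.le hMn).trans_lt hp
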